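/- Let n ∈ ℕ. Let (C,u) be an equicharacteristic ℤ-valued field with uniformizer π such that O_u is excellent, and let (K,v) and (L,w) be henselian valued field extensions of (C,u) in which π is still a uniformizer, such that the residue field extensions Kv/Cu and Lw/Cu are separable. Assume (R4_{n+1}) holds. If Th_{∃_n}(Kv,Cu) ⊆ Th_{∃_n}(Lw,Cu) (as L_ring(Cu)-theories), then Th_{∃_n}(K,v,C) ⊆ Th_{∃_n}(L,w,C) (as L_val(C)-theories). -/

import Mathlib

open FirstOrder FirstOrder.Language

universe u v w x

namespace Paper



/-! ### Syntactic fragments -/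

/-- `IsExistsN n φ`: `φ` is an `∃_n`-formula, i.e. of the form `∃ x₁ … x_m ψ`
with `m ≤ n` and `ψ` quantifier-free. -/
inductive IsExistsN {L : Language} {α : Type*} : ℕ → ∀ {k : ℕ}, L.BoundedFormula α k → Prop
  | qf {n k : ℕ} {φ : L.BoundedFormula α k} : φ.IsQF → IsExistsN n φ
  | ex {n k : ℕ} {φ : L.BoundedFormula α (k + 1)} : IsExistsN n φ → IsExistsN (n + 1) φ.ex

/-- `φ` is an existential formula. -/
def IsExists {L : Language} {α : Type*} {k : ℕ} (φ : L.BoundedFormula α k) : Prop :=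
  ∃ n : ℕ, IsExistsN n φ

/-- Positive boolean combinations of formulas satisfying `P`. -/
inductive IsPosBC {L : Language} {α : Type*} (P : ∀ {k : ℕ}, L.BoundedFormula α k → Prop) :
    ∀ {k : ℕ}, L.BoundedFormula α k → Prop
  | base {k : ℕ} {φ : L.BoundedFormula α k} : P φ → IsPosBC P φ
  | inf {k : ℕ} {φ ψ : L.BoundedFormula α k} :
      IsPosBC P φ → IsPosBC P ψ → IsPosBC P (φ ⊓ ψ)
  | sup {k : ℕ} {φ ψ : L.BoundedFormula α k} :
      IsPosBC P φ → IsPosBC P ψ → IsPosBC P (φ ⊔ ψ)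

/-- The `∃₁`-fragment: positive boolean combinations of formulas of the form `η` or `∃ y η`
with `η` quantifier-free. -/
def IsE1 {L : Language} {α : Type*} {k : ℕ} (φ : L.BoundedFormula α k) : Prop :=
  IsPosBC (fun {k} φ => φ.IsQF ∨ ∃ ψ : L.BoundedFormula α (k + 1), ψ.IsQF ∧ φ = ψ.ex) φ

/-- `∃_n∃₁`-formulas: `∃ x₁ … x_m ψ` with `m ≤ n` and `ψ` in the `∃₁`-fragment. -/
inductive IsExistsNE1 {L : Language} {α : Type*} : ℕ → ∀ {k : ℕ}, L.BoundedFormula α k → Prop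
  | e1 {n k : ℕ} {φ : L.BoundedFormula α k} : IsE1 φ → IsExistsNE1 n φ
  | ex {n k : ℕ} {φ : L.BoundedFormula α (k + 1)} : IsExistsNE1 n φ → IsExistsNE1 (n + 1) φ.ex

/-- The `∃^n`-fragments, defined inductively: `∃^0`-formulas are the quantifier-free ones,
and an `∃^{n+1}`-formula is of the form `ψ` or `∃ x ψ` with `ψ` a positive boolean
combination of `∃^n`-formulas. -/
def IsExpN {L : Language} {α : Type*} : ℕ → ∀ {k : ℕ}, L.BoundedFormula α k → Prop
  | 0, _, φ => φ.IsQF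
  | n + 1, k, φ => IsPosBC (IsExpN n) φ ∨
      ∃ ψ : L.BoundedFormula α (k + 1), IsPosBC (IsExpN n) ψ ∧ φ = ψ.ex



/-! ### The language of rings with constants, and realization -/

/-- The `Language.ring`-structure on a ring. -/
noncomputable def ringStructure (M : Type*) [CommRing M] : Language.ring.Structure M :=
  (FirstOrder.Ring.compatibleRingOfRing M).toStructure

/-- The `L_ring(α)`-structure on a ring `M` with constants interpreted via `f : α → M`. -/
noncomputable def ringConStructure {α M : Type*} [CommRing M] (f : α → M) :
    (Language.ring[[α]]).Structure M :=
  letI := ringStructure M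
  letI := constantsOn.structure f
  inferInstance

/-- `M ⊨ φ` for an `L_ring(α)`-sentence, with constants interpreted via `f`. -/
def RealizeRing (M : Type*) [CommRing M] {α : Type*} (f : α → M)
    (φ : (Language.ring[[α]]).Sentence) : Prop :=
  @Sentence.Realize _ M (ringConStructure f) φ

/-- The unary relation symbol `O` for the valuation ring. -/
inductive ValRel : ℕ → Type
  | isO : ValRel 1

/-- The language with a single unary predicate `O`. -/
def oLang : Language := ⟨fun _ => Empty, ValRel⟩

/-- The language of valued fields `L_val = L_ring ∪ {O}`. -/
abbrev Lval : Language := Language.ring.sum oLang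

/-- The `oLang`-structure on `M` in which `O` is interpreted as the set `O`. -/
def oStructure {M : Type*} (O : Set M) : oLang.Structure M where
  funMap := fun f _ => f.elim
  RelMap := fun {_} r => match r with
    | .isO => fun xs => xs 0 ∈ O

/-- The `L_val(α)`-structure on a ring `M`, with `O` interpreted as the set `O` and
constants interpreted via `f : α → M`. -/
noncomputable def valConStructure {α M : Type*} [CommRing M] (O : Set M) (f : α → M) :
    (Lval[[α]]).Structure M :=
  letI := ringStructure M
  letI := oStructure O
  letI : Lval.Structure M := inferInstance
  letI := constantsOn.structure f
  inferInstance

/-- `M ⊨ φ` for an `L_val(α)`-sentence. -/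
def RealizeVal (M : Type*) [CommRing M] (O : Set M) {α : Type*} (f : α → M)
    (φ : (Lval[[α]]).Sentence) : Prop :=
  @Sentence.Realize _ M (valConStructure O f) φ



abbrev Zm0 : Type := WithZero (Multiplicative ℤ)

variable {K : Type*} [Field K] {Γ : Type*} [LinearOrderedCommGroupWithZero Γ]

/-- `π` is a uniformizer of `(K, v)`: `v π` is minimal positive
(multiplicatively: `0 < v π < 1` and `v π` is the largest value `< 1`). -/
def IsUniformizer (v : Valuation K Γ) (π : K) : Prop :=
  0 < v π ∧ v π < 1 ∧ ∀ x : K, v x < 1 → v x ≤ v π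

/-- The valuation ring of `v`, as a set. -/
def Oset (v : Valuation K Γ) : Set K := {x | v x ≤ 1}

/-- The residue field `Kv` of the valued field `(K, v)`. -/
abbrev ResF (v : Valuation K Γ) : Type _ :=
  IsLocalRing.ResidueField v.valuationSubring

/-- The residue map `O_v → Kv`. -/
abbrev resMap (v : Valuation K Γ) : v.valuationSubring →+* ResF v :=
  IsLocalRing.residue _

/-- `(K, v)` is a henselian valued field. -/
abbrev IsHenselian (v : Valuation K Γ) : Prop :=
  HenselianLocalRing v.valuationSubring

/-- compatibility of a ring homomorphism between residue fields with the residue maps,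
for an extension `(K, v)` of `(C, u)`. -/
def ResCompat {C : Type*} [Field C] {Γ₀ : Type*} [LinearOrderedCommGroupWithZero Γ₀]
    (u : Valuation C Γ₀) [Algebra C K] (v : Valuation K Γ)
    (g : ResF u →+* ResF v) : Prop :=
  ∀ (x : u.valuationSubring) (hx : algebraMap C K ↑x ∈ v.valuationSubring),
    g (resMap u x) = resMap v ⟨algebraMap C K ↑x, hx⟩

/-- `(K, v)` is complete (with respect to the valuation uniformity). -/
def IsCompleteValued (v : Valuation K Γ) : Prop :=
  letI : Valued K Γ := Valued.mk' v
  CompleteSpace K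



/-- `E/F` admits a separating transcendence basis. -/
def HasSepTransBasis (F E : Type*) [Field F] [Field E] [Algebra F E] : Prop :=
  ∃ s : Set E, AlgebraicIndependent F ((↑) : s → E) ∧
    Algebra.IsSeparable (IntermediateField.adjoin F s) E

/-- The field extension `E/F` is separable: every finitely generated subextension
admits a separating transcendence basis. -/
def IsSepExt (F E : Type*) [Field F] [Field E] [Algebra F E] : Prop :=
  ∀ s : Finset E, HasSepTransBasis F (IntermediateField.adjoin F (s : Set E))

/-- The extension given by a ring homomorphism `f : F →+* E` of fields is separable. -/
def IsSepExtHom {F E : Type*} [Field F] [Field E] (f : F →+* E) : Prop :=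
  letI := f.toAlgebra
  IsSepExt F E

/-- `trdeg(E/F) ≤ d`: there is a finite transcendence basis with at most `d` elements. -/
def TrdegLE (F E : Type*) [CommRing F] [CommRing E] [Algebra F E] (d : ℕ) : Prop :=
  ∃ s : Finset E, s.card ≤ d ∧ IsTranscendenceBasis F (Subtype.val : ((s : Set E)) → E)

/-- `F` is a large field: `F` is existentially closed in `F((t))`. -/
def LargeField (F : Type u) [Field F] : Prop :=
  ∀ φ : (Language.ring[[F]]).Sentence, IsExists φ →
    RealizeRing (LaurentSeries F) (algebraMap F (LaurentSeries F)) φ →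
    RealizeRing F (id : F → F) φ

/-- `(R4_n)`: whenever a valuation `w` on a field `E` is trivial on a large subfield `F` of `E`
with residue field `Eu = F` (via the residue map), every `∃_n`-`L_ring(F)`-sentence true in `E`
is true in `F`. -/
def R4N (n : ℕ) : Prop :=
  ∀ (E : Type u) [Field E] (Γ : Type u) [LinearOrderedCommGroupWithZero Γ]
    (w : Valuation E Γ) (F : Subfield E),
    LargeField.{u} F →
    (∀ y : F, (y : E) ≠ 0 → w y = 1) →
    (∀ y : E, w y ≤ 1 → ∃ x : F, w (y - x) < 1) →
    ∀ φ : (Language.ring[[F]]).Sentence, IsExistsN n φ →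
      RealizeRing E ((↑) : F → E) φ → RealizeRing F (id : F → F) φ

/-- Excellence of the valuation ring of an (equicharacteristic, `ℤ`-valued) valued field
`(C, u)`, via the characterization: the fraction field of the completion (i.e. the completion
of `C`) is a separable extension of `C`. -/
def ExcellentCompletion (C : Type u) [Field C] (u : Valuation C Zm0) : Prop :=
  letI : Valued C Zm0 := Valued.mk' u
  letI : Field (UniformSpace.Completion C) := UniformSpace.Completion.instField
  IsSepExtHom (UniformSpace.Completion.coeRingHom : C →+* UniformSpace.Completion C)


/-- `Th_P(K, fK) ⊆ Th_P(L, fL)`: every positive boolean combination of `L_ring(α)`-sentences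
of the fragment `P` that is true in `K` is true in `L`. -/
def ThRingSub {α : Type*} (P : ∀ {k : ℕ}, (Language.ring[[α]]).BoundedFormula Empty k → Prop)
    (K : Type*) [CommRing K] (fK : α → K) (L : Type*) [CommRing L] (fL : α → L) : Prop :=
  ∀ φ : (Language.ring[[α]]).Sentence, IsPosBC P φ →
    RealizeRing K fK φ → RealizeRing L fL φ

/-- `Th_P(K, OK, fK) ⊆ Th_P(L, OL, fL)` for `L_val(α)`-sentences. -/
def ThValSub {α : Type*} (P : ∀ {k : ℕ}, (Lval[[α]]).BoundedFormula Empty k → Prop)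
    (K : Type*) [CommRing K] (OK : Set K) (fK : α → K)
    (L : Type*) [CommRing L] (OL : Set L) (fL : α → L) : Prop :=
  ∀ φ : (Lval[[α]]).Sentence, IsPosBC P φ →
    RealizeVal K OK fK φ → RealizeVal L OL fL φ

end Paper

namespace Paper

section Separability

variable {S T Ω : Type*} [Field S] [Field T] [Field Ω]

/-- MacLane's condition for separability of an extension given by a homomorphism of fields:
elements of the base independent over the `p`-th powers stay independent. -/
def SepHom (f : S →+* Ω) : Prop :=
  ∀ p : ℕ, p.Prime → CharP S p → ∀ (n : ℕ) (e : Fin n → S) (y : Fin n → Ω),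
    ∑ j, f (e j) * y j ^ p = 0 → y ≠ 0 → ∃ z : Fin n → S, z ≠ 0 ∧ ∑ j, e j * z j ^ p = 0

theorem SepHom.comp {f : S →+* T} {g : T →+* Ω} (hf : SepHom f) (hg : SepHom g) :
    SepHom (g.comp f) := by
  intro p hp hc n e y h hy
  have : CharP T p := (RingHom.charP_iff f f.injective p).1 hc
  obtain ⟨z, hz, hz'⟩ := hg p hp this n (fun j => f (e j)) y h hy
  exact hf p hp hc n e z hz' hz

theorem SepHom.of_comp {f : S →+* T} {g : T →+* Ω} (h : SepHom (g.comp f)) : SepHom f := by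
  intro p hp hc n e y hy hy0
  refine h p hp hc n e (fun j => g (y j)) ?_ ?_
  · simpa using congrArg g hy
  · intro h0
    exact hy0 (funext fun j => g.injective (by simpa using congrFun h0 j))

theorem exists_independent_expansion {ι : Type*} [Finite ι] (φ : S →+* Ω) (c : ι → Ω) :
    ∃ (r : ℕ) (e : Fin r → Ω) (s : ι → Fin r → S), (∀ j, c j = ∑ l, φ (s j l) * e l) ∧
      ∀ z : Fin r → S, ∑ l, φ (z l) * e l = 0 → z = 0 := by
  let _ := φ.toAlgebra
  let V := Submodule.span S (Set.range c)
  have : FiniteDimensional S V := FiniteDimensional.span_of_finite S (Set.finite_range c)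
  let b := Module.finBasis S V
  refine ⟨_, fun l => (b l : Ω), fun j l => b.repr ⟨c j, Submodule.subset_span ⟨j, rfl⟩⟩ l,
    fun j => ?_, fun z hz => ?_⟩
  · have := congrArg Subtype.val (b.sum_repr ⟨c j, Submodule.subset_span ⟨j, rfl⟩⟩)
    refine this.symm.trans ?_
    rw [Submodule.coe_sum]
    exact Finset.sum_congr rfl fun l _ => Algebra.smul_def _ _
  · have h : ∑ l, z l • b l = 0 := by
      apply Subtype.ext
      simpa [Algebra.smul_def, RingHom.algebraMap_toAlgebra] using hz
    exact funext fun l => (Fintype.linearIndependent_iff.1 b.linearIndependent) z h l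

theorem SepHom.relation {f : S →+* Ω} (hf : SepHom f) {p : ℕ} (hp : p.Prime) [CharP S p]
    {n : ℕ} (c : Fin n → S) (y : Fin n → Ω) (h : ∑ j, f (c j) * y j ^ p = 0) (hc : c ≠ 0) :
    ∃ d : Fin n → S, d ≠ 0 ∧ ∑ j, f (d j) * y j = 0 := by
  have := Fact.mk hp
  have : CharP Ω p := (RingHom.charP_iff f f.injective p).1 inferInstance
  obtain ⟨r, e, s, hs, he⟩ := exists_independent_expansion (frobenius S p) c
  have h1 : ∑ l, f (e l) * (∑ j, f (s j l) * y j) ^ p = 0 := by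
    rw [← h]
    simp_rw [sum_pow_char p, Finset.mul_sum]
    rw [Finset.sum_comm]
    refine Finset.sum_congr rfl fun j _ => ?_
    rw [hs j, map_sum, Finset.sum_mul]
    refine Finset.sum_congr rfl fun l _ => ?_
    simp [frobenius_def]; ring
  by_cases h2 : (fun l => ∑ j, f (s j l) * y j) = 0
  · obtain ⟨j, hj⟩ := Function.ne_iff.1 hc
    have : ∃ l, s j l ≠ 0 := by
      by_contra! hh
      exact hj (by rw [hs j]; simp [hh, frobenius_def, hp.ne_zero])
    obtain ⟨l, hl⟩ := this
    exact ⟨fun j => s j l, fun h0 => hl (congrFun h0 j), congrFun h2 l⟩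
  · obtain ⟨z, hz, hz'⟩ := hf p hp inferInstance r e _ h1 h2
    exact absurd (he z (by simpa [frobenius_def, mul_comm] using hz')) hz

theorem sepHom_of_relation {f : S →+* Ω}
    (H : ∀ p : ℕ, p.Prime → CharP S p → ∀ (n : ℕ) (c : Fin n → S) (y : Fin n → Ω),
      ∑ j, f (c j) * y j ^ p = 0 → (∀ d : Fin n → S, ∑ j, f (d j) * y j = 0 → d = 0) → c = 0) :
    SepHom f := by
  intro p hp hc n e y h hy
  have := Fact.mk hp
  have : CharP Ω p := (RingHom.charP_iff f f.injective p).1 inferInstance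
  obtain ⟨r, b, s, hs, hb⟩ := exists_independent_expansion f y
  have h1 : ∑ l, f (∑ j, e j * s j l ^ p) * b l ^ p = 0 := by
    rw [← h]
    simp_rw [map_sum, Finset.sum_mul]
    rw [Finset.sum_comm]
    refine Finset.sum_congr rfl fun j _ => ?_
    rw [hs j, sum_pow_char p, Finset.mul_sum]
    refine Finset.sum_congr rfl fun l _ => ?_
    simp; ring
  have h2 := H p hp hc r _ b h1 hb
  obtain ⟨j, hj⟩ := Function.ne_iff.1 hy
  have : ∃ l, s j l ≠ 0 := by
    by_contra! hh
    exact hj (by rw [hs j]; simp [hh])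
  obtain ⟨l, hl⟩ := this
  exact ⟨fun j => s j l, fun h0 => hl (congrFun h0 j), congrFun h2 l⟩

theorem SepHom.linearIndepOn_pow [Algebra S Ω] (hf : SepHom (algebraMap S Ω))
    {p : ℕ} (hp : p.Prime) [CharP S p] (s : Finset Ω) (hs : LinearIndepOn S id (s : Set Ω)) :
    LinearIndepOn S (· ^ p) (s : Set Ω) := by
  rw [LinearIndepOn, Fintype.linearIndependent_iff] at hs ⊢
  intro c h
  by_contra! hc
  let e := Fintype.equivFin (s : Set Ω)
  obtain ⟨d, hd, hd'⟩ := hf.relation hp (fun j => c (e.symm j)) (fun j => (e.symm j : Ω))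
    (by
      rw [← h, ← e.symm.sum_comp]
      exact Finset.sum_congr rfl fun j _ => by rw [Algebra.smul_def])
    (fun h0 => by
      obtain ⟨i, hi⟩ := hc
      exact hi (by simpa using congrFun h0 (e i)))
  refine hd (funext fun j => ?_)
  have := hs (fun i => d (e i)) (by
    rw [← hd', ← e.symm.sum_comp]
    exact Finset.sum_congr rfl fun j _ => by simp [Algebra.smul_def])
  simpa using this (e.symm j)

theorem sepHom_of_isSeparable [Algebra S Ω] [Algebra.IsSeparable S Ω] :
    SepHom (algebraMap S Ω) := by
  refine sepHom_of_relation fun p hp hc n c y h hy => ?_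
  have := Fact.mk hp
  have : ExpChar S p := ExpChar.prime hp
  have hli : LinearIndependent S y := by
    rw [Fintype.linearIndependent_iff]
    intro g hg i
    exact congrFun (hy g (by simpa [Algebra.smul_def] using hg)) i
  have := hli.map_pow_expChar_pow_of_isSeparable p 1
  rw [Fintype.linearIndependent_iff] at this
  exact funext fun i => this c (by simpa [Algebra.smul_def] using h) i

theorem sepHom_of_isFractionRing_mvPolynomial {ι : Type*} [Algebra (MvPolynomial ι S) Ω]
    [IsFractionRing (MvPolynomial ι S) Ω] :
    SepHom ((algebraMap (MvPolynomial ι S) Ω).comp MvPolynomial.C) := by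
  intro p hp hc n e y h hy
  have := Fact.mk hp
  obtain ⟨b, hb⟩ := IsLocalization.exist_integer_multiples_of_finite
    (nonZeroDivisors (MvPolynomial ι S)) y
  choose q hq using hb
  have hb0 : algebraMap (MvPolynomial ι S) Ω (b : MvPolynomial ι S) ≠ 0 := by
    simp
  have h1 : ∑ j, MvPolynomial.C (e j) * q j ^ p = 0 := by
    apply IsFractionRing.injective (MvPolynomial ι S) Ω
    have : ∑ j, algebraMap (MvPolynomial ι S) Ω (MvPolynomial.C (e j)) *
        (algebraMap _ Ω (b : MvPolynomial ι S) * y j) ^ p =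
          algebraMap _ Ω (b : MvPolynomial ι S) ^ p *
          ∑ j, algebraMap (MvPolynomial ι S) Ω (MvPolynomial.C (e j)) * y j ^ p := by
      rw [Finset.mul_sum]
      exact Finset.sum_congr rfl fun j _ => by ring
    rw [map_zero, map_sum]
    simp only [map_mul, map_pow, hq, Algebra.smul_def]
    rw [this]
    simp only [RingHom.comp_apply] at h
    rw [h, mul_zero]
  obtain ⟨j, hj⟩ := Function.ne_iff.1 hy
  have hqj : q j ≠ 0 := by
    intro h0
    have := hq j
    rw [h0, map_zero, Algebra.smul_def] at this
    exact (mul_ne_zero hb0 hj) this.symm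
  obtain ⟨m, hm⟩ := MvPolynomial.ne_zero_iff.1 hqj
  refine ⟨fun j => (q j).coeff m, fun h0 => hm (congrFun h0 j), ?_⟩
  have h2 := congrArg (MvPolynomial.coeff (p • m)) h1
  rw [MvPolynomial.coeff_sum] at h2
  rw [MvPolynomial.coeff_zero] at h2
  rw [← h2]
  refine Finset.sum_congr rfl fun j _ => ?_
  rw [MvPolynomial.coeff_C_mul, ← MvPolynomial.map_frobenius_expand, MvPolynomial.coeff_map,
    MvPolynomial.coeff_expand_smul p hp.ne_zero, frobenius_def]

open scoped IntermediateField.algebraAdjoinAdjoin in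
theorem sepHom_of_hasSepTransBasis [Algebra S Ω] (h : HasSepTransBasis S Ω) :
    SepHom (algebraMap S Ω) := by
  obtain ⟨t, ht, hts⟩ := h
  have h1 : SepHom (algebraMap (IntermediateField.adjoin S t) Ω) := sepHom_of_isSeparable
  let e : MvPolynomial t S ≃ₐ[S] Algebra.adjoin S t :=
    ht.aevalEquiv.trans (Subalgebra.equivOfEq _ _ (by simp))
  let _ : Algebra (MvPolynomial t S) (IntermediateField.adjoin S t) :=
    ((algebraMap (Algebra.adjoin S t) (IntermediateField.adjoin S t)).comp
      e.toRingEquiv.toRingHom).toAlgebra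
  have : IsFractionRing (MvPolynomial t S) (IntermediateField.adjoin S t) :=
    (IsFractionRing.isFractionRing_iff_of_base_ringEquiv _ e.symm.toRingEquiv).1 inferInstance
  have h2 := sepHom_of_isFractionRing_mvPolynomial (S := S) (ι := t)
    (Ω := IntermediateField.adjoin S t)
  convert h2.comp h1 using 1
  ext x
  have : e (MvPolynomial.C x) = algebraMap S _ x := e.commutes x
  simp only [RingHom.comp_apply, RingHom.algebraMap_toAlgebra]
  change _ = algebraMap _ Ω (algebraMap (Algebra.adjoin S t) (IntermediateField.adjoin S t)
    (e (MvPolynomial.C x)))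
  rw [this]
  rfl

theorem SepHom.of_isSepExtHom {f : S →+* Ω} (hf : IsSepExtHom f) : SepHom f := by
  intro p hp hc n e y h hy
  let _ := f.toAlgebra
  have hf' : IsSepExt S Ω := hf
  classical
  have hsep := sepHom_of_hasSepTransBasis (hf' (Finset.univ.image y))
  have hyF : ∀ j, y j ∈ IntermediateField.adjoin S ((Finset.univ.image y : Finset Ω) : Set Ω) :=
    fun j => IntermediateField.subset_adjoin _ _ (by simp)
  exact hsep p hp hc n e (fun j => ⟨y j, hyF j⟩) (by
    apply Subtype.ext
    simp only [IntermediateField.coe_sum, IntermediateField.coe_mul, IntermediateField.coe_pow]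
    exact h) (fun h0 => hy (funext fun j => congrArg Subtype.val (congrFun h0 j)))

end Separability
end Paper

namespace Paper

section Structure

open Polynomial

theorem exists_pseudo_division {A : Type*} [CommRing A] [IsDomain A] (P : A[X])
    (hP : P.natDegree ≠ 0) (r : A[X]) :
    ∃ (k : ℕ) (q rem : A[X]), C P.leadingCoeff ^ k * r = q * P + rem ∧
      rem.natDegree < P.natDegree := by
  induction h : r.natDegree using Nat.strong_induction_on generalizing r with
  | _ m ih =>
    by_cases hlt : r.natDegree < P.natDegree
    · exact ⟨0, 0, r, by simp, hlt⟩
    · push Not at hlt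
      let r' := C P.leadingCoeff * r - C r.leadingCoeff * X ^ (r.natDegree - P.natDegree) * P
      have hr0 : r ≠ 0 := by rintro rfl; simp at hlt; exact hP hlt
      have hP0 : P ≠ 0 := by rintro rfl; simp at hP
      have hlt' : r'.natDegree < m := by
        have h1 : r'.degree < (C P.leadingCoeff * r).degree := by
          apply degree_sub_lt_left
          · rw [degree_mul, degree_C (leadingCoeff_ne_zero.2 hP0), mul_assoc, degree_mul,
              degree_C (leadingCoeff_ne_zero.2 hr0), degree_mul, degree_X_pow,
              degree_eq_natDegree hr0, degree_eq_natDegree hP0]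
            norm_cast
            omega
          · exact mul_ne_zero (C_ne_zero.2 (leadingCoeff_ne_zero.2 hP0)) hr0
          · rw [leadingCoeff_mul, leadingCoeff_mul, leadingCoeff_mul, leadingCoeff_C,
              leadingCoeff_C, leadingCoeff_X_pow, mul_one, mul_comm]
        have h2 : (C P.leadingCoeff * r).degree = r.degree := by
          rw [degree_mul, degree_C (leadingCoeff_ne_zero.2 hP0), zero_add]
        rw [h2] at h1
        by_cases h0 : r' = 0
        · rw [h0]; simp; omega
        · rw [← h]; exact natDegree_lt_natDegree h0 h1
      obtain ⟨k, q, rem, h1, h2⟩ := ih _ hlt' r' rfl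
      refine ⟨k + 1, q + C P.leadingCoeff ^ k * C r.leadingCoeff *
        X ^ (r.natDegree - P.natDegree), rem, ?_, h2⟩
      have : C P.leadingCoeff ^ k * r' = q * P + rem := h1
      simp only [r'] at this
      linear_combination this

section Core

variable {A F₀ E : Type*} [CommRing A] [IsDomain A] [Field F₀] [Algebra A F₀]
  [IsFractionRing A F₀] [Field E] [Algebra F₀ E]

theorem exists_separable_equation (θ : E) (hθ : IsSeparable F₀ θ) :
    ∃ P : A[X], P.eval₂ ((algebraMap F₀ E).comp (algebraMap A F₀)) θ = 0 ∧
      P.derivative.eval₂ ((algebraMap F₀ E).comp (algebraMap A F₀)) θ ≠ 0 ∧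
      P ≠ 0 ∧
      ∀ r : A[X], r.eval₂ ((algebraMap F₀ E).comp (algebraMap A F₀)) θ = 0 →
        ∃ (k : ℕ) (q : A[X]), C P.leadingCoeff ^ k * r = q * P := by
  have hθi : IsIntegral F₀ θ := hθ.isIntegral
  obtain ⟨c, hc, hcP⟩ := IsLocalization.integerNormalization_spec (nonZeroDivisors A)
    (minpoly F₀ θ)
  set P := IsLocalization.integerNormalization (nonZeroDivisors A) (minpoly F₀ θ) with hPdef
  have hc0 : algebraMap A F₀ c ≠ 0 := by
    simpa using nonZeroDivisors.ne_zero hc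
  have hcP' : P.map (algebraMap A F₀) = C (algebraMap A F₀ c) * minpoly F₀ θ := by
    rw [hcP, Algebra.smul_def]; rfl
  have hev (r : A[X]) : r.eval₂ ((algebraMap F₀ E).comp (algebraMap A F₀)) θ =
      aeval θ (r.map (algebraMap A F₀)) := by
    rw [aeval_def, eval₂_map]
  have hinj : Function.Injective (algebraMap A F₀) := IsFractionRing.injective A F₀
  have hdeg : P.natDegree = (minpoly F₀ θ).natDegree := by
    rw [← natDegree_map_eq_of_injective hinj P, hcP', natDegree_C_mul hc0]
  have hP0 : P.natDegree ≠ 0 := by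
    rw [hdeg]; exact (minpoly.natDegree_pos hθi).ne'
  refine ⟨P, ?_, ?_, ?_, ?_⟩
  · rw [hev, hcP']; simp
  · rw [hev, ← derivative_map, hcP', derivative_mul]
    simp only [derivative_C, zero_mul, zero_add, map_mul, aeval_C]
    refine mul_ne_zero (by simpa using hc0) ?_
    exact hθ.aeval_derivative_ne_zero (minpoly.aeval _ _)
  · rintro h; simp [h] at hP0
  · intro r hr
    obtain ⟨k, q, rem, h1, h2⟩ := exists_pseudo_division P hP0 r
    refine ⟨k, q, ?_⟩
    have h3 : rem.eval₂ ((algebraMap F₀ E).comp (algebraMap A F₀)) θ = 0 := by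
      have := congrArg (eval₂ ((algebraMap F₀ E).comp (algebraMap A F₀)) θ) h1
      rw [eval₂_mul, hr, mul_zero, eval₂_add, eval₂_mul, hev P, hcP'] at this
      simpa using this.symm
    rw [hev] at h3
    have h4 : rem.map (algebraMap A F₀) = 0 := by
      by_contra hne
      have := natDegree_le_of_dvd (minpoly.dvd F₀ θ h3) hne
      rw [natDegree_map_eq_of_injective hinj] at this
      omega
    rw [Polynomial.map_eq_zero_iff hinj] at h4
    rw [h1, h4, add_zero]

theorem exists_fraction_of_adjoin_eq_top (θ : E) (hθ : IsIntegral F₀ θ)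
    (htop : IntermediateField.adjoin F₀ {θ} = ⊤) (y : E) :
    ∃ (c : A) (r : A[X]), c ≠ 0 ∧
      y * (algebraMap F₀ E) (algebraMap A F₀ c) =
        r.eval₂ ((algebraMap F₀ E).comp (algebraMap A F₀)) θ := by
  have hy : y ∈ Algebra.adjoin F₀ {θ} := by
    rw [← IntermediateField.adjoin_simple_toSubalgebra_of_isAlgebraic hθ.isAlgebraic]
    rw [htop]; trivial
  rw [Algebra.adjoin_singleton_eq_range_aeval] at hy
  obtain ⟨q, hq⟩ := hy
  obtain ⟨c, hc, hcP⟩ := IsLocalization.integerNormalization_spec (nonZeroDivisors A) q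
  refine ⟨c, IsLocalization.integerNormalization (nonZeroDivisors A) q,
    nonZeroDivisors.ne_zero hc, ?_⟩
  rw [← eval₂_map, hcP, Algebra.smul_def, ← hq]
  have : (algebraMap A F₀[X]) c = C (algebraMap A F₀ c) := rfl
  rw [this, eval₂_mul, eval₂_C, ← aeval_def, mul_comm]
  rfl

end Core


variable {S Ω : Type*} [Field S] [Field Ω]

/-- Evaluation of polynomials in `d` variables and one further variable. -/
noncomputable def evalPair {S Ω : Type*} [CommRing S] [CommRing Ω] (f : S →+* Ω) {d : ℕ}
    (b : Fin d → Ω) (θ : Ω) :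
    (MvPolynomial (Fin d) S)[X] →+* Ω :=
  Polynomial.eval₂RingHom (MvPolynomial.eval₂Hom f b) θ

theorem exists_finset_isTranscendenceBasis {E : Type*} [Field E] [Algebra S E]
    [Algebra.EssFiniteType S E] (hf : SepHom (algebraMap S E)) :
    ∃ s : Finset E, IsTranscendenceBasis S ((↑) : s → E) ∧
      Algebra.IsSeparable (IntermediateField.adjoin S (s : Set E)) E := by
  obtain h | ⟨p, hp, hpk⟩ := CharP.exists' S
  · exact exists_isTranscendenceBasis_and_isSeparable_of_perfectField S E
  · have : ExpChar S p := ExpChar.prime hp.1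
    exact exists_isTranscendenceBasis_and_isSeparable_of_linearIndepOn_pow_of_essFiniteType p hp.1
      fun s hs => hf.linearIndepOn_pow hp.1 s hs

/-- A presentation of (a localization of) a finitely generated separable extension as an
étale cover of an open part of an affine space. -/
structure EtalePresentation (f : S →+* Ω) (s : Finset Ω) where
  d : ℕ
  b : Fin d → Ω
  θ : Ω
  P : (MvPolynomial (Fin d) S)[X]
  G : (MvPolynomial (Fin d) S)[X]
  injective : Function.Injective (MvPolynomial.eval₂Hom f b)
  eval_P : evalPair f b θ P = 0
  eval_derivative : evalPair f b θ (derivative P) ≠ 0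
  eval_G : evalPair f b θ G ≠ 0
  exists_eq : ∀ y ∈ s, ∃ r, y * evalPair f b θ G = evalPair f b θ r
  ker : ∀ r, evalPair f b θ r = 0 → ∃ (k : ℕ) (q : (MvPolynomial (Fin d) S)[X]),
    G ^ k * r = q * P

open scoped IntermediateField.algebraAdjoinAdjoin in
theorem exists_etalePresentation_top {E : Type*} [Field E] [Algebra S E]
    [Algebra.EssFiniteType S E] (hf : SepHom (algebraMap S E)) (s : Finset E) :
    Nonempty (EtalePresentation (algebraMap S E) s) := by
  classical
  obtain ⟨t, ht, hsep⟩ := exists_finset_isTranscendenceBasis hf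
  let b : Fin t.card → E := fun i => t.equivFin.symm i
  have hb : AlgebraicIndependent S b := ht.1.comp _ t.equivFin.symm.injective
  have hrange : Set.range b = (t : Set E) := by
    ext x
    constructor
    · rintro ⟨i, rfl⟩; exact (t.equivFin.symm i).2
    · intro hx; exact ⟨t.equivFin ⟨x, hx⟩, by simp [b]⟩
  let e : MvPolynomial (Fin t.card) S ≃ₐ[S] Algebra.adjoin S (t : Set E) :=
    hb.aevalEquiv.trans (Subalgebra.equivOfEq _ _ (by rw [hrange]))
  let F₀ := IntermediateField.adjoin S (t : Set E)
  let _ : Algebra (MvPolynomial (Fin t.card) S) F₀ :=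
    ((algebraMap (Algebra.adjoin S (t : Set E)) F₀).comp e.toRingEquiv.toRingHom).toAlgebra
  have : IsFractionRing (MvPolynomial (Fin t.card) S) F₀ :=
    (IsFractionRing.isFractionRing_iff_of_base_ringEquiv _ e.symm.toRingEquiv).1 inferInstance
  have hcomp : (algebraMap F₀ E).comp (algebraMap (MvPolynomial (Fin t.card) S) F₀) =
      MvPolynomial.eval₂Hom (algebraMap S E) b := by
    apply MvPolynomial.ringHom_ext
    · intro r
      have : e (MvPolynomial.C r) = algebraMap S _ r := e.commutes r
      change algebraMap F₀ E (algebraMap (Algebra.adjoin S (t : Set E)) F₀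
        (e (MvPolynomial.C r))) = _
      rw [this]
      simp
      rfl
    · intro i
      have : ((e (MvPolynomial.X i) : Algebra.adjoin S (t : Set E)) : E) = b i := by
        change ((hb.aevalEquiv (MvPolynomial.X i)) : E) = b i
        simp
      simp only [MvPolynomial.coe_eval₂Hom, MvPolynomial.eval₂_X]
      exact this
  have hinj : Function.Injective (MvPolynomial.eval₂Hom (algebraMap S E) b) := hb
  have : FiniteDimensional F₀ E := by
    obtain ⟨g, hg⟩ := IntermediateField.fg_top S E
    have h1 : IntermediateField.adjoin F₀ (g : Set E) = ⊤ := by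
      rw [← IntermediateField.restrictScalars_eq_top_iff (K := S), eq_top_iff, ← hg,
        IntermediateField.adjoin_le_iff]
      exact IntermediateField.subset_adjoin F₀ (g : Set E)
    have h2 : FiniteDimensional F₀ (IntermediateField.adjoin F₀ (g : Set E)) :=
      IntermediateField.finiteDimensional_adjoin fun x _ => Algebra.IsIntegral.isIntegral x
    rw [h1] at h2
    exact LinearEquiv.finiteDimensional
      (IntermediateField.topEquiv (F := F₀) (E := E)).toLinearEquiv
  obtain ⟨θ, hθ⟩ := Field.exists_primitive_element F₀ E
  have hθs : IsSeparable F₀ θ := Algebra.IsSeparable.isSeparable F₀ θ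
  obtain ⟨P, hP, hP', hP0, hker⟩ :=
    exists_separable_equation (A := MvPolynomial (Fin t.card) S) θ hθs
  rw [hcomp] at hP hP' hker
  choose c r hc hr using exists_fraction_of_adjoin_eq_top
    (A := MvPolynomial (Fin t.card) S) θ hθs.isIntegral hθ
  have hinj' : ∀ a, algebraMap F₀ E (algebraMap (MvPolynomial (Fin t.card) S) F₀ a) =
      MvPolynomial.eval₂Hom (algebraMap S E) b a := fun a => RingHom.congr_fun hcomp a
  rw [hcomp] at hr
  simp only [hinj'] at hr
  refine ⟨⟨t.card, b, θ, P, C (P.leadingCoeff * ∏ y ∈ s, c y), hinj, hP, hP', ?_, ?_, ?_⟩⟩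
  · simp only [evalPair, coe_eval₂RingHom, eval₂_C]
    rw [map_ne_zero_iff _ hinj]
    exact mul_ne_zero (leadingCoeff_ne_zero.2 hP0) (Finset.prod_ne_zero_iff.2 fun y _ => hc y)
  · intro y hy
    refine ⟨C (P.leadingCoeff * ∏ z ∈ s.erase y, c z) * r y, ?_⟩
    rw [← Finset.mul_prod_erase s c hy]
    simp only [evalPair, coe_eval₂RingHom, eval₂_C, eval₂_mul, map_mul, ← hr]
    ring
  · intro r hr
    obtain ⟨k, q, h⟩ := hker r hr
    refine ⟨k, C (∏ y ∈ s, c y) ^ k * q, ?_⟩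
    rw [C_mul, mul_pow, mul_right_comm, h]
    ring

theorem evalPair_comp {S E Ω : Type*} [CommRing S] [CommRing E] [CommRing Ω] (f : S →+* E)
    (ι : E →+* Ω) {d : ℕ} (b : Fin d → E)
    (θ : E) (r : (MvPolynomial (Fin d) S)[X]) :
    evalPair (ι.comp f) (fun i => ι (b i)) (ι θ) r = ι (evalPair f b θ r) := by
  have : evalPair (ι.comp f) (fun i => ι (b i)) (ι θ) = ι.comp (evalPair f b θ) := by
    ext <;> simp [evalPair]
  rw [this]; rfl

theorem SepHom.exists_etalePresentation {f : S →+* Ω} (hf : SepHom f) (s : Finset Ω) :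
    Nonempty (EtalePresentation f s) := by
  classical
  let _ := f.toAlgebra
  let E := IntermediateField.adjoin S (s : Set Ω)
  have hE : SepHom (algebraMap S E) := SepHom.of_comp (g := algebraMap E Ω) hf
  have : Algebra.EssFiniteType S E :=
    IntermediateField.essFiniteType_iff.2 (IntermediateField.fg_adjoin_finset s)
  let s' : Finset E := s.attach.image
    fun y => ⟨y.1, IntermediateField.subset_adjoin S (s : Set Ω) y.2⟩
  obtain ⟨Q⟩ := exists_etalePresentation_top hE s'
  have hev : ∀ r, evalPair f (fun i => (Q.b i : Ω)) (Q.θ : Ω) r =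
      (evalPair (algebraMap S E) Q.b Q.θ r : Ω) :=
    fun r => evalPair_comp (algebraMap S E) (algebraMap E Ω) Q.b Q.θ r
  refine ⟨⟨Q.d, fun i => Q.b i, Q.θ, Q.P, Q.G, ?_, ?_, ?_, ?_, ?_, ?_⟩⟩
  · have : MvPolynomial.eval₂Hom f (fun i => (Q.b i : Ω)) =
        (algebraMap E Ω).comp (MvPolynomial.eval₂Hom (algebraMap S E) Q.b) := by
      ext <;> simp <;> rfl
    rw [this]
    exact (algebraMap E Ω).injective.comp Q.injective
  · rw [hev, Q.eval_P]; rfl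
  · rw [hev]; exact fun h => Q.eval_derivative (Subtype.ext h)
  · rw [hev]; exact fun h => Q.eval_G (Subtype.ext h)
  · intro y hy
    obtain ⟨r, hr⟩ := Q.exists_eq ⟨y, IntermediateField.subset_adjoin S (s : Set Ω) hy⟩
      (Finset.mem_image.2 ⟨⟨y, hy⟩, Finset.mem_attach _ _, rfl⟩)
    refine ⟨r, ?_⟩
    rw [hev, hev, ← hr]; rfl
  · intro r hr
    rw [hev] at hr
    exact Q.ker r (Subtype.ext hr)

/-- The universal property of an étale presentation: solutions of the presentation in a field
give partial homomorphisms. -/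
theorem EtalePresentation.exists_hom {f : S →+* Ω} {s : Finset Ω} (Q : EtalePresentation f s)
    {N : Type*} [Field N] (g : S →+* N) (b' : Fin Q.d → N) (θ' : N)
    (hP : evalPair g b' θ' Q.P = 0) (hG : evalPair g b' θ' Q.G ≠ 0) :
    ∃ (B : Subring Ω) (ψ : B →+* N), (∀ y ∈ s, y ∈ B) ∧
      (∀ c, ∃ h : f c ∈ B, ψ ⟨f c, h⟩ = g c) ∧
      ∀ y : B, ∀ r, (y : Ω) * evalPair f Q.b Q.θ Q.G = evalPair f Q.b Q.θ r →
        ψ y * evalPair g b' θ' Q.G = evalPair g b' θ' r := by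
  let R := Localization.Away Q.G
  let φ : R →+* Ω := IsLocalization.Away.lift (g := evalPair f Q.b Q.θ) Q.G
    (isUnit_iff_ne_zero.2 Q.eval_G)
  let φ' : R →+* N := IsLocalization.Away.lift (g := evalPair g b' θ') Q.G
    (isUnit_iff_ne_zero.2 hG)
  have hφ : ∀ r, φ (algebraMap _ R r) = evalPair f Q.b Q.θ r := fun r =>
    IsLocalization.Away.lift_eq _ _ _
  have hφ' : ∀ r, φ' (algebraMap _ R r) = evalPair g b' θ' r := fun r =>
    IsLocalization.Away.lift_eq _ _ _
  have hker' : ∀ r, evalPair f Q.b Q.θ r = 0 → evalPair g b' θ' r = 0 := by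
    intro r hr
    obtain ⟨k, q, h⟩ := Q.ker r hr
    have := congrArg (evalPair g b' θ') h
    rw [map_mul, map_mul, hP, mul_zero, map_pow] at this
    exact (mul_eq_zero.1 this).resolve_left (pow_ne_zero _ hG)
  have hker : RingHom.ker φ ≤ RingHom.ker φ' := by
    intro z hz
    obtain ⟨k, r, hr⟩ := IsLocalization.Away.surj Q.G z
    rw [RingHom.mem_ker] at hz ⊢
    have h1 := congrArg φ hr
    rw [map_mul, hz, zero_mul, hφ] at h1
    have h2 := congrArg φ' hr
    rw [hφ', hker' r h1.symm, map_mul, map_pow, hφ'] at h2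
    exact (mul_eq_zero.1 h2).resolve_right (pow_ne_zero _ hG)
  let ψ : φ.range →+* N := (Ideal.Quotient.lift (RingHom.ker φ) φ' fun a ha => hker ha).comp
    (RingHom.quotientKerEquivRange φ).symm.toRingHom
  have hψ : ∀ z : R, ψ ⟨φ z, z, rfl⟩ = φ' z := by
    intro z
    have : (RingHom.quotientKerEquivRange φ).symm ⟨φ z, z, rfl⟩ =
        Ideal.Quotient.mk _ z := by
      rw [RingEquiv.symm_apply_eq]; rfl
    change Ideal.Quotient.lift (RingHom.ker φ) φ' (fun a ha => hker ha)
      ((RingHom.quotientKerEquivRange φ).symm ⟨φ z, z, rfl⟩) = _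
    rw [this]; rfl
  have hfrac : ∀ y r, y * evalPair f Q.b Q.θ Q.G = evalPair f Q.b Q.θ r →
      ∃ z, φ z = y ∧ φ' z * evalPair g b' θ' Q.G = evalPair g b' θ' r := by
    intro y r h
    obtain ⟨i, hi⟩ := (IsLocalization.Away.algebraMap_isUnit (S := R) Q.G).exists_right_inv
    have h1 := congrArg φ hi
    have h2 := congrArg φ' hi
    rw [map_mul, hφ, map_one] at h1
    rw [map_mul, hφ', map_one] at h2
    refine ⟨algebraMap _ R r * i, ?_, ?_⟩
    · rw [map_mul, hφ, ← h, mul_assoc, h1, mul_one]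
    · rw [map_mul, hφ', mul_assoc, mul_comm (φ' i), h2, mul_one]
  refine ⟨φ.range, ψ, ?_, ?_, ?_⟩
  · intro y hy
    obtain ⟨r, hr⟩ := Q.exists_eq y hy
    obtain ⟨z, hz, -⟩ := hfrac y r hr
    exact ⟨z, hz⟩
  · intro c
    have h1 : φ (algebraMap (MvPolynomial (Fin Q.d) S)[X] R (C (MvPolynomial.C c))) = f c := by
      simp [hφ, evalPair]
    have h2 : φ' (algebraMap (MvPolynomial (Fin Q.d) S)[X] R (C (MvPolynomial.C c))) = g c := by
      simp [hφ', evalPair]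
    refine ⟨⟨_, h1⟩, ?_⟩
    rw [← h2, ← hψ]
    exact congrArg ψ (Subtype.ext h1.symm)
  · rintro ⟨y, w, rfl⟩ r h
    obtain ⟨z, hz, hz'⟩ := hfrac _ r h
    rw [← hz', hψ]
    have h0 : z - w ∈ RingHom.ker φ := by rw [RingHom.mem_ker, map_sub, hz, sub_self]
    have := hker h0
    rw [RingHom.mem_ker, map_sub, sub_eq_zero] at this
    rw [this]

end Structure
end Paper

namespace Paper

open Polynomial Filter

/-- A form of Newton's lemma: `∑ i ≤ d, g i * z ^ i` has a root of size at most `|g 0 / g 1|`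
as soon as the terms of order at least two are negligible there. -/
def NewtonHensel {N : Type*} [Field N] (O : ValuationSubring N) : Prop :=
  ∀ (d : ℕ) (g : ℕ → N), 1 ≤ d → g 1 ≠ 0 →
    (∀ i, 2 ≤ i → i ≤ d → O.valuation (g i * g 0 ^ (i - 1)) < O.valuation (g 1 ^ i)) →
    ∃ z, ∑ i ∈ Finset.range (d + 1), g i * z ^ i = 0 ∧
      O.valuation (z * g 1) ≤ O.valuation (g 0)

theorem newtonHensel_of_henselianLocalRing {N : Type*} [Field N] (O : ValuationSubring N)
    (hO : HenselianLocalRing O) : NewtonHensel O := by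
  intro d g hd hg1 hg
  by_cases hg0 : g 0 = 0
  · refine ⟨0, ?_, by simp⟩
    rw [Finset.sum_eq_single 0] <;> simp +contextual [hg0]
  have hmem : ∀ i, 2 ≤ i → i ≤ d → O.valuation (g i * g 0 ^ (i - 1) / g 1 ^ i) < 1 := by
    intro i h2 hi
    rw [map_div₀]
    exact (div_lt_one₀ (by simp [zero_lt_iff, hg1])).2 (hg i h2 hi)
  let h : ℕ → O := fun i => if hi : 2 ≤ i ∧ i ≤ d then
    ⟨g i * g 0 ^ (i - 1) / g 1 ^ i, (O.valuation_le_one_iff _).1 (hmem i hi.1 hi.2).le⟩ else 0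
  have hh : ∀ i, h i ∈ IsLocalRing.maximalIdeal O := by
    intro i
    by_cases hi : 2 ≤ i ∧ i ≤ d
    · rw [ValuationSubring.valuation_lt_one_iff]
      simp only [h, dif_pos hi]
      exact hmem i hi.1 hi.2
    · simp only [h, dif_neg hi]
      exact zero_mem _
  let r : O[X] := ∑ i ∈ Finset.Icc 2 d, C (h i) * X ^ (d + 1 - i)
  let f : O[X] := X ^ (d + 1) + (X ^ d + r)
  have hr : r.degree < d := by
    refine lt_of_le_of_lt (Polynomial.degree_sum_le _ _) ?_
    rw [Finset.sup_lt_iff (by exact WithBot.bot_lt_coe d)]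
    intro i hi
    rw [Finset.mem_Icc] at hi
    refine lt_of_le_of_lt (degree_C_mul_X_pow_le _ _) ?_
    exact_mod_cast (by omega : d + 1 - i < d)
  have hf : f.Monic := by
    refine monic_X_pow_add ?_
    refine lt_of_le_of_lt (degree_add_le _ _) (max_lt ?_ (hr.trans ?_))
    · rw [degree_X_pow]; exact_mod_cast Nat.lt_succ_self d
    · exact_mod_cast Nat.lt_succ_self d
  have hrm : ∀ x : O, r.eval x ∈ IsLocalRing.maximalIdeal O := by
    intro x
    simp only [r, eval_finsetSum, eval_mul, eval_C]
    exact Ideal.sum_mem _ fun i _ => Ideal.mul_mem_right _ _ (hh i)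
  have hrm' : ∀ x : O, r.derivative.eval x ∈ IsLocalRing.maximalIdeal O := by
    intro x
    simp only [r, derivative_sum, eval_finsetSum, derivative_C_mul, eval_mul, eval_C]
    exact Ideal.sum_mem _ fun i _ => Ideal.mul_mem_right _ _ (hh i)
  obtain ⟨W, hW, hW1⟩ := hO.is_henselian f hf (-1) (by
      simp only [f, eval_add, eval_pow, eval_X]
      convert! hrm (-1) using 1
      ring) (by
      have h1 : f.derivative.eval (-1) = (-1) ^ d + r.derivative.eval (-1) := by
        simp only [f, derivative_add, eval_add, derivative_X_pow, eval_mul, eval_C, eval_pow,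
          eval_X]
        obtain ⟨k, rfl⟩ : ∃ k, d = k + 1 := ⟨d - 1, by omega⟩
        push_cast
        try simp only [Nat.add_sub_cancel]
        ring
      rw [h1]
      by_contra hu
      have : ((-1 : O) ^ d + r.derivative.eval (-1)) ∈ IsLocalRing.maximalIdeal O := by
        simpa using hu
      have h2 := Ideal.sub_mem _ this (hrm' (-1))
      rw [add_sub_cancel_right] at h2
      exact h2 ((isUnit_one.neg).pow d))
  have hWu : IsUnit W := by
    by_contra hu
    have h1 : W ∈ IsLocalRing.maximalIdeal O := hu
    have h2 := Ideal.sub_mem _ hW1 h1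
    simp only [sub_neg_eq_add] at h2
    rw [add_comm, ← sub_add_eq_add_sub] at h2
    simp at h2
  have hWv : O.valuation (W : N) = 1 := (O.valuation_eq_one_iff W).1 hWu
  have hW0 : (W : N) ≠ 0 := by
    intro h0
    simp [h0] at hWv
  refine ⟨g 0 / g 1 / W, ?_, ?_⟩
  · have e : (W : N) ^ (d + 1) + ((W : N) ^ d +
        ∑ i ∈ Finset.Icc 2 d, (h i : N) * (W : N) ^ (d + 1 - i)) = 0 := by
      have := congrArg (fun x : O => (x : N)) hW
      simpa [f, r, eval_finsetSum] using this
    have key : ∑ i ∈ Finset.range (d + 1), g i * (g 0 / g 1 / W) ^ i =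
        g 0 / W ^ (d + 1) * ((W : N) ^ (d + 1) + ((W : N) ^ d +
        ∑ i ∈ Finset.Icc 2 d, (h i : N) * (W : N) ^ (d + 1 - i))) := by
      have hs : Finset.range (d + 1) = insert 0 (insert 1 (Finset.Icc 2 d)) := by
        ext i
        simp only [Finset.mem_range, Finset.mem_insert, Finset.mem_Icc]
        omega
      rw [hs, Finset.sum_insert (by simp), Finset.sum_insert (by simp), mul_add, mul_add,
        Finset.mul_sum]
      congr 1
      · field_simp
      congr 1
      · field_simp
        rw [pow_succ, mul_comm]
      refine Finset.sum_congr rfl fun i hi => ?_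
      rw [Finset.mem_Icc] at hi
      simp only [h, dif_pos hi]
      obtain ⟨j, rfl⟩ : ∃ j, i = j + 1 := ⟨i - 1, by omega⟩
      have e2 : (W : N) ^ (d + 1) = (W : N) ^ (d + 1 - (j + 1)) * (W : N) ^ (j + 1) := by
        rw [← pow_add]; congr 1; omega
      rw [e2]
      simp only [Nat.add_sub_cancel]
      rw [div_pow, div_pow, pow_succ (g 0) j]
      field_simp
    rw [key, e, mul_zero]
  · rw [map_mul, map_div₀, map_div₀, hWv, div_one,
      div_mul_cancel₀ _ (by simpa using hg1)]

section Approx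

variable {N Γ : Type*} [Field N] [LinearOrderedCommGroupWithZero Γ] (V : Valuation N Γ)

theorem approx_trans {x y z : N} (h : V (x - y) < V y) (h' : V (y - z) < V z) :
    V (x - z) < V z := by
  have e : V y = V z := Valuation.map_eq_of_sub_lt _ h'
  rw [e] at h
  have := V.map_add_lt h h'
  simpa using this

theorem approx_symm {x y : N} (h : V (x - y) < V y) : V (y - x) < V x := by
  rwa [V.map_sub_swap, Valuation.map_eq_of_sub_lt _ h]

theorem approx_mul {x y : N} (h : V (x - y) < V y) {z : N} (hz : z ≠ 0) :
    V (x * z - y * z) < V (y * z) := by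
  rw [← sub_mul, map_mul, map_mul]
  exact mul_lt_mul_of_pos_right h (by simp [zero_lt_iff, hz])

theorem approx_cancel {x y z : N} (hz : z ≠ 0) (h : V (x * z - y * z) < V (y * z)) :
    V (x - y) < V y := by
  rw [← sub_mul, map_mul, map_mul] at h
  exact lt_of_mul_lt_mul_right h zero_le

end Approx

section VTendsto

variable {Ω Γ I : Type*} [Field Ω] [LinearOrderedCommGroupWithZero Γ]

/-- Convergence along a filter for the topology of a valuation. -/
def VTendsto (ν : Valuation Ω Γ) (F : Filter I) (X : I → Ω) (x : Ω) : Prop :=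
  ∀ γ : Ω, γ ≠ 0 → ∀ᶠ i in F, ν (X i - x) < ν γ

variable {ν : Valuation Ω Γ} {F : Filter I} {X Y : I → Ω} {x y : Ω}

theorem vTendsto_const (x : Ω) : VTendsto ν F (fun _ => x) x := by
  intro γ hγ
  simp [zero_lt_iff, hγ]

theorem VTendsto.add (hX : VTendsto ν F X x) (hY : VTendsto ν F Y y) :
    VTendsto ν F (fun i => X i + Y i) (x + y) := by
  intro γ hγ
  filter_upwards [hX γ hγ, hY γ hγ] with i h1 h2
  have := ν.map_add_lt h1 h2
  convert! this using 2
  ring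

theorem VTendsto.eventually_eq (hX : VTendsto ν F X x) (hx : x ≠ 0) :
    ∀ᶠ i in F, ν (X i) = ν x := by
  filter_upwards [hX x hx] with i h
  exact Valuation.map_eq_of_sub_lt _ h

theorem VTendsto.eventually_lt (hX : VTendsto ν F X x) (hY : VTendsto ν F Y y)
    (h : ν x < ν y) : ∀ᶠ i in F, ν (X i) < ν (Y i) := by
  have hy : y ≠ 0 := by
    rintro rfl
    simp at h
  filter_upwards [hX y hy, hY.eventually_eq hy] with i h1 h2
  rw [h2]
  have := ν.map_add_lt h1 h
  simpa using this

theorem VTendsto.mul (hX : VTendsto ν F X x) (hY : VTendsto ν F Y y) :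
    VTendsto ν F (fun i => X i * Y i) (x * y) := by
  intro γ hγ
  have hXb : ∃ γ' ≠ 0, ∀ᶠ i in F, ν (X i) ≤ ν γ' := by
    by_cases hx : x = 0
    · refine ⟨1, one_ne_zero, ?_⟩
      filter_upwards [hX 1 one_ne_zero] with i h
      simpa [hx] using h.le
    · exact ⟨x, hx, (hX.eventually_eq hx).mono fun i h => h.le⟩
  obtain ⟨γ', hγ', hb⟩ := hXb
  by_cases hy : y = 0
  · filter_upwards [hb, hY (γ / γ') (div_ne_zero hγ hγ')] with i h1 h2
    subst hy
    rw [sub_zero, map_div₀] at h2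
    rw [mul_zero, sub_zero, map_mul]
    calc _ ≤ ν γ' * ν (Y i) := mul_le_mul_left h1 _
      _ < ν γ' * (ν γ / ν γ') := mul_lt_mul_of_pos_left h2 (by simp [zero_lt_iff, hγ'])
      _ = _ := mul_div_cancel₀ _ (by simpa using hγ')
  · filter_upwards [hb, hY (γ / γ') (div_ne_zero hγ hγ'), hX (γ / y) (div_ne_zero hγ hy)]
      with i h1 h2 h3
    have e : X i * Y i - x * y = X i * (Y i - y) + (X i - x) * y := by ring
    rw [e]
    refine ν.map_add_lt ?_ ?_
    · rw [map_div₀] at h2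
      rw [map_mul]
      calc _ ≤ ν γ' * ν (Y i - y) := mul_le_mul_left h1 _
        _ < ν γ' * (ν γ / ν γ') := mul_lt_mul_of_pos_left h2 (by simp [zero_lt_iff, hγ'])
        _ = _ := mul_div_cancel₀ _ (by simpa using hγ')
    · rw [map_div₀] at h3
      rw [map_mul]
      calc _ < (ν γ / ν y) * ν y := mul_lt_mul_of_pos_right h3 (by simp [zero_lt_iff, hy])
        _ = _ := div_mul_cancel₀ _ (by simpa using hy)

theorem VTendsto.pow (hX : VTendsto ν F X x) (n : ℕ) :
    VTendsto ν F (fun i => X i ^ n) (x ^ n) := by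
  induction n with
  | zero => simpa using vTendsto_const 1
  | succ n ih => simpa only [pow_succ] using ih.mul hX

theorem VTendsto.evalPair {S : Type*} [CommRing S] (f : S →+* Ω) {d : ℕ} {b : I → Fin d → Ω}
    {b₀ : Fin d → Ω} {θ : I → Ω} {θ₀ : Ω} (hb : ∀ j, VTendsto ν F (fun i => b i j) (b₀ j))
    (hθ : VTendsto ν F θ θ₀) (r : (MvPolynomial (Fin d) S)[X]) :
    VTendsto ν F (fun i => evalPair f (b i) (θ i) r) (evalPair f b₀ θ₀ r) := by
  induction r using Polynomial.induction_on' with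
  | add p q hp hq => simpa only [map_add] using hp.add hq
  | monomial n a =>
    simp only [Paper.evalPair, coe_eval₂RingHom, eval₂_monomial]
    refine VTendsto.mul ?_ (hθ.pow n)
    induction a using MvPolynomial.induction_on with
    | C a => simpa using vTendsto_const (f a)
    | add p q hp hq => simpa only [map_add] using hp.add hq
    | mul_X p j hp =>
      simpa only [map_mul, MvPolynomial.coe_eval₂Hom, MvPolynomial.eval₂_X] using hp.mul (hb j)

theorem exists_filter_vTendsto {A : Type*} [CommRing A] (ν : Valuation Ω Γ) (α : A →+* Ω)
    (hα : ∀ y γ : Ω, γ ≠ 0 → ∃ a, ν (y - α a) < ν γ) {J : Type*} (p : J → Ω) :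
    ∃ F : Filter (J → A), F.NeBot ∧ ∀ j, VTendsto ν F (fun a => α (a j)) (p j) := by
  let B : {γ : Ω // γ ≠ 0} → Set (J → A) := fun γ => {a | ∀ j, ν (α (a j) - p j) < ν γ.1}
  have hdir : Directed (· ≥ ·) fun γ => 𝓟 (B γ) := by
    intro γ γ'
    rcases le_total (ν γ.1) (ν γ'.1) with h | h
    · exact ⟨γ, le_rfl, principal_mono.2 fun a ha j => (ha j).trans_le h⟩
    · exact ⟨γ', principal_mono.2 fun a ha j => (ha j).trans_le h, le_rfl⟩
  have : Nonempty {γ : Ω // γ ≠ 0} := ⟨1, one_ne_zero⟩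
  refine ⟨⨅ γ, 𝓟 (B γ), iInf_neBot_of_directed' hdir fun γ => ?_, fun j γ hγ => ?_⟩
  · rw [principal_neBot_iff]
    choose a ha using fun j => hα (p j) γ.1 γ.2
    exact ⟨a, fun j => by rw [ν.map_sub_swap]; exact ha j⟩
  · exact mem_iInf_of_mem (⟨γ, hγ⟩ : {γ : Ω // γ ≠ 0})
      (mem_principal.2 fun a (ha : a ∈ B ⟨γ, hγ⟩) => ha j)

end VTendsto

theorem evalPair_add {S N : Type*} [CommRing S] [CommRing N] (f : S →+* N) {d : ℕ} (b : Fin d → N)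
    (θ z : N) (r : (MvPolynomial (Fin d) S)[X]) :
    evalPair f b (θ + z) r =
      ∑ i ∈ Finset.range (r.natDegree + 1), evalPair f b θ (hasseDeriv i r) * z ^ i := by
  have hr : ∀ (θ : N) (r : (MvPolynomial (Fin d) S)[X]),
      evalPair f b θ r = (r.map (MvPolynomial.eval₂Hom f b)).eval θ := fun θ r =>
    (Polynomial.eval_map (MvPolynomial.eval₂Hom f b) θ).symm
  rw [hr, add_comm, ← taylor_eval, eval_eq_sum_range' (n := r.natDegree + 1)]
  · refine Finset.sum_congr rfl fun i _ => ?_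
    rw [taylor_coeff, hr]
    congr 2
    ext k
    simp [hasseDeriv_coeff]
  · rw [natDegree_taylor]
    exact Nat.lt_succ_of_le natDegree_map_le

/-- Approximation and Newton's lemma: points of a separable extension of `S` inside `Ω` can be
moved to a henselian valued field `N` along approximations from a common dense subring. -/
theorem exists_subring_hom_of_newtonHensel {S A Ω N Γ : Type*} [Field S] [CommRing A] [Field Ω]
    [Field N] [LinearOrderedCommGroupWithZero Γ] (ν : Valuation Ω Γ) (α : A →+* Ω) (β : A →+* N)
    (O : ValuationSubring N) (hO : NewtonHensel O)
    (H : ∀ a c, ν (α a) < ν (α c) → O.valuation (β a) < O.valuation (β c))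
    (D : ∀ y γ : Ω, γ ≠ 0 → ∃ a, ν (y - α a) < ν γ)
    (σ : S →+* A) (hσ : SepHom (α.comp σ)) (s : Finset Ω) :
    ∃ (B : Subring Ω) (ψ : B →+* N), (∀ y ∈ s, y ∈ B) ∧
      (∀ c, ∃ h : α (σ c) ∈ B, ψ ⟨α (σ c), h⟩ = β (σ c)) ∧
      ∀ y : B, (y : Ω) ∈ s → ∀ c, ν (y - α c) < ν (α c) →
        O.valuation (ψ y - β c) < O.valuation (β c) := by
  classical
  obtain ⟨Q⟩ := hσ.exists_etalePresentation s
  obtain ⟨F, hF, hp⟩ := exists_filter_vTendsto ν α D (fun j : Option (Fin Q.d) => j.elim Q.θ Q.b)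
  have hne : ∀ a, α a ≠ 0 → β a ≠ 0 := by
    intro a ha h
    have := H 0 a (by simpa [zero_lt_iff] using ha)
    simp [h] at this
  have hev : ∀ (a : Option (Fin Q.d) → A) r, α (evalPair σ (fun j => a (some j)) (a none) r) =
      evalPair (α.comp σ) (fun j => α (a (some j))) (α (a none)) r :=
    fun a r => (evalPair_comp σ α _ _ r).symm
  have hT : ∀ r, VTendsto ν F (fun a => α (evalPair σ (fun j => a (some j)) (a none) r))
      (evalPair (α.comp σ) Q.b Q.θ r) := by
    intro r
    simp only [hev]
    exact VTendsto.evalPair _ (fun j => hp (some j)) (hp none) r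
  have hpos : ∀ x : Ω, x ≠ 0 → ν 0 < ν x := fun x hx => by simpa [zero_lt_iff] using hx
  have hg0 : VTendsto ν F (fun a => α (evalPair σ (fun j => a (some j)) (a none) Q.P)) 0 := by
    simpa [Q.eval_P] using hT Q.P
  have hg1 := hT (derivative Q.P)
  have hpow : ∀ i (c : Ω), i ≠ 0 → c * 0 ^ i = 0 := fun i c hi => by simp [hi]
  have ev1 : ∀ i, 2 ≤ i → ∀ᶠ a in F,
      ν (α (evalPair σ (fun j => a (some j)) (a none) (hasseDeriv i Q.P)) *
        α (evalPair σ (fun j => a (some j)) (a none) Q.P) ^ (i - 1)) <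
      ν (α (evalPair σ (fun j => a (some j)) (a none) (derivative Q.P)) ^ i) := by
    intro i hi
    have := (hT (hasseDeriv i Q.P)).mul (hg0.pow (i - 1))
    rw [hpow _ _ (by omega)] at this
    exact this.eventually_lt (hg1.pow i) (hpos _ (pow_ne_zero _ Q.eval_derivative))
  have ev2 : ∀ r, evalPair (α.comp σ) Q.b Q.θ r ≠ 0 → ∀ i, 1 ≤ i → ∀ᶠ a in F,
      ν (α (evalPair σ (fun j => a (some j)) (a none) (hasseDeriv i r)) *
        α (evalPair σ (fun j => a (some j)) (a none) Q.P) ^ i) <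
      ν (α (evalPair σ (fun j => a (some j)) (a none) r) *
        α (evalPair σ (fun j => a (some j)) (a none) (derivative Q.P)) ^ i) := by
    intro r hr i hi
    have := (hT (hasseDeriv i r)).mul (hg0.pow i)
    rw [hpow _ _ (by omega)] at this
    exact this.eventually_lt ((hT r).mul (hg1.pow i))
      (hpos _ (mul_ne_zero hr (pow_ne_zero _ Q.eval_derivative)))
  choose! R hR using Q.exists_eq
  have ev3 : ∀ y ∈ s, y ≠ 0 → ∀ᶠ a in F,
      ν (α (evalPair σ (fun j => a (some j)) (a none) (R y)) -
        y * α (evalPair σ (fun j => a (some j)) (a none) Q.G)) <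
      ν (y * α (evalPair σ (fun j => a (some j)) (a none) Q.G)) := by
    intro y hy hy0
    have h1 := (hT (R y)).add ((vTendsto_const (-y)).mul (hT Q.G))
    rw [neg_mul, hR y hy, add_neg_cancel] at h1
    have h2 := h1.eventually_lt ((vTendsto_const y).mul (hT Q.G))
      (hpos _ (mul_ne_zero hy0 Q.eval_G))
    filter_upwards [h2] with a h
    simpa only [neg_mul, ← sub_eq_add_neg] using h
  have ev4 : ∀ᶠ a in F, α (evalPair σ (fun j => a (some j)) (a none) (derivative Q.P)) ≠ 0 := by
    filter_upwards [hg1.eventually_eq Q.eval_derivative] with a h h0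
    rw [h0, map_zero] at h
    exact Q.eval_derivative ((ν.zero_iff).1 h.symm)
  have ev4' : ∀ r, evalPair (α.comp σ) Q.b Q.θ r ≠ 0 → ∀ᶠ a in F,
      α (evalPair σ (fun j => a (some j)) (a none) r) ≠ 0 := by
    intro r hr
    filter_upwards [(hT r).eventually_eq hr] with a h h0
    rw [h0, map_zero] at h
    exact hr ((ν.zero_iff).1 h.symm)
  have hRne : ∀ y ∈ s, y ≠ 0 → evalPair (α.comp σ) Q.b Q.θ (R y) ≠ 0 := fun y hy hy0 => by
    rw [← hR y hy]
    exact mul_ne_zero hy0 Q.eval_G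
  let rs : Finset (MvPolynomial (Fin Q.d) S)[X] := insert Q.G ((s.erase 0).image R)
  have hrs : ∀ r ∈ rs, evalPair (α.comp σ) Q.b Q.θ r ≠ 0 := by
    intro r hr
    simp only [rs, Finset.mem_insert, Finset.mem_image, Finset.mem_erase] at hr
    rcases hr with rfl | ⟨y, ⟨hy0, hy⟩, rfl⟩
    · exact Q.eval_G
    · exact hRne y hy hy0
  have ev1' : ∀ᶠ a in F, ∀ i ∈ Finset.Icc 2 Q.P.natDegree,
      ν (α (evalPair σ (fun j => a (some j)) (a none) (hasseDeriv i Q.P)) *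
        α (evalPair σ (fun j => a (some j)) (a none) Q.P) ^ (i - 1)) <
      ν (α (evalPair σ (fun j => a (some j)) (a none) (derivative Q.P)) ^ i) := by
    rw [Filter.eventually_all_finset]
    exact fun i hi => ev1 i (Finset.mem_Icc.1 hi).1
  have ev2' : ∀ᶠ a in F, ∀ r ∈ rs, ∀ i ∈ Finset.Icc 1 r.natDegree,
      ν (α (evalPair σ (fun j => a (some j)) (a none) (hasseDeriv i r)) *
        α (evalPair σ (fun j => a (some j)) (a none) Q.P) ^ i) <
      ν (α (evalPair σ (fun j => a (some j)) (a none) r) *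
        α (evalPair σ (fun j => a (some j)) (a none) (derivative Q.P)) ^ i) := by
    rw [Filter.eventually_all_finset]
    intro r hr
    rw [Filter.eventually_all_finset]
    exact fun i hi => ev2 r (hrs r hr) i (Finset.mem_Icc.1 hi).1
  have ev3' : ∀ᶠ a in F, ∀ y ∈ s, y ≠ 0 →
      ν (α (evalPair σ (fun j => a (some j)) (a none) (R y)) -
        y * α (evalPair σ (fun j => a (some j)) (a none) Q.G)) <
      ν (y * α (evalPair σ (fun j => a (some j)) (a none) Q.G)) := by
    rw [Filter.eventually_all_finset]
    intro y hy
    by_cases hy0 : y = 0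
    · simp [hy0]
    · simpa [hy0] using ev3 y hy hy0
  have ev5 : ∀ᶠ a in F, ∀ r ∈ rs, α (evalPair σ (fun j => a (some j)) (a none) r) ≠ 0 := by
    rw [Filter.eventually_all_finset]
    exact fun r hr => ev4' r (hrs r hr)
  obtain ⟨a, h1, h2, h3, h4, h5⟩ := (ev1'.and (ev2'.and (ev3'.and (ev4.and ev5)))).exists
  set E : (MvPolynomial (Fin Q.d) S)[X] →+* A := evalPair σ (fun j => a (some j)) (a none) with hE
  have hdeg : 1 ≤ Q.P.natDegree := by
    rw [Nat.one_le_iff_ne_zero]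
    intro h0
    apply h4
    rw [derivative_of_natDegree_zero h0, map_zero, map_zero]
  obtain ⟨z, hz, hzv⟩ := hO Q.P.natDegree (fun i => β (E (hasseDeriv i Q.P))) hdeg
    (hne _ (by simpa [hasseDeriv_one] using h4)) (by
      intro i hi hid
      have := H (E (hasseDeriv i Q.P) * E Q.P ^ (i - 1)) (E (derivative Q.P) ^ i)
        (by simpa using h1 i (Finset.mem_Icc.2 ⟨hi, hid⟩))
      simpa [hasseDeriv_one, hasseDeriv_zero] using this)
  simp only [hasseDeriv_one, hasseDeriv_zero, LinearMap.id_coe, id_eq] at hzv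
  let E' : (MvPolynomial (Fin Q.d) S)[X] →+* N :=
    evalPair (β.comp σ) (fun j => β (a (some j))) (β (a none) + z)
  have hE' : ∀ r, E' r = ∑ i ∈ Finset.range (r.natDegree + 1), β (E (hasseDeriv i r)) * z ^ i := by
    intro r
    simp only [E', evalPair_add, hE, evalPair_comp]
  have hclose : ∀ r ∈ rs, O.valuation (E' r - β (E r)) < O.valuation (β (E r)) := by
    intro r hr
    have hsub : E' r - β (E r) =
        ∑ i ∈ Finset.Icc 1 r.natDegree, β (E (hasseDeriv i r)) * z ^ i := by
      rw [hE', sub_eq_iff_eq_add]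
      have hs : Finset.range (r.natDegree + 1) = insert 0 (Finset.Icc 1 r.natDegree) := by
        ext i
        simp only [Finset.mem_range, Finset.mem_insert, Finset.mem_Icc]
        omega
      rw [hs, Finset.sum_insert (by simp), add_comm]
      simp [hasseDeriv_zero]
    rw [hsub]
    refine Valuation.map_sum_lt _ (by simpa using hne _ (h5 r hr)) fun i hi => ?_
    have hlt := H (E (hasseDeriv i r) * E Q.P ^ i) (E r * E (derivative Q.P) ^ i)
      (by simpa using h2 r hr i hi)
    have hg1' : O.valuation (β (E (derivative Q.P)) ^ i) ≠ 0 := by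
      simpa using fun h => absurd h (hne _ h4)
    simp only [map_mul, map_pow] at hlt hg1' hzv ⊢
    refine lt_of_mul_lt_mul_right (a := O.valuation (β (E (derivative Q.P))) ^ i)
      (lt_of_le_of_lt ?_ hlt) zero_le
    rw [mul_assoc, ← mul_pow]
    exact mul_le_mul_right (pow_le_pow_left₀ zero_le hzv i) _
  have hGmem : Q.G ∈ rs := Finset.mem_insert_self _ _
  have hG' : E' Q.G ≠ 0 := by
    intro h0
    have := Valuation.map_eq_of_sub_lt _ (hclose _ hGmem)
    rw [h0, map_zero] at this
    exact hne _ (h5 _ hGmem) ((O.valuation.zero_iff).1 this.symm)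
  obtain ⟨B, ψ, hB, hc, hψ⟩ := Q.exists_hom (β.comp σ) (fun j => β (a (some j))) (β (a none) + z)
    ((hE' Q.P).trans hz) hG'
  refine ⟨B, ψ, hB, hc, fun y hy c hyc => ?_⟩
  have hc0 : α c ≠ 0 := by
    intro h0
    simp [h0] at hyc
  have hy0 : (y : Ω) ≠ 0 := by
    intro h0
    simp [h0] at hyc
  have hRmem : R y ∈ rs :=
    Finset.mem_insert_of_mem (Finset.mem_image_of_mem _ (Finset.mem_erase.2 ⟨hy0, hy⟩))
  have hψy : ψ y * E' Q.G = E' (R y) := hψ y (R y) (hR y hy)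
  refine approx_cancel O.valuation hG' ?_
  rw [hψy]
  have t1 := approx_trans ν (h3 y hy hy0) (approx_mul ν hyc (h5 _ hGmem))
  have t2 : O.valuation (β (E (R y)) - β c * β (E Q.G)) < O.valuation (β c * β (E Q.G)) := by
    have := H (E (R y) - c * E Q.G) (c * E Q.G) (by simpa using t1)
    simpa using this
  have t3 := approx_mul O.valuation (approx_symm O.valuation (hclose _ hGmem)) (hne _ hc0)
  rw [mul_comm _ (β c), mul_comm _ (β c)] at t3
  exact approx_trans _ (hclose _ hRmem) (approx_trans _ t2 t3)

end Paper

namespace Paper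

open Filter

section ResFun

variable {K : Type*} [Field K] (O : ValuationSubring K)

/-- The residue map of a valuation ring, extended by zero. -/
noncomputable def resFun (x : K) : IsLocalRing.ResidueField O :=
  open Classical in if h : x ∈ O then IsLocalRing.residue O ⟨x, h⟩ else 0

theorem resFun_coe (x : O) : resFun O x = IsLocalRing.residue O x := by
  simp [resFun]

theorem resFun_of_mem {x : K} (h : x ∈ O) : resFun O x = IsLocalRing.residue O ⟨x, h⟩ := by
  simp [resFun, h]

theorem resFun_eq_zero_iff {x : K} (h : x ∈ O) : resFun O x = 0 ↔ O.valuation x < 1 := by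
  rw [resFun_of_mem O h, IsLocalRing.residue_eq_zero_iff, ValuationSubring.valuation_lt_one_iff]

theorem resFun_add {x y : K} (hx : x ∈ O) (hy : y ∈ O) :
    resFun O (x + y) = resFun O x + resFun O y := by
  rw [resFun_of_mem O hx, resFun_of_mem O hy, resFun_of_mem O (add_mem hx hy), ← map_add]
  rfl

theorem resFun_mul {x y : K} (hx : x ∈ O) (hy : y ∈ O) :
    resFun O (x * y) = resFun O x * resFun O y := by
  rw [resFun_of_mem O hx, resFun_of_mem O hy, resFun_of_mem O (mul_mem hx hy), ← map_mul]
  rfl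

theorem resFun_one : resFun O 1 = 1 := by
  rw [resFun_of_mem O (one_mem O)]
  exact map_one _

theorem resFun_zero : resFun O 0 = 0 := by
  rw [resFun_of_mem O (zero_mem O)]
  exact map_zero _

theorem exists_resFun_eq (y : IsLocalRing.ResidueField O) : ∃ x ∈ O, resFun O x = y := by
  obtain ⟨x, rfl⟩ := IsLocalRing.residue_surjective y
  exact ⟨x, x.2, resFun_coe O x⟩

theorem resFun_eq_iff {x y : K} (hx : x ∈ O) (hy : y ∈ O) :
    resFun O x = resFun O y ↔ O.valuation (x - y) < 1 := by
  rw [← resFun_eq_zero_iff O (sub_mem hx hy), sub_eq_add_neg, resFun_add O hx (neg_mem hy)]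
  have : resFun O (-y) = - resFun O y := by
    rw [eq_neg_iff_add_eq_zero, ← resFun_add O (neg_mem hy) hy, neg_add_cancel, resFun_zero]
  rw [this, ← sub_eq_add_neg, sub_eq_zero]

end ResFun

section Coarsening

variable {K : Type*} [Field K] {O O' : ValuationSubring K}

theorem valuation_le_of_le (h : O ≤ O') {x y : K} (hxy : O.valuation x ≤ O.valuation y) :
    O'.valuation x ≤ O'.valuation y := by
  rw [ValuationSubring.valuation_le_iff] at hxy ⊢
  obtain ⟨a, ha⟩ := hxy
  exact ⟨⟨a, h a.2⟩, ha⟩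

theorem valuation_lt_of_le (h : O ≤ O') {x y : K} (hxy : O'.valuation x < O'.valuation y) :
    O.valuation x < O.valuation y :=
  lt_of_not_ge fun h' => not_le_of_gt hxy (valuation_le_of_le h h')

theorem NewtonHensel.of_le (hO : NewtonHensel O) (h : O ≤ O') : NewtonHensel O' := by
  intro d g hd h1 hg
  obtain ⟨z, hz, hzv⟩ := hO d g hd h1 fun i h2 hi => valuation_lt_of_le h (hg i h2 hi)
  exact ⟨z, hz, valuation_le_of_le h hzv⟩

end Coarsening

section Germ

variable {I : Type*} (U : Ultrafilter I)

/-- The diagonal embedding of a field into an ultrapower. -/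
noncomputable def germDiag (K : Type*) [Field K] : K →+* Germ (U : Filter I) K :=
  (Germ.coeRingHom (U : Filter I)).comp (Pi.constRingHom I K)

variable {U} {K : Type*} [Field K] (O : ValuationSubring K)

theorem germDiag_apply (x : K) : germDiag U K x = ((fun _ => x : I → K) : Germ (U : Filter I) K) :=
  rfl

theorem exists_germ_rep {J : Type*} (x : J → Germ (U : Filter I) K) :
    ∃ a : J → I → K, ∀ j, x j = (a j : Germ (U : Filter I) K) := by
  choose a ha using fun j => Quotient.exists_rep (x j)
  exact ⟨a, fun j => (ha j).symm⟩

variable (U) in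
/-- The ultrapower of a valuation ring. -/
def germSubring : ValuationSubring (Germ (U : Filter I) K) where
  carrier := {x | Germ.LiftPred (· ∈ O) x}
  mul_mem' {a b} := by
    refine Germ.inductionOn₂ a b fun a b ha hb => ?_
    exact (Germ.liftPred_coe.1 ha).mp ((Germ.liftPred_coe.1 hb).mono fun i h h' => mul_mem h' h)
  one_mem' := Germ.liftPred_coe (f := fun _ => (1 : K)).2 (Eventually.of_forall fun _ => one_mem O)
  add_mem' {a b} := by
    refine Germ.inductionOn₂ a b fun a b ha hb => ?_
    exact (Germ.liftPred_coe.1 ha).mp ((Germ.liftPred_coe.1 hb).mono fun i h h' => add_mem h' h)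
  zero_mem' := Germ.liftPred_coe (f := fun _ => (0 : K)).2
    (Eventually.of_forall fun _ => zero_mem O)
  neg_mem' {a} := by
    refine Germ.inductionOn a fun a ha => ?_
    exact (Germ.liftPred_coe.1 ha).mono fun i h => neg_mem h
  mem_or_inv_mem' x := by
    refine Germ.inductionOn x fun a => ?_
    have : ∀ᶠ i in (U : Filter I), a i ∈ O ∨ (a i)⁻¹ ∈ O :=
      Eventually.of_forall fun i => O.mem_or_inv_mem (a i)
    exact Ultrafilter.eventually_or.1 this

theorem coe_mem_germSubring {a : I → K} :
    (a : Germ (U : Filter I) K) ∈ germSubring U O ↔ ∀ᶠ i in (U : Filter I), a i ∈ O := Iff.rfl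

theorem germSubring_mono {O O' : ValuationSubring K} (h : O ≤ O') :
    germSubring U O ≤ germSubring U O' := by
  intro x
  refine Germ.inductionOn x fun a ha => ?_
  rw [coe_mem_germSubring] at ha ⊢
  exact ha.mono fun i hi => h hi

theorem germDiag_mem_germSubring {x : K} : germDiag U K x ∈ germSubring U O ↔ x ∈ O := by
  rw [germDiag_apply, coe_mem_germSubring]
  simp

theorem germ_valuation_le_iff {a b : I → K} :
    (germSubring U O).valuation (a : Germ (U : Filter I) K) ≤ (germSubring U O).valuation
      (b : Germ (U : Filter I) K) ↔ ∀ᶠ i in (U : Filter I), O.valuation (a i) ≤ O.valuation (b i)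
        := by
  classical
  rw [ValuationSubring.valuation_le_iff]
  constructor
  · rintro ⟨⟨c, hc⟩, h⟩
    revert hc h
    refine Germ.inductionOn c fun c hc h => ?_
    have h' := Germ.coe_eq.1 h
    filter_upwards [(coe_mem_germSubring O).1 hc, h'] with i h1 h2
    exact (O.valuation_le_iff _ _).2 ⟨⟨c i, h1⟩, h2⟩
  · intro h
    let c : I → K := fun i => if h : O.valuation (a i) ≤ O.valuation (b i) then
      ((O.valuation_le_iff _ _).1 h).choose else 0
    have hc : ∀ i, O.valuation (a i) ≤ O.valuation (b i) → c i ∈ O ∧ c i * b i = a i := by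
      intro i hi
      simp only [c, dif_pos hi]
      exact ⟨SetLike.coe_mem _, ((O.valuation_le_iff _ _).1 hi).choose_spec⟩
    exact ⟨⟨(c : Germ (U : Filter I) K), h.mono fun i hi => (hc i hi).1⟩,
      Germ.coe_eq.2 (h.mono fun i hi => (hc i hi).2)⟩

theorem germ_valuation_lt_iff {a b : I → K} :
    (germSubring U O).valuation (a : Germ (U : Filter I) K) < (germSubring U O).valuation
      (b : Germ (U : Filter I) K) ↔ ∀ᶠ i in (U : Filter I), O.valuation (a i) < O.valuation (b i)
        := by
  rw [← not_le, germ_valuation_le_iff, ← Ultrafilter.eventually_not]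
  simp only [not_le]

theorem germ_valuation_lt_one_iff {a : I → K} :
    (germSubring U O).valuation (a : Germ (U : Filter I) K) < 1 ↔
      ∀ᶠ i in (U : Filter I), O.valuation (a i) < 1 := by
  have := germ_valuation_lt_iff (U := U) O (a := a) (b := fun _ => 1)
  have e : ((fun _ => 1 : I → K) : Germ (U : Filter I) K) = 1 := rfl
  rwa [e, map_one, map_one] at this

theorem coe_eq_zero_iff {a : I → K} :
    (a : Germ (U : Filter I) K) = 0 ↔ ∀ᶠ i in (U : Filter I), a i = 0 :=
  Germ.coe_eq (g := fun _ => 0)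

theorem NewtonHensel.germ {O : ValuationSubring K} (hO : NewtonHensel O) :
    NewtonHensel (germSubring U O) := by
  classical
  intro d g hd h1 hg
  obtain ⟨a, ha⟩ := exists_germ_rep g
  obtain rfl : g = fun j => (a j : Germ (U : Filter I) K) := funext ha
  have e1 : ∀ᶠ i in (U : Filter I), a 1 i ≠ 0 := by
    rw [Ultrafilter.eventually_not]
    exact fun h => h1 ((coe_eq_zero_iff).2 h)
  have e2 : ∀ᶠ i in (U : Filter I), ∀ k ∈ Finset.Icc 2 d,
      O.valuation (a k i * a 0 i ^ (k - 1)) < O.valuation (a 1 i ^ k) := by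
    rw [Filter.eventually_all_finset]
    intro k hk
    rw [Finset.mem_Icc] at hk
    exact (germ_valuation_lt_iff O).1 (hg k hk.1 hk.2)
  have e3 : ∀ᶠ i in (U : Filter I), ∃ z, ∑ k ∈ Finset.range (d + 1), a k i * z ^ k = 0 ∧
      O.valuation (z * a 1 i) ≤ O.valuation (a 0 i) := by
    filter_upwards [e1, e2] with i h1 h2
    exact hO d (fun k => a k i) hd h1 fun k hk hkd => h2 k (Finset.mem_Icc.2 ⟨hk, hkd⟩)
  let z : I → K := fun i => if h : ∃ z, ∑ k ∈ Finset.range (d + 1), a k i * z ^ k = 0 ∧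
      O.valuation (z * a 1 i) ≤ O.valuation (a 0 i) then h.choose else 0
  have hz : ∀ᶠ i in (U : Filter I), ∑ k ∈ Finset.range (d + 1), a k i * z i ^ k = 0 ∧
      O.valuation (z i * a 1 i) ≤ O.valuation (a 0 i) := by
    filter_upwards [e3] with i h
    simp only [z, dif_pos h]
    exact h.choose_spec
  refine ⟨(z : Germ (U : Filter I) K), ?_, ?_⟩
  · have : ∑ k ∈ Finset.range (d + 1), (a k : Germ (U : Filter I) K) *
        (z : Germ (U : Filter I) K) ^ k =
        ((fun i => ∑ k ∈ Finset.range (d + 1), a k i * z i ^ k : I → K) : Germ (U : Filter I) K) :=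
          by
      have h := map_sum (Germ.coeRingHom (R := K) (U : Filter I)) (fun k => a k * z ^ k)
        (Finset.range (d + 1))
      have e : (∑ k ∈ Finset.range (d + 1), a k * z ^ k) =
        fun i => ∑ k ∈ Finset.range (d + 1), a k i * z i ^ k := by
        ext i
        simp
      rw [e] at h
      exact h.symm
    rw [this, coe_eq_zero_iff]
    exact hz.mono fun i h => h.1
  · exact (germ_valuation_le_iff O).2 (hz.mono fun i h => h.2)

theorem eval₂_germDiag {S J : Type*} [CommRing S] (h : S →+* K) (a : J → I → K)
    (f : MvPolynomial J S) :
    MvPolynomial.eval₂ ((germDiag U K).comp h) (fun j => (a j : Germ (U : Filter I) K)) f =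
      ((fun i => MvPolynomial.eval₂ h (fun j => a j i) f : I → K) : Germ (U : Filter I) K) := by
  let Φ : MvPolynomial J S →+* Germ (U : Filter I) K := (Germ.coeRingHom (U : Filter I)).comp
    (RingHom.pi fun i => MvPolynomial.eval₂Hom h fun j => a j i)
  have : MvPolynomial.eval₂Hom ((germDiag U K).comp h) (fun j => (a j : Germ (U : Filter I) K)) =
      Φ := by
    refine MvPolynomial.ringHom_ext (fun s => ?_) fun j => ?_
    · simp only [MvPolynomial.eval₂Hom_C]
      change _ = ((fun i => MvPolynomial.eval₂Hom h (fun j => a j i) (MvPolynomial.C s) : I → K) :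
        Germ (U : Filter I) K)
      simp only [MvPolynomial.eval₂Hom_C]
      rfl
    · simp only [MvPolynomial.eval₂Hom_X']
      change _ = ((fun i => MvPolynomial.eval₂Hom h (fun j => a j i) (MvPolynomial.X j) : I → K) :
        Germ (U : Filter I) K)
      simp only [MvPolynomial.eval₂Hom_X']
  exact congrArg (fun Ψ : MvPolynomial J S →+* Germ (U : Filter I) K => Ψ f) this

theorem sepHom_germDiag : SepHom (germDiag U K) := by
  classical
  intro p hp hK n e y h hy
  obtain ⟨a, ha⟩ := exists_germ_rep y
  obtain rfl : y = fun j => (a j : Germ (U : Filter I) K) := funext ha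
  have h1 : ∀ᶠ i in (U : Filter I), ∑ j, e j * a j i ^ p = 0 := by
    rw [← coe_eq_zero_iff, ← h]
    have h := map_sum (Germ.coeRingHom (R := K) (U : Filter I)) (fun j => (fun _ => e j) * a j ^ p)
        Finset.univ
    refine Eq.trans ?_ h
    change _ = ((∑ j, (fun _ => e j) * a j ^ p : I → K) : Germ (U : Filter I) K)
    congr 1
    ext i
    simp
  have h2 : ∀ᶠ i in (U : Filter I), (fun j => a j i) ≠ 0 := by
    rw [Ultrafilter.eventually_not]
    intro h
    apply hy
    ext j
    exact coe_eq_zero_iff.2 (h.mono fun i hi => congrFun hi j)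
  obtain ⟨i, h3, h4⟩ := (h1.and h2).exists
  exact ⟨_, h4, h3⟩

variable (U) in
/-- The comparison of the residue field of an ultrapower with the ultrapower of the
residue field. -/
noncomputable def germResidue : IsLocalRing.ResidueField (germSubring U O) →+*
    Germ (U : Filter I) (IsLocalRing.ResidueField O) :=
  let f : germSubring U O →+* Germ (U : Filter I) (IsLocalRing.ResidueField O) :=
    { toFun := fun x => Germ.map (resFun O) x.1
      map_one' := by
        change ((fun _ => resFun O 1 : I → _) : Germ (U : Filter I) (IsLocalRing.ResidueField O)) =
          _
        rw [resFun_one]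
        rfl
      map_zero' := by
        change ((fun _ => resFun O 0 : I → _) : Germ (U : Filter I) (IsLocalRing.ResidueField O)) =
          _
        rw [resFun_zero]
        rfl
      map_mul' := by
        rintro ⟨x, hx⟩ ⟨y, hy⟩
        revert hx hy
        refine Germ.inductionOn₂ x y fun a b hx hy => ?_
        refine Germ.coe_eq.2 ?_
        filter_upwards [(coe_mem_germSubring O).1 hx, (coe_mem_germSubring O).1 hy] with i h1 h2
        exact resFun_mul O h1 h2
      map_add' := by
        rintro ⟨x, hx⟩ ⟨y, hy⟩
        revert hx hy
        refine Germ.inductionOn₂ x y fun a b hx hy => ?_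
        refine Germ.coe_eq.2 ?_
        filter_upwards [(coe_mem_germSubring O).1 hx, (coe_mem_germSubring O).1 hy] with i h1 h2
        exact resFun_add O h1 h2 }
  Ideal.Quotient.lift _ f (by
    rintro ⟨x, hx⟩ h
    rw [ValuationSubring.valuation_lt_one_iff] at h
    revert hx h
    refine Germ.inductionOn x fun a hx h => ?_
    refine coe_eq_zero_iff.2 ?_
    filter_upwards [(coe_mem_germSubring O).1 hx, (germ_valuation_lt_one_iff O).1 h] with i h1 h2
    exact (resFun_eq_zero_iff O h1).2 h2)

theorem germResidue_coe {a : I → K} (h : (a : Germ (U : Filter I) K) ∈ germSubring U O) :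
    germResidue U O (IsLocalRing.residue _ ⟨(a : Germ (U : Filter I) K), h⟩) =
      ((fun i => resFun O (a i) : I → _) : Germ (U : Filter I) (IsLocalRing.ResidueField O)) := rfl

theorem germResidue_surjective : Function.Surjective (germResidue U O) := by
  intro y
  refine Germ.inductionOn y fun b => ?_
  choose a ha h using fun i => exists_resFun_eq O (b i)
  refine ⟨IsLocalRing.residue _ ⟨(a : Germ (U : Filter I) K),
    (coe_mem_germSubring O).2 (Eventually.of_forall ha)⟩, ?_⟩
  rw [germResidue_coe]
  simp only [h]

end Germ

/-- If every finite part of the diagram of `F` over `S` is realized in `K`, within prescribed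
sets, then `F` embeds over `S` into an ultrapower of `K`. -/
theorem exists_hom_germ {S F K : Type u} [Field S] [Field F] [Field K] (f : S →+* F)
    (σ : S →+* K) (Q : F → Set K)
    (h : ∀ (Z : Finset (MvPolynomial F S)) (s : Finset F),
      (∀ p ∈ Z, MvPolynomial.eval₂ f id p = 0) →
      ∃ x : F → K, (∀ p ∈ Z, MvPolynomial.eval₂ σ x p = 0) ∧ ∀ a ∈ s, x a ∈ Q a) :
    ∃ (I : Type u) (U : Ultrafilter I) (ζ : F →+* Germ (U : Filter I) K),
      (∀ c, ζ (f c) = germDiag U K (σ c)) ∧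
      ∀ a, ∃ x : I → K, ζ a = (x : Germ (U : Filter I) K) ∧ ∀ᶠ i in (U : Filter I), x i ∈ Q a := by
  classical
  let I := Finset {p : MvPolynomial F S // MvPolynomial.eval₂ f id p = 0} × Finset F
  let U : Ultrafilter I := Ultrafilter.of atTop
  have hU : ∀ {p : I → Prop}, (∀ᶠ i in atTop, p i) → ∀ᶠ i in (U : Filter I), p i :=
    fun hp => (Ultrafilter.of_le atTop) hp
  have h' : ∀ i : I, ∃ x : F → K, (∀ p ∈ i.1, MvPolynomial.eval₂ σ x p.1 = 0) ∧
      ∀ a ∈ i.2, x a ∈ Q a := by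
    intro i
    obtain ⟨x, hx, hs⟩ := h (i.1.image Subtype.val) i.2 (by
      intro p hp
      obtain ⟨q, hq, rfl⟩ := Finset.mem_image.1 hp
      exact q.2)
    exact ⟨x, fun p hp => hx p.1 (Finset.mem_image_of_mem _ hp), hs⟩
  choose x hx hQ using h'
  let ξ : F → Germ (U : Filter I) K := fun a => ((fun i => x i a : I → K) : Germ (U : Filter I) K)
  have key : ∀ p : MvPolynomial F S, MvPolynomial.eval₂ f id p = 0 →
      MvPolynomial.eval₂ ((germDiag U K).comp σ) ξ p = 0 := by
    intro p hp
    rw [eval₂_germDiag σ (fun a i => x i a) p, coe_eq_zero_iff]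
    apply hU
    filter_upwards [eventually_ge_atTop (({⟨p, hp⟩}, ∅) : I)] with i hi
    exact hx i ⟨p, hp⟩ (hi.1 (Finset.mem_singleton_self _))
  have key2 : ∀ p q : MvPolynomial F S, MvPolynomial.eval₂ f id p = MvPolynomial.eval₂ f id q →
      MvPolynomial.eval₂ ((germDiag U K).comp σ) ξ p =
        MvPolynomial.eval₂ ((germDiag U K).comp σ) ξ q := by
    intro p q hpq
    rw [← sub_eq_zero, ← MvPolynomial.eval₂_sub]
    exact key _ (by rw [MvPolynomial.eval₂_sub, hpq, sub_self])
  refine ⟨I, U, ⟨⟨⟨ξ, ?_⟩, ?_⟩, ?_, ?_⟩, ?_, ?_⟩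
  · simpa using key2 (MvPolynomial.X 1) (MvPolynomial.C 1) (by simp)
  · intro a b
    have := key2 (MvPolynomial.X (a * b)) (MvPolynomial.X a * MvPolynomial.X b) (by simp)
    rwa [MvPolynomial.eval₂_X, MvPolynomial.eval₂_mul, MvPolynomial.eval₂_X,
      MvPolynomial.eval₂_X] at this
  · simpa using key2 (MvPolynomial.X 0) (MvPolynomial.C 0) (by simp)
  · intro a b
    have := key2 (MvPolynomial.X (a + b)) (MvPolynomial.X a + MvPolynomial.X b) (by simp)
    rwa [MvPolynomial.eval₂_X, MvPolynomial.eval₂_add, MvPolynomial.eval₂_X,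
      MvPolynomial.eval₂_X] at this
  · intro c
    simpa using key2 (MvPolynomial.X (f c)) (MvPolynomial.C c) (by simp)
  · intro a
    refine ⟨fun i => x i a, rfl, hU ?_⟩
    filter_upwards [eventually_ge_atTop ((∅, {a}) : I)] with i hi
    exact hQ i a (hi.2 (Finset.mem_singleton_self _))

end Paper

namespace Paper

section Agreement

variable {α : Type u} {L : FirstOrder.Language.{u, 0}}
  (str : ∀ (M : Type u) [CommRing M] (O : Set M) (f : α → M), L.Structure M)

/-- Quantifier-free formulas are determined by finitely many polynomial conditions, and
existential formulas by a witness of finitely many polynomial conditions. -/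
theorem exists_finset_of_isQF
    (hT : ∀ {k : ℕ} (t : L.Term (Empty ⊕ Fin k)), ∃ p : MvPolynomial (α ⊕ Fin k) ℤ,
      ∀ (M : Type u) [CommRing M] (O : Set M) (f : α → M) (xs : Fin k → M),
        @Term.realize L M (str M O f) _ (Sum.elim Empty.elim xs) t =
          MvPolynomial.aeval (Sum.elim f xs) p)
    (hR : ∀ {l : ℕ} (R : L.Relations l), ∃ i : Fin l,
      ∀ (M : Type u) [CommRing M] (O : Set M) (f : α → M) (xs : Fin l → M),
        @Structure.RelMap L M (str M O f) l R xs ↔ xs i ∈ O)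
    {k : ℕ} {φ : L.BoundedFormula Empty k} (hφ : φ.IsQF) :
    ∃ Z : Finset (MvPolynomial (α ⊕ Fin k) ℤ),
      ∀ (M : Type u) [CommRing M] (O : Set M) (f : α → M) (xs : Fin k → M)
        (N : Type u) [CommRing N] (O' : Set N) (g : α → N) (ys : Fin k → N),
        (∀ p ∈ Z, (MvPolynomial.aeval (Sum.elim f xs) p = 0 ↔
            MvPolynomial.aeval (Sum.elim g ys) p = 0) ∧
          (MvPolynomial.aeval (Sum.elim f xs) p ∈ O ↔
            MvPolynomial.aeval (Sum.elim g ys) p ∈ O')) →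
        (@BoundedFormula.Realize L M (str M O f) _ _ φ Empty.elim xs ↔
          @BoundedFormula.Realize L N (str N O' g) _ _ φ Empty.elim ys) := by
  classical
  induction hφ with
  | falsum => exact ⟨∅, fun M _ O f xs N _ O' g ys _ => Iff.rfl⟩
  | of_isAtomic h =>
    cases h with
    | equal t₁ t₂ =>
      obtain ⟨p, hp⟩ := hT t₁
      obtain ⟨q, hq⟩ := hT t₂
      refine ⟨{p - q}, fun M _ O f xs N _ O' g ys h => ?_⟩
      have h1 := (h _ (Finset.mem_singleton_self _)).1
      rw [map_sub, map_sub, sub_eq_zero, sub_eq_zero, ← hp M O, ← hq M O, ← hp N O', ← hq N O']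
        at h1
      exact h1
    | rel R ts =>
      obtain ⟨i, hi⟩ := hR R
      obtain ⟨p, hp⟩ := hT (ts i)
      refine ⟨{p}, fun M _ O f xs N _ O' g ys h => ?_⟩
      have h1 := (h _ (Finset.mem_singleton_self _)).2
      rw [← hp M O, ← hp N O'] at h1
      exact ((hi M O f _).trans h1).trans (hi N O' g _).symm
  | imp _ _ ih₁ ih₂ =>
    obtain ⟨Z₁, h₁⟩ := ih₁
    obtain ⟨Z₂, h₂⟩ := ih₂
    refine ⟨Z₁ ∪ Z₂, fun M _ O f xs N _ O' g ys h => ?_⟩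
    exact imp_congr (h₁ M O f xs N O' g ys fun p hp => h p (Finset.mem_union_left _ hp))
      (h₂ M O f xs N O' g ys fun p hp => h p (Finset.mem_union_right _ hp))

theorem exists_finset_of_isExistsN
    (hT : ∀ {k : ℕ} (t : L.Term (Empty ⊕ Fin k)), ∃ p : MvPolynomial (α ⊕ Fin k) ℤ,
      ∀ (M : Type u) [CommRing M] (O : Set M) (f : α → M) (xs : Fin k → M),
        @Term.realize L M (str M O f) _ (Sum.elim Empty.elim xs) t =
          MvPolynomial.aeval (Sum.elim f xs) p)
    (hR : ∀ {l : ℕ} (R : L.Relations l), ∃ i : Fin l,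
      ∀ (M : Type u) [CommRing M] (O : Set M) (f : α → M) (xs : Fin l → M),
        @Structure.RelMap L M (str M O f) l R xs ↔ xs i ∈ O)
    {n k : ℕ} {φ : L.BoundedFormula Empty k} (hφ : IsExistsN n φ) :
    ∃ Z : Finset (MvPolynomial (α ⊕ (Fin k ⊕ Fin n)) ℤ),
      ∀ (M : Type u) [CommRing M] (O : Set M) (f : α → M) (xs : Fin k → M),
        @BoundedFormula.Realize L M (str M O f) _ _ φ Empty.elim xs →
        ∃ a : Fin n → M, ∀ (N : Type u) [CommRing N] (O' : Set N) (g : α → N) (ys : Fin k → N)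
          (b : Fin n → N),
        (∀ p ∈ Z, (MvPolynomial.aeval (Sum.elim f (Sum.elim xs a)) p = 0 ↔
            MvPolynomial.aeval (Sum.elim g (Sum.elim ys b)) p = 0) ∧
          (MvPolynomial.aeval (Sum.elim f (Sum.elim xs a)) p ∈ O ↔
            MvPolynomial.aeval (Sum.elim g (Sum.elim ys b)) p ∈ O')) →
          @BoundedFormula.Realize L N (str N O' g) _ _ φ Empty.elim ys := by
  classical
  induction hφ with
  | @qf n k φ h =>
    obtain ⟨Z, hZ⟩ := exists_finset_of_isQF str hT hR h
    refine ⟨Z.image (MvPolynomial.rename (Sum.map id Sum.inl)), fun M _ O f xs hφ =>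
      ⟨0, fun N _ O' g ys b hb => ?_⟩⟩
    refine (hZ M O f xs N O' g ys fun p hp => ?_).1 hφ
    have := hb _ (Finset.mem_image_of_mem _ hp)
    simpa only [MvPolynomial.aeval_rename, Sum.elim_comp_map, Function.comp_id,
      Sum.elim_comp_inl] using this
  | @ex n k φ h ih =>
    obtain ⟨Z, hZ⟩ := ih
    let e : Fin (k + 1) ⊕ Fin n → Fin k ⊕ Fin (n + 1) :=
      Sum.elim (Fin.snoc (α := fun _ => Fin k ⊕ Fin (n + 1)) Sum.inl (Sum.inr 0))
        (fun j => Sum.inr j.succ)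
    have he : ∀ (M : Type u) (xs : Fin k → M) (a : Fin (n + 1) → M),
        Sum.elim xs a ∘ e = Sum.elim (Fin.snoc (α := fun _ => M) xs (a 0)) (fun j => a j.succ) := by
      intro M xs a
      ext j
      rcases j with j | j
      · refine Fin.lastCases ?_ (fun i => ?_) j
        · simp [e]
        · simp [e]
      · simp [e]
    refine ⟨Z.image (MvPolynomial.rename (Sum.map id e)), fun M _ O f xs hφ => ?_⟩
    let _ := str M O f
    rw [BoundedFormula.realize_ex] at hφ
    obtain ⟨a₀, ha₀⟩ := hφ
    obtain ⟨a, ha⟩ := hZ M O f _ ha₀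
    refine ⟨Fin.cons a₀ a, fun N _ O' g ys b hb => ?_⟩
    let _ := str N O' g
    rw [BoundedFormula.realize_ex]
    refine ⟨b 0, ha N O' g _ (fun j => b j.succ) fun p hp => ?_⟩
    have := hb _ (Finset.mem_image_of_mem _ hp)
    simpa only [MvPolynomial.aeval_rename, Sum.elim_comp_map, Function.comp_id, he,
      Fin.cons_zero, Fin.cons_succ] using this

end Agreement

section RingTerms

variable {α : Type u}

theorem exists_polynomial_of_ringTerm {k : ℕ} (t : (Language.ring[[α]]).Term (Empty ⊕ Fin k)) :
    ∃ p : MvPolynomial (α ⊕ Fin k) ℤ,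
      ∀ (M : Type u) [CommRing M] (f : α → M) (xs : Fin k → M),
        @Term.realize _ M (ringConStructure f) _ (Sum.elim Empty.elim xs) t =
          MvPolynomial.aeval (Sum.elim f xs) p := by
  induction t with
  | var i =>
    rcases i with i | i
    · exact i.elim
    · exact ⟨MvPolynomial.X (Sum.inr i), fun M _ f xs => by simp⟩
  | @func l F ts ih =>
    choose p hp using ih
    rcases F with F | F
    · cases F with
      | add =>
        refine ⟨p 0 + p 1, fun M _ f xs => ?_⟩
        rw [map_add, ← hp, ← hp]
        rfl
      | mul =>
        refine ⟨p 0 * p 1, fun M _ f xs => ?_⟩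
        rw [map_mul, ← hp, ← hp]
        rfl
      | neg =>
        refine ⟨-p 0, fun M _ f xs => ?_⟩
        rw [map_neg, ← hp]
        rfl
      | zero => exact ⟨0, fun M _ f xs => by rw [map_zero]; rfl⟩
      | one => exact ⟨1, fun M _ f xs => by rw [map_one]; rfl⟩
    · match l, F with
      | 0, c =>
        refine ⟨MvPolynomial.X (Sum.inl c), fun M _ f xs => ?_⟩
        rw [MvPolynomial.aeval_X]
        rfl

theorem exists_polynomial_of_valTerm {k : ℕ} (t : (Lval[[α]]).Term (Empty ⊕ Fin k)) :
    ∃ p : MvPolynomial (α ⊕ Fin k) ℤ,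
      ∀ (M : Type u) [CommRing M] (O : Set M) (f : α → M) (xs : Fin k → M),
        @Term.realize _ M (valConStructure O f) _ (Sum.elim Empty.elim xs) t =
          MvPolynomial.aeval (Sum.elim f xs) p := by
  induction t with
  | var i =>
    rcases i with i | i
    · exact i.elim
    · exact ⟨MvPolynomial.X (Sum.inr i), fun M _ O f xs => by simp⟩
  | @func l F ts ih =>
    choose p hp using ih
    rcases F with (F | F) | F
    · cases F with
      | add =>
        refine ⟨p 0 + p 1, fun M _ O f xs => ?_⟩
        rw [map_add, ← hp _ M O, ← hp _ M O]
        rfl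
      | mul =>
        refine ⟨p 0 * p 1, fun M _ O f xs => ?_⟩
        rw [map_mul, ← hp _ M O, ← hp _ M O]
        rfl
      | neg =>
        refine ⟨-p 0, fun M _ O f xs => ?_⟩
        rw [map_neg, ← hp _ M O]
        rfl
      | zero => exact ⟨0, fun M _ O f xs => by rw [map_zero]; rfl⟩
      | one => exact ⟨1, fun M _ O f xs => by rw [map_one]; rfl⟩
    · exact F.elim
    · match l, F with
      | 0, c =>
        refine ⟨MvPolynomial.X (Sum.inl c), fun M _ O f xs => ?_⟩
        rw [MvPolynomial.aeval_X]
        rfl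

theorem exists_ringTerm_of_polynomial {k : ℕ} (p : MvPolynomial (α ⊕ Fin k) ℤ) :
    ∃ t : (Language.ring[[α]]).Term (Empty ⊕ Fin k),
      ∀ (M : Type u) [CommRing M] (f : α → M) (xs : Fin k → M),
        @Term.realize _ M (ringConStructure f) _ (Sum.elim Empty.elim xs) t =
          MvPolynomial.aeval (Sum.elim f xs) p := by
  have hadd : ∀ t₁ t₂ : (Language.ring[[α]]).Term (Empty ⊕ Fin k),
      ∃ t : (Language.ring[[α]]).Term (Empty ⊕ Fin k),
      ∀ (M : Type u) [CommRing M] (f : α → M) (xs : Empty ⊕ Fin k → M),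
        @Term.realize _ M (ringConStructure f) _ xs t =
          @Term.realize _ M (ringConStructure f) _ xs t₁ +
          @Term.realize _ M (ringConStructure f) _ xs t₂ := fun t₁ t₂ =>
    ⟨Term.func (L := Language.ring[[α]]) (l := 2) (Sum.inl FirstOrder.ringFunc.add) ![t₁, t₂],
      fun M _ f xs => rfl⟩
  induction p using MvPolynomial.induction_on with
  | C a =>
    induction a using Int.induction_on with
    | zero => exact ⟨Term.func (L := Language.ring[[α]]) (l := 0)
      (Sum.inl FirstOrder.ringFunc.zero) ![],
      fun M _ f xs => by simp only [map_zero]; rfl⟩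
    | succ i ih =>
      obtain ⟨t, ht⟩ := ih
      obtain ⟨t', ht'⟩ := hadd t (Term.func (L := Language.ring[[α]]) (l := 0)
        (Sum.inl FirstOrder.ringFunc.one) ![])
      refine ⟨t', fun M _ f xs => ?_⟩
      rw [ht', ht]
      simp only [map_add, map_one]
      rfl
    | pred i ih =>
      obtain ⟨t, ht⟩ := ih
      obtain ⟨t', ht'⟩ := hadd t (Term.func (L := Language.ring[[α]]) (l := 1)
        (Sum.inl FirstOrder.ringFunc.neg) ![Term.func (L := Language.ring[[α]]) (l := 0)
        (Sum.inl FirstOrder.ringFunc.one) ![] ])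
      refine ⟨t', fun M _ f xs => ?_⟩
      rw [ht', ht]
      simp only [sub_eq_add_neg, map_add, map_neg, map_one]
      rfl
  | add p q hp hq =>
    obtain ⟨t₁, h₁⟩ := hp
    obtain ⟨t₂, h₂⟩ := hq
    obtain ⟨t, ht⟩ := hadd t₁ t₂
    exact ⟨t, fun M _ f xs => by rw [ht, h₁, h₂, map_add]⟩
  | mul_X p i hp =>
    obtain ⟨t₁, h₁⟩ := hp
    rcases i with c | i
    · refine ⟨Term.func (L := Language.ring[[α]]) (l := 2) (Sum.inl FirstOrder.ringFunc.mul)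
        ![t₁, Term.func (L := Language.ring[[α]]) (l := 0) (Sum.inr c) ![] ], fun M _ f xs => ?_⟩
      rw [map_mul, ← h₁, MvPolynomial.aeval_X]
      rfl
    · refine ⟨Term.func (L := Language.ring[[α]]) (l := 2) (Sum.inl FirstOrder.ringFunc.mul)
        ![t₁, Term.var (Sum.inr i)], fun M _ f xs => ?_⟩
      rw [map_mul, ← h₁, MvPolynomial.aeval_X]
      rfl

theorem IsExistsN.exs {L : Language} {n j : ℕ} {φ : L.BoundedFormula Empty n}
    (h : IsExistsN j φ) : IsExistsN (n + j) φ.exs := by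
  induction n generalizing j with
  | zero => simpa [BoundedFormula.exs] using h
  | succ n ih =>
    have := ih (IsExistsN.ex h)
    rwa [show n + 1 + j = n + (j + 1) by ring]

theorem exists_sentence_of_system {m : ℕ} (fs : Finset (MvPolynomial (α ⊕ Fin m) ℤ))
    (g : MvPolynomial (α ⊕ Fin m) ℤ) :
    ∃ φ : (Language.ring[[α]]).Sentence, IsExistsN m φ ∧
      ∀ (M : Type u) [CommRing M] (f : α → M), RealizeRing M f φ ↔
        ∃ x : Fin m → M, (∀ p ∈ fs, MvPolynomial.aeval (Sum.elim f x) p = 0) ∧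
          MvPolynomial.aeval (Sum.elim f x) g ≠ 0 := by
  classical
  have hQF : ∃ ψ : (Language.ring[[α]]).BoundedFormula Empty m, ψ.IsQF ∧
      ∀ (M : Type u) [CommRing M] (f : α → M) (x : Fin m → M),
      @BoundedFormula.Realize _ M (ringConStructure f) _ _ ψ Empty.elim x ↔
        (∀ p ∈ fs, MvPolynomial.aeval (Sum.elim f x) p = 0) ∧
          MvPolynomial.aeval (Sum.elim f x) g ≠ 0 := by
    obtain ⟨t0, ht0⟩ := exists_ringTerm_of_polynomial (0 : MvPolynomial (α ⊕ Fin m) ℤ)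
    induction fs using Finset.induction_on with
    | empty =>
      obtain ⟨t, ht⟩ := exists_ringTerm_of_polynomial g
      refine ⟨∼(t.bdEqual t0), (BoundedFormula.IsAtomic.equal t t0).isQF.not, fun M _ f x => ?_⟩
      let _ := ringConStructure f
      rw [BoundedFormula.realize_not, BoundedFormula.realize_bdEqual, ht, ht0]
      simp
    | insert p fs hp ih =>
      obtain ⟨ψ, hψ, h⟩ := ih
      obtain ⟨t, ht⟩ := exists_ringTerm_of_polynomial p
      refine ⟨t.bdEqual t0 ⊓ ψ, (BoundedFormula.IsAtomic.equal t t0).isQF.inf hψ,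
        fun M _ f x => ?_⟩
      let _ := ringConStructure f
      rw [BoundedFormula.realize_inf, BoundedFormula.realize_bdEqual, ht, ht0, h]
      simp [and_assoc]
  obtain ⟨ψ, hψ, h⟩ := hQF
  refine ⟨ψ.exs, by simpa using (IsExistsN.qf (n := 0) hψ).exs, fun M _ f => ?_⟩
  let _ := ringConStructure f
  refine (BoundedFormula.realize_exs (φ := ψ) (v := default)).trans (exists_congr fun x => ?_)
  rw [← h M f x]
  exact iff_of_eq (congrArg (fun v => ψ.Realize v x) (Subsingleton.elim _ _))

end RingTerms

/-- Solvability of a finite system of polynomial equations and one inequation. -/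
def Solv {m : ℕ} {S M : Type*} [CommRing S] [CommRing M] (h : S →+* M)
    (fs : Finset (MvPolynomial (Fin m) S)) (g : MvPolynomial (Fin m) S) : Prop :=
  ∃ x : Fin m → M, (∀ p ∈ fs, MvPolynomial.eval₂ h x p = 0) ∧ MvPolynomial.eval₂ h x g ≠ 0

section Solv

variable {S : Type u} [CommRing S]

/-- Constants as variables. -/
noncomputable def absorbConstants (S : Type u) [CommRing S] (m : ℕ) :
    MvPolynomial (S ⊕ Fin m) ℤ →+* MvPolynomial (Fin m) S :=
  (MvPolynomial.aeval (Sum.elim MvPolynomial.C MvPolynomial.X)).toRingHom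

theorem eval₂_absorbConstants {m : ℕ} {M : Type*} [CommRing M] (h : S →+* M) (x : Fin m → M)
    (p : MvPolynomial (S ⊕ Fin m) ℤ) :
    MvPolynomial.eval₂ h x (absorbConstants S m p) = MvPolynomial.aeval (Sum.elim h x) p := by
  have : (MvPolynomial.eval₂Hom h x).comp (absorbConstants S m) =
      (MvPolynomial.aeval (Sum.elim h x)).toRingHom := by
    refine MvPolynomial.ringHom_ext (fun s => ?_) fun j => ?_
    · simp [absorbConstants]
    · rcases j with j | j <;> simp [absorbConstants]
  exact congrArg (fun Ψ : _ →+* M => Ψ p) this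

theorem absorbConstants_surjective (m : ℕ) : Function.Surjective (absorbConstants S m) := by
  intro p
  induction p using MvPolynomial.induction_on with
  | C a => exact ⟨MvPolynomial.X (Sum.inl a), by simp [absorbConstants]⟩
  | add p q hp hq =>
    obtain ⟨p, rfl⟩ := hp
    obtain ⟨q, rfl⟩ := hq
    exact ⟨p + q, map_add _ _ _⟩
  | mul_X p i hp =>
    obtain ⟨p, rfl⟩ := hp
    exact ⟨p * MvPolynomial.X (Sum.inr i), by rw [map_mul]; simp [absorbConstants]⟩

theorem exists_sentence_solv {m : ℕ} (fs : Finset (MvPolynomial (Fin m) S))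
    (g : MvPolynomial (Fin m) S) :
    ∃ φ : (Language.ring[[S]]).Sentence, IsExistsN m φ ∧
      ∀ (M : Type u) [CommRing M] (f : S →+* M), RealizeRing M f φ ↔ Solv f fs g := by
  classical
  choose ι hι using absorbConstants_surjective (S := S) m
  obtain ⟨φ, hφ, h⟩ := exists_sentence_of_system (fs.image ι) (ι g)
  refine ⟨φ, hφ, fun M _ f => (h M f).trans (exists_congr fun x => ?_)⟩
  simp only [Finset.forall_mem_image, ← eval₂_absorbConstants, hι]

theorem realizeRing_iff {α M : Type*} [CommRing M] (f : α → M)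
    (φ : (Language.ring[[α]]).Sentence) :
    RealizeRing M f φ ↔
      @BoundedFormula.Realize _ M (ringConStructure f) _ _ φ Empty.elim default :=
  iff_of_eq (congrArg (fun v => @BoundedFormula.Realize _ M (ringConStructure f) _ _ φ v default)
    (Subsingleton.elim _ _))

theorem realizeVal_iff {α M : Type*} [CommRing M] (O : Set M) (f : α → M)
    (φ : (Lval[[α]]).Sentence) :
    RealizeVal M O f φ ↔
      @BoundedFormula.Realize _ M (valConStructure O f) _ _ φ Empty.elim default :=
  iff_of_eq (congrArg (fun v => @BoundedFormula.Realize _ M (valConStructure O f) _ _ φ v default)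
    (Subsingleton.elim _ _))

/-- Transfer of existential sentences in the language of rings. -/
theorem realizeRing_of_agreement {n : ℕ} {φ : (Language.ring[[S]]).Sentence}
    (hφ : IsExistsN n φ) {M N : Type u} [CommRing M] [CommRing N] (f : S →+* M) (g : S →+* N)
    (h : ∀ (Z : Finset (MvPolynomial (Fin n) S)) (x : Fin n → M), ∃ y : Fin n → N, ∀ p ∈ Z,
      (MvPolynomial.eval₂ f x p = 0 ↔ MvPolynomial.eval₂ g y p = 0))
    (hM : RealizeRing M f φ) : RealizeRing N g φ := by
  classical
  obtain ⟨Z, hZ⟩ := exists_finset_of_isExistsN (α := S) (L := Language.ring[[S]])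
    (fun M _ O f => ringConStructure f)
    (fun t => (exists_polynomial_of_ringTerm t).imp fun p hp M _ O f xs => hp M f xs)
    (fun {l} R => by rcases R with R | R <;> exact (IsEmpty.false R).elim) hφ
  obtain ⟨a, ha⟩ := hZ M Set.univ f default ((realizeRing_iff _ _).1 hM)
  let e : S ⊕ (Fin 0 ⊕ Fin n) → S ⊕ Fin n := Sum.map id (Sum.elim Fin.elim0 id)
  obtain ⟨b, hb⟩ := h (Z.image fun p => absorbConstants S n (MvPolynomial.rename e p)) a
  refine (realizeRing_iff _ _).2 (ha N Set.univ g default b fun p hp => ?_)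
  have := hb _ (Finset.mem_image_of_mem _ hp)
  have he : ∀ (M : Type u) (x : S → M) (xs : Fin 0 → M) (y : Fin n → M),
      Sum.elim x y ∘ e = Sum.elim x (Sum.elim xs y) := by
    intro M x xs y
    ext j
    rcases j with j | j | j
    · simp [e]
    · exact j.elim0
    · simp [e]
  simp only [eval₂_absorbConstants, MvPolynomial.aeval_rename] at this
  rw [he M f default a, he N g default b] at this
  exact ⟨this, by simp⟩

/-- Transfer of existential sentences in the language of valued fields. -/
theorem thValSub_of_agreement {n : ℕ} {M N : Type u} [CommRing M] [CommRing N] (O : Set M)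
    (O' : Set N) (f : S →+* M) (g : S →+* N)
    (h : ∀ (Z : Finset (MvPolynomial (Fin n) S)) (x : Fin n → M), ∃ y : Fin n → N, ∀ p ∈ Z,
      (MvPolynomial.eval₂ f x p = 0 ↔ MvPolynomial.eval₂ g y p = 0) ∧
      (MvPolynomial.eval₂ f x p ∈ O ↔ MvPolynomial.eval₂ g y p ∈ O')) :
    ThValSub (fun {k} φ => IsExistsN n φ) M O f N O' g := by
  classical
  intro φ hφ
  have key : ∀ {φ : (Lval[[S]]).Sentence}, IsExistsN n φ → RealizeVal M O f φ →
      RealizeVal N O' g φ := by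
    intro φ hφ hM
    obtain ⟨Z, hZ⟩ := exists_finset_of_isExistsN (α := S) (L := Lval[[S]])
      (fun M _ O f => valConStructure O f)
      (fun t => exists_polynomial_of_valTerm t)
      (fun {l} R => by
        rcases R with (R | R) | R
        · exact (IsEmpty.false R).elim
        · cases R with
          | isO => exact ⟨0, fun M _ O f xs => Iff.rfl⟩
        · exact (IsEmpty.false R).elim) hφ
    obtain ⟨a, ha⟩ := hZ M O f default ((realizeVal_iff _ _ _).1 hM)
    let e : S ⊕ (Fin 0 ⊕ Fin n) → S ⊕ Fin n := Sum.map id (Sum.elim Fin.elim0 id)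
    obtain ⟨b, hb⟩ := h (Z.image fun p => absorbConstants S n (MvPolynomial.rename e p)) a
    refine (realizeVal_iff _ _ _).2 (ha N O' g default b fun p hp => ?_)
    have := hb _ (Finset.mem_image_of_mem _ hp)
    have he : ∀ (M : Type u) (x : S → M) (xs : Fin 0 → M) (y : Fin n → M),
        Sum.elim x y ∘ e = Sum.elim x (Sum.elim xs y) := by
      intro M x xs y
      ext j
      rcases j with j | j | j
      · simp [e]
      · exact j.elim0
      · simp [e]
    simp only [eval₂_absorbConstants, MvPolynomial.aeval_rename] at this
    rwa [he M f default a, he N g default b] at this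
  let _ := valConStructure O f
  let _ := valConStructure O' g
  have hbc : ∀ {k : ℕ} {φ : (Lval[[S]]).BoundedFormula Empty k},
      IsPosBC (fun {k} φ => IsExistsN n φ) φ → k = 0 → ∀ xs ys,
        φ.Realize Empty.elim (xs : Fin k → M) → φ.Realize Empty.elim (ys : Fin k → N) := by
    intro k φ hφ
    induction hφ with
    | base h =>
      rintro rfl xs ys hM
      have hM' := key h ((realizeVal_iff _ _ _).2 (Subsingleton.elim xs default ▸ hM))
      exact Subsingleton.elim default ys ▸ (realizeVal_iff _ _ _).1 hM'
    | inf _ _ ih₁ ih₂ =>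
      intro h0 xs ys hM
      have hM' := BoundedFormula.realize_inf.1 hM
      exact BoundedFormula.realize_inf.2 ⟨ih₁ h0 xs ys hM'.1, ih₂ h0 xs ys hM'.2⟩
    | sup _ _ ih₁ ih₂ =>
      intro h0 xs ys hM
      exact BoundedFormula.realize_sup.2 ((BoundedFormula.realize_sup.1 hM).imp
        (ih₁ h0 xs ys) (ih₂ h0 xs ys))
  exact fun hM => (realizeVal_iff _ _ _).2 (hbc hφ rfl _ _ ((realizeVal_iff _ _ _).1 hM))

end Solv

end Paper

namespace Paper

open Filter LaurentSeries
open scoped RatFunc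

/-- Approximating a tuple by a ring homomorphism, polynomial conditions being preserved. -/
theorem exists_agreement_of_newtonHensel {S A Ω N Γ : Type*} [Field S] [CommRing A] [Field Ω]
    [Field N] [LinearOrderedCommGroupWithZero Γ] (ν : Valuation Ω Γ) (α : A →+* Ω) (β : A →+* N)
    (O : ValuationSubring N) (hO : NewtonHensel O)
    (H : ∀ a c, ν (α a) < ν (α c) → O.valuation (β a) < O.valuation (β c))
    (D : ∀ y γ : Ω, γ ≠ 0 → ∃ a, ν (y - α a) < ν γ)
    (σ : S →+* A) (hσ : SepHom (α.comp σ)) {J : Type*} [Finite J]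
    (Z : Finset (MvPolynomial J S)) (x : J → Ω) :
    ∃ y : J → N, ∀ p ∈ Z,
      (MvPolynomial.eval₂ (α.comp σ) x p = 0 → MvPolynomial.eval₂ (β.comp σ) y p = 0) ∧
      (MvPolynomial.eval₂ (α.comp σ) x p ≠ 0 → ∃ c, α c ≠ 0 ∧
        ν (MvPolynomial.eval₂ (α.comp σ) x p) = ν (α c) ∧ β c ≠ 0 ∧
        O.valuation (MvPolynomial.eval₂ (β.comp σ) y p) = O.valuation (β c)) := by
  classical
  have := Fintype.ofFinite J
  obtain ⟨B, ψ, hs, hψ, hv⟩ := exists_subring_hom_of_newtonHensel ν α β O hO H D σ hσ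
    (Finset.univ.image x ∪ Z.image fun p => MvPolynomial.eval₂ (α.comp σ) x p)
  have hx : ∀ j, x j ∈ B := fun j => hs _ (Finset.mem_union_left _
    (Finset.mem_image_of_mem _ (Finset.mem_univ j)))
  choose hB hB' using hψ
  let σ' : S →+* B := (α.comp σ).codRestrict B hB
  have hσ' : ψ.comp σ' = β.comp σ := RingHom.ext hB'
  have e1 : ∀ p, ((MvPolynomial.eval₂ σ' (fun j => (⟨x j, hx j⟩ : B)) p : B) : Ω) =
      MvPolynomial.eval₂ (α.comp σ) x p := fun p =>
    MvPolynomial.eval₂_comp_left B.subtype σ' (fun j => ⟨x j, hx j⟩) p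
  have e2 : ∀ p, ψ (MvPolynomial.eval₂ σ' (fun j => ⟨x j, hx j⟩) p) =
      MvPolynomial.eval₂ (β.comp σ) (fun j => ψ ⟨x j, hx j⟩) p := fun p => by
    rw [← hσ']
    exact MvPolynomial.eval₂_comp_left ψ σ' (fun j => ⟨x j, hx j⟩) p
  refine ⟨fun j => ψ ⟨x j, hx j⟩, fun p hp => ⟨fun h => ?_, fun h => ?_⟩⟩
  · rw [← e2, show MvPolynomial.eval₂ σ' (fun j => ⟨x j, hx j⟩) p = 0 from Subtype.ext
      ((e1 p).trans h), map_zero]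
  · obtain ⟨c, hc⟩ := D (MvPolynomial.eval₂ (α.comp σ) x p) _ h
    have h1 : ν (MvPolynomial.eval₂ (α.comp σ) x p) = ν (α c) := by
      rw [Valuation.map_sub_swap] at hc
      have := Valuation.map_add_eq_of_lt_left ν hc
      rw [← this]
      congr 1
      ring
    have hc0 : α c ≠ 0 := by rwa [← ν.ne_zero_iff, ← h1, ν.ne_zero_iff]
    have h2 := hv (MvPolynomial.eval₂ σ' (fun j => ⟨x j, hx j⟩) p)
      (by rw [e1]; exact Finset.mem_union_right _ (Finset.mem_image_of_mem _ hp)) c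
      (by rw [e1, ← h1]; exact hc)
    rw [e2] at h2
    refine ⟨c, hc0, h1, ?_, ?_⟩
    · intro h0
      rw [h0, map_zero] at h2
      exact not_lt_zero h2
    · have := Valuation.map_add_eq_of_lt_left _ h2
      rw [← this]
      congr 1
      ring

section Laurent

variable {F : Type*} [Field F]

theorem exists_ofPowerSeries_of_ne_zero {J : Type*} [Finite J] (y : J → F⸨X⸩) (hy : y ≠ 0) :
    ∃ (m : ℤ) (q : J → PowerSeries F), (∀ j, y j = HahnSeries.single m 1 *
      HahnSeries.ofPowerSeries ℤ F (q j)) ∧ ∃ j, PowerSeries.constantCoeff (q j) ≠ 0 := by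
  classical
  obtain ⟨j₁, hj₁⟩ := Function.ne_iff.1 hy
  let T := {j // y j ≠ 0}
  have : Nonempty T := ⟨⟨j₁, hj₁⟩⟩
  obtain ⟨⟨j₀, hj₀⟩, hmin⟩ := Finite.exists_min (fun j : T => (y j).order)
  have hle : ∀ j, y j ≠ 0 → (y j₀).order ≤ (y j).order := fun j hj => hmin ⟨j, hj⟩
  refine ⟨(y j₀).order, fun j => if y j = 0 then 0 else
    PowerSeries.X ^ ((y j).order - (y j₀).order).toNat * (y j).powerSeriesPart, fun j => ?_, j₀, ?_⟩
  · dsimp only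
    split_ifs with h
    · simp [h]
    · conv_lhs => rw [← LaurentSeries.single_order_mul_powerSeriesPart (y j)]
      rw [map_mul, HahnSeries.ofPowerSeries_X_pow, ← mul_assoc, HahnSeries.single_mul_single,
        mul_one]
      congr 2
      have := Int.toNat_of_nonneg (sub_nonneg.2 (hle j h))
      rw [this]
      ring_nf
  · have hj₀' : ¬ y j₀ = 0 := hj₀
    dsimp only
    rw [if_neg hj₀']
    simp only [sub_self, Int.toNat_zero, pow_zero, one_mul]
    rw [← PowerSeries.coeff_zero_eq_constantCoeff_apply, LaurentSeries.powerSeriesPart_coeff]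
    simpa using hj₀

theorem single_ne_zero' (m : ℤ) : (HahnSeries.single m 1 : F⸨X⸩) ≠ 0 := by simp

/-- Reduction of a purely inseparable relation to power series. -/
theorem exists_powerSeries_relation {S : Type*} [CommRing S] (f : S →+* PowerSeries F) {n p : ℕ}
    (e : Fin n → S) (y : Fin n → F⸨X⸩) (hy : y ≠ 0)
    (h : ∑ j, HahnSeries.ofPowerSeries ℤ F (f (e j)) * y j ^ p = 0) :
    ∃ q : Fin n → PowerSeries F, (∃ j, PowerSeries.constantCoeff (q j) ≠ 0) ∧
      ∑ j, f (e j) * q j ^ p = 0 := by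
  obtain ⟨m, q, hq, hj⟩ := exists_ofPowerSeries_of_ne_zero y hy
  refine ⟨q, hj, HahnSeries.ofPowerSeries_injective (Γ := ℤ) ?_⟩
  rw [map_zero, map_sum]
  have : (HahnSeries.single m 1 : F⸨X⸩) ^ p * ∑ j, HahnSeries.ofPowerSeries ℤ F (f (e j) * q j ^ p)
      = 0 := by
    rw [← h, Finset.mul_sum]
    refine Finset.sum_congr rfl fun j _ => ?_
    rw [hq, map_mul, map_pow]
    ring
  exact (mul_eq_zero.1 this).resolve_left (pow_ne_zero _ (single_ne_zero' m))

theorem sepHom_algebraMap_laurentSeries : SepHom (algebraMap F F⸨X⸩) := by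
  intro p hp hc n e y h hy
  obtain ⟨q, ⟨j, hj⟩, hq⟩ := exists_powerSeries_relation PowerSeries.C e y hy (by
    rw [← h]
    refine Finset.sum_congr rfl fun j _ => ?_
    rw [HahnSeries.ofPowerSeries_C, LaurentSeries.algebraMap_apply])
  refine ⟨fun j => PowerSeries.constantCoeff (q j), fun h => hj (congrFun h j), ?_⟩
  simpa using congrArg PowerSeries.constantCoeff hq

end Laurent

/-- The value of a polynomial at a topologically nilpotent element. -/
theorem valuation_eval₂_eq {F Ω Γ : Type*} [Field F] [Field Ω] [LinearOrderedCommGroupWithZero Γ]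
    (ν : Valuation Ω Γ) (φ : F →+* Ω) (hφ : ∀ c, c ≠ 0 → ν (φ c) = 1) (t : Ω) (ht : ν t < 1)
    (p : Polynomial F) (hp : p ≠ 0) :
    ν (p.eval₂ φ t) = ν t ^ p.rootMultiplicity 0 := by
  obtain ⟨q, hq, hq'⟩ := p.exists_eq_pow_rootMultiplicity_mul_and_not_dvd hp 0
  rw [map_zero, sub_zero, Polynomial.X_dvd_iff] at hq'
  have hle : ∀ r : Polynomial F, ν (r.eval₂ φ t) ≤ 1 := by
    intro r
    rw [Polynomial.eval₂_eq_sum_range]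
    refine ν.map_sum_le fun i _ => ?_
    rw [map_mul, map_pow]
    refine mul_le_one' ?_ (pow_le_one' ht.le _)
    rcases eq_or_ne (r.coeff i) 0 with h | h
    · simp [h]
    · exact (hφ _ h).le
  conv_lhs => rw [hq]
  rw [Polynomial.eval₂_mul, Polynomial.eval₂_pow, map_mul]
  have h1 : ν (q.eval₂ φ t) = 1 := by
    rw [← q.divX_mul_X_add, Polynomial.eval₂_add, Polynomial.eval₂_mul, Polynomial.eval₂_X,
      Polynomial.eval₂_C, add_comm, Valuation.map_add_eq_of_lt_left, hφ _ hq']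
    rw [hφ _ hq', map_mul]
    exact mul_lt_one_of_nonneg_of_lt_one_right (hle _) zero_le ht
  rw [h1]
  simp

/-- The coarsening of a valuation ring in which a given subfield becomes trivially valued. -/
def coarsenTrivial {F N : Type*} [Field F] [Field N] (φ : F →+* N) (O : ValuationSubring N) :
    ValuationSubring N where
  carrier := {z | ∃ c : F, c ≠ 0 ∧ φ c * z ∈ O}
  mul_mem' := by
    rintro a b ⟨c, hc, ha⟩ ⟨d, hd, hb⟩
    refine ⟨c * d, mul_ne_zero hc hd, ?_⟩
    rw [map_mul, mul_mul_mul_comm]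
    exact mul_mem ha hb
  one_mem' := ⟨1, one_ne_zero, by simp⟩
  zero_mem' := ⟨1, one_ne_zero, by simp⟩
  neg_mem' := by
    rintro a ⟨c, hc, ha⟩
    exact ⟨c, hc, by rw [mul_neg]; exact neg_mem ha⟩
  add_mem' := by
    rintro a b ⟨c, hc, ha⟩ ⟨d, hd, hb⟩
    rcases O.mem_or_inv_mem (φ (c / d)) with h | h
    · refine ⟨c, hc, ?_⟩
      rw [mul_add]
      refine add_mem ha ?_
      have := mul_mem h hb
      rwa [← mul_assoc, ← map_mul, div_mul_cancel₀ _ hd] at this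
    · refine ⟨d, hd, ?_⟩
      rw [mul_add]
      refine add_mem ?_ hb
      have := mul_mem h ha
      rwa [← map_inv₀, inv_div, ← mul_assoc, ← map_mul, div_mul_cancel₀ _ hc] at this
  mem_or_inv_mem' := by
    intro a
    rcases O.mem_or_inv_mem a with h | h
    · exact Or.inl ⟨1, one_ne_zero, by simpa using h⟩
    · exact Or.inr ⟨1, one_ne_zero, by simpa using h⟩

theorem le_coarsenTrivial {F N : Type*} [Field F] [Field N] (φ : F →+* N)
    (O : ValuationSubring N) : O ≤ coarsenTrivial φ O :=
  fun a ha => ⟨1, one_ne_zero, by simpa using ha⟩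

theorem coarsenTrivial_valuation {F N : Type*} [Field F] [Field N] (φ : F →+* N)
    (O : ValuationSubring N) (c : F) (hc : c ≠ 0) : (coarsenTrivial φ O).valuation (φ c) = 1 := by
  have h : ∀ c : F, c ≠ 0 → φ c ∈ coarsenTrivial φ O := fun c hc =>
    ⟨c⁻¹, inv_ne_zero hc, by rw [← map_mul, inv_mul_cancel₀ hc, map_one]; exact one_mem O⟩
  refine le_antisymm ((ValuationSubring.valuation_le_one_iff _ _).2 (h c hc)) ?_
  have := (ValuationSubring.valuation_le_one_iff _ _).2 (h _ (inv_ne_zero hc))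
  rw [map_inv₀, map_inv₀] at this
  have h0 : 0 < (coarsenTrivial φ O).valuation (φ c) := by
    rw [zero_lt_iff, Valuation.ne_zero_iff]
    simpa using hc
  exact (inv_le_one₀ h0).1 this

theorem coarsenTrivial_valuation_lt_one {F N : Type*} [Field F] [Field N] (φ : F →+* N)
    (O : ValuationSubring N) (t : N) (ht : ∀ c, O.valuation (φ c * t) < 1) :
    (coarsenTrivial φ O).valuation t < 1 := by
  rcases eq_or_ne t 0 with rfl | h0
  · simp
  by_contra! h
  have h1 : (coarsenTrivial φ O).valuation t⁻¹ ≤ 1 := by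
    rw [map_inv₀]
    exact inv_le_one_of_one_le₀ h
  obtain ⟨c, hc, hct⟩ := (ValuationSubring.valuation_le_one_iff _ _).1 h1
  have h2 := (ValuationSubring.valuation_le_one_iff _ _).2 hct
  have h3 := ht c⁻¹
  rw [← one_mul (1 : O.ValueGroup)] at h3
  have : O.valuation (φ c * t⁻¹) * O.valuation (φ c⁻¹ * t) < 1 :=
    mul_lt_one_of_nonneg_of_lt_one_right h2 zero_le (ht c⁻¹)
  rw [← map_mul, mul_mul_mul_comm, ← map_mul, mul_inv_cancel₀ hc, inv_mul_cancel₀ h0, map_one,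
    mul_one, map_one] at this
  exact lt_irrefl _ this

/-- A field with a nontrivial henselian valuation is large. -/
theorem largeField_of_newtonHensel {F : Type u} [Field F] (O : ValuationSubring F)
    (hO : NewtonHensel O) (hm : ∃ m : F, m ≠ 0 ∧ O.valuation m < 1) : LargeField F := by
  classical
  rintro φ ⟨n, hφ⟩ hr
  have hid : (id : F → F) = RingHom.id F := rfl
  rw [hid]
  refine realizeRing_of_agreement hφ (algebraMap F F⸨X⸩) (RingHom.id F) (fun Z x => ?_) hr
  obtain ⟨m, hm0, hm⟩ := hm
  have hsmall : ∀ s : Finset F, ∃ e : F, e ≠ 0 ∧ ∀ c ∈ s, O.valuation (c * e) < 1 := by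
    intro s
    induction s using Finset.induction_on with
    | empty => exact ⟨1, one_ne_zero, by simp⟩
    | insert a s ha ih =>
      obtain ⟨e, he, h⟩ := ih
      rcases lt_or_ge (O.valuation (a * e)) 1 with h1 | h1
      · exact ⟨e, he, fun c hc => (Finset.mem_insert.1 hc).elim (fun hc => hc ▸ h1) (h c)⟩
      · have hae : a * e ≠ 0 := by
          intro h0
          rw [h0, map_zero] at h1
          exact not_lt_of_ge h1 zero_lt_one
        have ha0 : a ≠ 0 := left_ne_zero_of_mul hae
        refine ⟨m / a, div_ne_zero hm0 ha0, fun c hc => ?_⟩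
        rcases Finset.mem_insert.1 hc with rfl | hc
        · rwa [mul_div_cancel₀ _ ha0]
        · have : c * (m / a) = (c * e) * (m * (a * e)⁻¹) := by field_simp
          rw [this, map_mul, map_mul O.valuation m, map_inv₀]
          refine mul_lt_one_of_nonneg_of_lt_one_right (h c hc).le zero_le ?_
          refine mul_lt_one_of_nonneg_of_lt_one_left zero_le hm (inv_le_one_of_one_le₀ h1)
  choose e he0 he using hsmall
  let U : Ultrafilter (Finset F) := Ultrafilter.of atTop
  have hU : (U : Filter (Finset F)) ≤ atTop := Ultrafilter.of_le atTop
  let ε : Germ (U : Filter (Finset F)) F := (e : Germ (U : Filter (Finset F)) F)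
  have hε0 : ε ≠ 0 := by
    intro h
    obtain ⟨s, hs⟩ := ((coe_eq_zero_iff (U := U)).1 h).exists
    exact he0 s hs
  have hε : ∀ c : F, (germSubring U O).valuation (germDiag U F c * ε) < 1 := by
    intro c
    refine (germ_valuation_lt_one_iff (U := U) O (a := fun s => c * e s)).2 (hU ?_)
    filter_upwards [Ici_mem_atTop ({c} : Finset F)] with s hs
    exact he s c (hs (Finset.mem_singleton_self c))
  let O₁ := coarsenTrivial (germDiag U F) (germSubring U O)
  have hO₁ : NewtonHensel O₁ := hO.germ.of_le (le_coarsenTrivial _ _)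
  have htriv : ∀ c : F, c ≠ 0 → O₁.valuation (germDiag U F c) = 1 :=
    coarsenTrivial_valuation _ _
  have hε1 : O₁.valuation ε < 1 := coarsenTrivial_valuation_lt_one _ _ _ hε
  have hε2 : 0 < O₁.valuation ε := by rwa [zero_lt_iff, Valuation.ne_zero_iff]
  let g : Polynomial F →+* Germ (U : Filter (Finset F)) F :=
    Polynomial.eval₂RingHom (germDiag U F) ε
  have hgv : ∀ p, p ≠ 0 → O₁.valuation (g p) = O₁.valuation ε ^ p.rootMultiplicity 0 :=
    fun p hp => valuation_eval₂_eq _ _ htriv ε hε1 p hp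
  have hg : Function.Injective g := by
    refine (injective_iff_map_eq_zero g).2 fun p hp => ?_
    by_contra h
    have := hgv p h
    rw [hp, map_zero] at this
    exact (pow_pos hε2 _).ne this
  let β : RatFunc F →+* Germ (U : Filter (Finset F)) F := IsFractionRing.lift hg
  have hβ : ∀ p, β (algebraMap _ _ p) = g p := IsFractionRing.lift_algebraMap hg
  let α : RatFunc F →+* F⸨X⸩ := algebraMap _ _
  let ν : Valuation F⸨X⸩ (WithZero (Multiplicative ℤ)) := Valued.v
  let t : F⸨X⸩ := HahnSeries.single 1 1
  have hα : ∀ p : Polynomial F, α (algebraMap _ _ p) = p.eval₂ (algebraMap F F⸨X⸩) t := by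
    intro p
    have : α.comp (algebraMap (Polynomial F) (RatFunc F)) =
        Polynomial.eval₂RingHom (algebraMap F F⸨X⸩) t := by
      refine Polynomial.ringHom_ext (fun a => ?_) ?_
      · simp only [α, RingHom.comp_apply, ← IsScalarTower.algebraMap_apply,
          Polynomial.coe_eval₂RingHom, Polynomial.eval₂_C]
        rw [LaurentSeries.algebraMap_apply, HahnSeries.algebraMap_apply',
          show algebraMap (Polynomial F) (PowerSeries F) (Polynomial.C a) = PowerSeries.C a from by
            simp [PowerSeries.algebraMap_apply'], HahnSeries.ofPowerSeries_C]
      · simp [α, t]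
    exact congrArg (fun Ψ : _ →+* F⸨X⸩ => Ψ p) this
  have hνC : ∀ c : F, c ≠ 0 → ν (algebraMap F F⸨X⸩ c) = 1 := by
    have hle : ∀ c : F, ν (algebraMap F F⸨X⸩ c) ≤ 1 := fun c =>
      (LaurentSeries.val_le_one_iff_eq_coe F _).2 ⟨PowerSeries.C c, by
        rw [HahnSeries.ofPowerSeries_C, LaurentSeries.algebraMap_apply]⟩
    intro c hc
    refine le_antisymm (hle c) ?_
    have := hle c⁻¹
    rw [map_inv₀, map_inv₀] at this
    exact (inv_le_one₀ (by rw [zero_lt_iff, Valuation.ne_zero_iff]; simpa using hc)).1 this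
  have hνt : ν t = WithZero.exp (-1 : ℤ) := by
    simpa using LaurentSeries.valuation_single_zpow F 1
  have hνt1 : ν t < 1 := by
    rw [hνt]
    decide
  have hνt0 : 0 < ν t := by
    rw [hνt]
    exact WithZero.exp_pos
  have hva : ∀ a : RatFunc F, a ≠ 0 → ∃ m : ℤ, ν (α a) = ν t ^ m ∧
      O₁.valuation (β a) = O₁.valuation ε ^ m := by
    intro a
    induction a using RatFunc.induction_on with
    | f p q hq =>
      intro hpq
      have hp : p ≠ 0 := by
        rintro rfl
        simp at hpq
      refine ⟨(p.rootMultiplicity 0 : ℤ) - q.rootMultiplicity 0, ?_, ?_⟩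
      · rw [map_div₀, map_div₀, hα, hα, valuation_eval₂_eq ν _ hνC t hνt1 p hp,
          valuation_eval₂_eq ν _ hνC t hνt1 q hq, zpow_sub₀ hνt0.ne', zpow_natCast, zpow_natCast]
      · rw [map_div₀, map_div₀, hβ, hβ, hgv p hp, hgv q hq, zpow_sub₀ hε2.ne', zpow_natCast,
          zpow_natCast]
  obtain ⟨y, hy⟩ := exists_agreement_of_newtonHensel ν α β O₁ hO₁ (fun a c h => by
      have hc : c ≠ 0 := by
        rintro rfl
        simp at h
      obtain ⟨m, hm1, hm2⟩ := hva c hc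
      rcases eq_or_ne a 0 with rfl | ha
      · rw [map_zero, map_zero, hm2]
        exact zpow_pos hε2 _
      · obtain ⟨m', hm1', hm2'⟩ := hva a ha
        rw [hm2, hm2']
        rw [hm1, hm1', zpow_lt_zpow_iff_right_of_lt_one₀ hνt0 hνt1] at h
        rwa [zpow_lt_zpow_iff_right_of_lt_one₀ hε2 hε1])
    (fun y γ hγ => LaurentSeries.exists_ratFunc_val_lt y
      (Units.mk0 (ν γ) ((Valuation.ne_zero_iff _).2 hγ)))
    ((algebraMap (Polynomial F) (RatFunc F)).comp Polynomial.C) (by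
      have : α.comp ((algebraMap (Polynomial F) (RatFunc F)).comp Polynomial.C) =
          algebraMap F F⸨X⸩ := RingHom.ext fun c => by
        rw [RingHom.comp_apply, RingHom.comp_apply, hα, Polynomial.eval₂_C]
      rw [this]
      exact sepHom_algebraMap_laurentSeries) Z x
  have e1 : α.comp ((algebraMap (Polynomial F) (RatFunc F)).comp Polynomial.C) =
      algebraMap F F⸨X⸩ := RingHom.ext fun c => by
    rw [RingHom.comp_apply, RingHom.comp_apply, hα, Polynomial.eval₂_C]
  have e2 : β.comp ((algebraMap (Polynomial F) (RatFunc F)).comp Polynomial.C) =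
      (germDiag U F).comp (RingHom.id F) := RingHom.ext fun c => by
    rw [RingHom.comp_apply, RingHom.comp_apply, hβ]
    simp [g]
  rw [e1, e2] at hy
  obtain ⟨b, hb⟩ := exists_germ_rep y
  obtain rfl : y = fun j => (b j : Germ (U : Filter (Finset F)) F) := funext hb
  simp only [eval₂_germDiag, coe_eq_zero_iff] at hy
  have hev : ∀ᶠ s in (U : Filter (Finset F)), ∀ p ∈ Z,
      (MvPolynomial.eval₂ (algebraMap F F⸨X⸩) x p = 0 ↔
        MvPolynomial.eval₂ (RingHom.id F) (fun j => b j s) p = 0) := by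
    rw [Filter.eventually_all_finset]
    intro p hp
    by_cases h : MvPolynomial.eval₂ (algebraMap F F⸨X⸩) x p = 0
    · filter_upwards [(hy p hp).1 h] with s hs
      exact iff_of_true h hs
    · obtain ⟨c, -, -, hc0, hc⟩ := (hy p hp).2 h
      have : ∀ᶠ s in (U : Filter (Finset F)),
          ¬ MvPolynomial.eval₂ (RingHom.id F) (fun j => b j s) p = 0 := by
        rw [Ultrafilter.eventually_not, ← coe_eq_zero_iff]
        exact (Valuation.ne_zero_iff O₁.valuation).1 (hc ▸ (Valuation.ne_zero_iff _).2 hc0)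
      filter_upwards [this] with s hs
      exact iff_of_false h hs
  obtain ⟨s, hs⟩ := hev.exists
  exact ⟨fun j => b j s, hs⟩

end Paper

namespace Paper

open LaurentSeries

section LaurentMap

variable {k κ : Type*} [Field k] [Field κ]

/-- The ring homomorphism of Laurent series fields induced by a homomorphism of fields. -/
noncomputable def laurentMap (g : k →+* κ) : k⸨X⸩ →+* κ⸨X⸩ where
  toFun x := HahnSeries.map x g
  map_one' := HahnSeries.map_one g.toMonoidWithZeroHom
  map_zero' := HahnSeries.map_zero g.toAddMonoidHom.toZeroHom
  map_mul' x y := HahnSeries.map_mul (g : k →ₙ+* κ)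
  map_add' x y := HahnSeries.map_add g.toAddMonoidHom

theorem laurentMap_coeff (g : k →+* κ) (x : k⸨X⸩) (i : ℤ) :
    (laurentMap g x).coeff i = g (x.coeff i) := rfl

theorem laurentMap_ofPowerSeries (g : k →+* κ) (x : PowerSeries k) :
    laurentMap g (HahnSeries.ofPowerSeries ℤ k x) =
      HahnSeries.ofPowerSeries ℤ κ (PowerSeries.map g x) := by
  ext i
  rw [laurentMap_coeff, PowerSeries.coeff_coe, PowerSeries.coeff_coe]
  split_ifs <;> simp

theorem laurentMap_single (g : k →+* κ) (i : ℤ) (a : k) :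
    laurentMap g (HahnSeries.single i a) = HahnSeries.single i (g a) := by
  ext j
  rw [laurentMap_coeff, HahnSeries.coeff_single, HahnSeries.coeff_single]
  split_ifs <;> simp

theorem valuation_laurentMap_le_iff (g : k →+* κ) (x y : k⸨X⸩) :
    (Valued.v (laurentMap g x) : WithZero (Multiplicative ℤ)) ≤ Valued.v (laurentMap g y) ↔
      (Valued.v x : WithZero (Multiplicative ℤ)) ≤ Valued.v y := by
  have key : ∀ z : k⸨X⸩, ((Valued.v (laurentMap g z) : WithZero (Multiplicative ℤ)) ≤ 1 ↔
      (Valued.v z : WithZero (Multiplicative ℤ)) ≤ 1) := by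
    intro z
    rw [← WithZero.exp_zero, ← neg_zero, LaurentSeries.valuation_le_iff_coeff_lt_eq_zero,
      LaurentSeries.valuation_le_iff_coeff_lt_eq_zero]
    simp [laurentMap_coeff]
  rcases eq_or_ne y 0 with rfl | hy
  · simp
  · have h1 : (Valued.v y : WithZero (Multiplicative ℤ)) ≠ 0 := by simpa using hy
    have h2 : (Valued.v (laurentMap g y) : WithZero (Multiplicative ℤ)) ≠ 0 := by simpa using hy
    have := key (x / y)
    rwa [map_div₀, map_div₀, map_div₀, div_le_one₀ (zero_lt_iff.2 h1),
      div_le_one₀ (zero_lt_iff.2 h2)] at this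

/-- For a separable extension, coordinates with respect to a basis are compatible with
`p`-th powers. -/
theorem SepHom.exists_linear [Algebra k κ] (hf : SepHom (algebraMap k κ)) {p : ℕ} (hp : p.Prime)
    [CharP k p] {a : κ} (ha : a ≠ 0) :
    ∃ (l : κ → k) (l' : κ →ₗ[k] k), l a ≠ 0 ∧ ∀ b, l' (b ^ p) = l b ^ p := by
  classical
  have : Fact p.Prime := ⟨hp⟩
  have : CharP κ p := (RingHom.charP_iff _ (algebraMap k κ).injective p).1 inferInstance
  have hli : LinearIndepOn k id ({a} : Set κ) := by
    exact LinearIndepOn.singleton ha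
  let B := Module.Basis.extend hli
  have haB : a ∈ hli.extend (Set.subset_univ _) := hli.subset_extend _ rfl
  let i₀ : hli.extend (Set.subset_univ _) := ⟨a, haB⟩
  have hB : ∀ i, B i = (i : κ) := fun i => Module.Basis.extend_apply_self hli i
  have hli' : LinearIndependent k fun i => B i ^ p := by
    have h0 : LinearIndepOn k (· ^ p) (hli.extend (Set.subset_univ _)) := by
      refine linearIndepOn_of_finite _ fun t ht htf => ?_
      obtain ⟨t, rfl⟩ := htf.exists_finset_coe
      exact hf.linearIndepOn_pow hp t ((hli.linearIndepOn_extend _).mono ht)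
    simp only [hB]
    exact h0
  obtain ⟨G, hG⟩ := LinearMap.exists_leftInverse_of_injective
    (Finsupp.linearCombination k fun i => B i ^ p) (LinearMap.ker_eq_bot.2 hli')
  refine ⟨fun b => B.repr b i₀, (Finsupp.lapply i₀).comp G, ?_, fun b => ?_⟩
  · have : B.repr a = Finsupp.single i₀ 1 := by
      rw [← B.repr_self i₀, hB]
    simp [this]
  · have h1 : b ^ p = Finsupp.linearCombination k (fun i => B i ^ p)
        ((B.repr b).mapRange (· ^ p) (zero_pow hp.ne_zero)) := by
      conv_lhs => rw [← B.linearCombination_repr b]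
      rw [Finsupp.linearCombination_apply, Finsupp.linearCombination_apply, Finsupp.sum,
        sum_pow_char, Finsupp.sum_mapRange_index (by simp), Finsupp.sum]
      exact Finset.sum_congr rfl fun i _ => smul_pow _ _ _
    rw [h1, LinearMap.comp_apply, ← LinearMap.comp_apply G, hG]
    simp

theorem coeff_powerSeries_pow_char {p : ℕ} (hp : p.Prime) [CharP k p] (f : PowerSeries k)
    (i : ℕ) : PowerSeries.coeff i (f ^ p) =
      if p ∣ i then PowerSeries.coeff (i / p) f ^ p else 0 := by
  have : Fact p.Prime := ⟨hp⟩
  have : ExpChar k p := ExpChar.prime hp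
  have h := MvPowerSeries.map_frobenius_expand (σ := Unit) (R := k) p (f := f) hp.ne_zero
  rw [← h]
  change PowerSeries.coeff i (PowerSeries.map (frobenius k p) (PowerSeries.expand p hp.ne_zero f))
    = _
  rw [PowerSeries.coeff_map, PowerSeries.coeff_expand]
  split_ifs <;> simp [frobenius_def, hp.ne_zero]

theorem SepHom.laurentMap {g : k →+* κ} (hg : SepHom g) : SepHom (laurentMap g) := by
  classical
  intro p hp hc n e y h hy
  have hck : CharP k p := (RingHom.charP_iff _ (algebraMap k k⸨X⸩).injective p).2 hc
  have : CharP κ p := (RingHom.charP_iff g g.injective p).1 hck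
  have hn : Nonempty (Fin n) := by
    by_contra hn
    rw [not_nonempty_iff] at hn
    exact hy (Subsingleton.elim _ _)
  obtain ⟨j₀⟩ := hn
  rcases eq_or_ne e 0 with rfl | he
  · exact ⟨fun _ => 1, fun h => one_ne_zero (congrFun h j₀), by simp⟩
  obtain ⟨m, E, hE, -⟩ := exists_ofPowerSeries_of_ne_zero e he
  obtain ⟨q, ⟨j, hj⟩, hq⟩ := exists_powerSeries_relation (PowerSeries.map g) E y hy (by
    have : (HahnSeries.single m 1 : κ⸨X⸩) *
        ∑ j, HahnSeries.ofPowerSeries ℤ κ (PowerSeries.map g (E j)) * y j ^ p = 0 := by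
      rw [← h, Finset.mul_sum]
      refine Finset.sum_congr rfl fun j _ => ?_
      rw [hE, map_mul, laurentMap_single, laurentMap_ofPowerSeries, map_one g]
      ring
    exact (mul_eq_zero.1 this).resolve_left (single_ne_zero' m))
  let _ : Algebra k κ := g.toAlgebra
  obtain ⟨l, l', hl, hl'⟩ := SepHom.exists_linear (k := k) (κ := κ) hg hp hj
  let z : Fin n → PowerSeries k := fun j => PowerSeries.mk fun i => l (PowerSeries.coeff i (q j))
  have hz : ∑ j, E j * z j ^ p = 0 := by
    ext i
    have h1 := congrArg l' (congrArg (PowerSeries.coeff i) hq)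
    rw [map_zero, map_zero, map_sum, map_sum] at h1
    rw [map_zero, ← h1, map_sum]
    refine Finset.sum_congr rfl fun j _ => ?_
    rw [PowerSeries.coeff_mul, PowerSeries.coeff_mul, map_sum]
    refine Finset.sum_congr rfl fun ab _ => ?_
    rw [PowerSeries.coeff_map, show g (PowerSeries.coeff ab.1 (E j)) =
      algebraMap k κ (PowerSeries.coeff ab.1 (E j)) from rfl, ← Algebra.smul_def, map_smul,
      smul_eq_mul, coeff_powerSeries_pow_char hp, coeff_powerSeries_pow_char hp]
    split_ifs
    · rw [hl', PowerSeries.coeff_mk]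
    · rw [map_zero]
  refine ⟨fun j => HahnSeries.ofPowerSeries ℤ k (z j), fun h => hl ?_, ?_⟩
  · have := congrFun h j
    rw [Pi.zero_apply, map_eq_zero_iff _ HahnSeries.ofPowerSeries_injective] at this
    have := congrArg PowerSeries.constantCoeff this
    rw [← PowerSeries.coeff_zero_eq_constantCoeff_apply, PowerSeries.coeff_mk] at this
    simpa using this
  · have := congrArg (fun s => HahnSeries.single m 1 * HahnSeries.ofPowerSeries ℤ k s) hz
    simp only [map_zero, mul_zero, map_sum, Finset.mul_sum] at this
    rw [← this]
    refine Finset.sum_congr rfl fun j _ => ?_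
    rw [hE, map_mul, map_pow, mul_assoc]

end LaurentMap

end Paper

namespace Paper

section FormallySmooth

open Algebra

variable (k κ : Type*) [Field k] [Field κ] [Algebra k κ]

theorem cotangentComplex_mk_eq_zero_iff (f : (Generators.self k κ).toExtension.ker) :
    (Generators.self k κ).toExtension.cotangentComplex (Extension.Cotangent.mk f) = 0 ↔
      ∀ a, MvPolynomial.aeval (R := k) (id : κ → κ)
        (MvPolynomial.pderiv a (show MvPolynomial κ k from f.1)) = 0 := by
  rw [Extension.cotangentComplex_mk,
    ← (Generators.self k κ).cotangentSpaceBasis.repr.map_eq_zero_iff,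
    DFunLike.ext_iff]
  refine forall_congr' fun a => ?_
  rw [Generators.cotangentSpaceBasis_repr_one_tmul]
  rfl

/-- The first cotangent homology vanishes if and only if every relation all of whose partial
derivatives vanish is a combination of products of two relations. -/
theorem subsingleton_h1Cotangent_iff :
    Subsingleton (H1Cotangent k κ) ↔
      ∀ f : MvPolynomial κ k, MvPolynomial.aeval (R := k) (id : κ → κ) f = 0 →
        (∀ a, MvPolynomial.aeval (R := k) (id : κ → κ) (MvPolynomial.pderiv a f) = 0) →
        f ∈ RingHom.ker (MvPolynomial.aeval (R := k) (id : κ → κ)).toRingHom ^ 2 := by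
  constructor
  · intro h f hf hf'
    let f₀ : (Generators.self k κ).toExtension.ker := ⟨f, hf⟩
    have h0 := (cotangentComplex_mk_eq_zero_iff k κ f₀).2 hf'
    have h1 : (Extension.Cotangent.mk f₀) = 0 :=
      congrArg Subtype.val (h.elim ⟨Extension.Cotangent.mk f₀, h0⟩ 0)
    exact (Extension.Cotangent.mk_eq_zero_iff f₀).1 h1
  · intro h
    refine ⟨fun x y => ?_⟩
    have key : ∀ x : H1Cotangent k κ, x = 0 := by
      rintro ⟨x, hx⟩
      obtain ⟨f, rfl⟩ := Extension.Cotangent.mk_surjective x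
      refine Subtype.ext ?_
      exact (Extension.Cotangent.mk_eq_zero_iff f).2
        (h f.1 f.2 ((cotangentComplex_mk_eq_zero_iff k κ f).1 hx))
    rw [key x, key y]

variable {k κ}

theorem formallySmooth_adjoin (hf : SepHom (algebraMap k κ)) (s : Finset κ) :
    FormallySmooth k (IntermediateField.adjoin k (s : Set κ)) := by
  have hE : SepHom (algebraMap k (IntermediateField.adjoin k (s : Set κ))) :=
    SepHom.of_comp (g := algebraMap _ κ) hf
  have : Algebra.EssFiniteType k (IntermediateField.adjoin k (s : Set κ)) :=
    IntermediateField.essFiniteType_iff.2 ⟨s, rfl⟩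
  obtain ⟨t, ht, hsep⟩ := exists_finset_isTranscendenceBasis hE
  have : Algebra.IsSeparable (IntermediateField.adjoin k (Set.range (Subtype.val :
      t → IntermediateField.adjoin k (s : Set κ))))
      (IntermediateField.adjoin k (s : Set κ)) := by
    convert! hsep <;> simp
  exact .of_algebraicIndependent_of_isSeparable ht.1

/-- Separable field extensions are formally smooth. -/
theorem SepHom.formallySmooth (hf : SepHom (algebraMap k κ)) : FormallySmooth k κ := by
  classical
  refine ⟨inferInstance, (subsingleton_h1Cotangent_iff k κ).2 fun f hf0 hf1 => ?_⟩
  let F := IntermediateField.adjoin k (f.vars : Set κ)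
  have hF : FormallySmooth k F := formallySmooth_adjoin hf f.vars
  obtain ⟨g, hg⟩ := MvPolynomial.exists_rename_eq_of_vars_subset_range f (Subtype.val : F → κ)
    Subtype.val_injective (by
      intro a ha
      exact ⟨⟨a, IntermediateField.subset_adjoin _ _ ha⟩, rfl⟩)
  have hev : ∀ q : MvPolynomial F k, MvPolynomial.aeval (R := k) (id : κ → κ)
      (MvPolynomial.rename Subtype.val q) =
        (MvPolynomial.aeval (R := k) (id : F → F) q : κ) := by
    intro q
    rw [MvPolynomial.aeval_rename]
    exact (MvPolynomial.comp_aeval_apply (φ := F.val) (f := (id : F → F)) q).symm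
  have hmem := (subsingleton_h1Cotangent_iff k F).1 inferInstance g
    (by
      apply Subtype.val_injective
      rw [← hev, hg, hf0]
      rfl)
    (fun a => by
      apply Subtype.val_injective
      rw [← hev, ← MvPolynomial.pderiv_rename Subtype.val_injective, hg, hf1]
      rfl)
  have := Ideal.mem_map_of_mem (MvPolynomial.rename (R := k) (Subtype.val : F → κ)).toRingHom hmem
  rw [Ideal.map_pow] at this
  have hfg : f = (MvPolynomial.rename (R := k) (Subtype.val : F → κ)).toRingHom g := hg.symm
  rw [hfg]
  refine Ideal.pow_right_mono ?_ 2 this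
  rw [Ideal.map_le_iff_le_comap]
  intro q hq
  rw [Ideal.mem_comap, RingHom.mem_ker]
  have hq' : MvPolynomial.aeval (R := k) (id : F → F) q = 0 := hq
  refine (hev q).trans ?_
  rw [hq']
  rfl

/-- Lifting along nilpotent thickenings, for separable field extensions. -/
theorem SepHom.exists_lift {k κ : Type*} {A B : Type*} [Field k] [Field κ] [CommRing A]
    [CommRing B] {f : k →+* κ} (hf : SepHom f) (ρ : k →+* A) (q : A →+* B)
    (hq : Function.Surjective q) (hnil : IsNilpotent (RingHom.ker q)) (σ : κ →+* B)
    (h : σ.comp f = q.comp ρ) : ∃ τ : κ →+* A, q.comp τ = σ ∧ τ.comp f = ρ := by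
  let _ := f.toAlgebra
  let _ := ρ.toAlgebra
  let _ := (q.comp ρ).toAlgebra
  have : FormallySmooth k κ := SepHom.formallySmooth (k := k) (κ := κ) hf
  let σ' : κ →ₐ[k] B := { σ with commutes' := fun c => RingHom.congr_fun h c }
  let q' : A →ₐ[k] B := { q with commutes' := fun c => rfl }
  let τ := FormallySmooth.liftOfSurjective σ' q' hq hnil
  refine ⟨τ, ?_, ?_⟩
  · have := FormallySmooth.comp_liftOfSurjective σ' q' hq hnil
    exact congrArg AlgHom.toRingHom this
  · ext c
    exact τ.commutes c

end FormallySmooth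

/-- Fields are separable over prime fields. -/
theorem sepHom_zmod {p : ℕ} [Fact p.Prime] {E : Type*} [Field E] (f : ZMod p →+* E) : SepHom f := by
  classical
  let _ := f.toAlgebra
  refine SepHom.of_isSepExtHom (f := f) ?_
  intro s
  have : Algebra.EssFiniteType (ZMod p) (IntermediateField.adjoin (ZMod p) (s : Set E)) :=
    IntermediateField.essFiniteType_iff.2 ⟨s, rfl⟩
  obtain ⟨t, ht, h⟩ := exists_isTranscendenceBasis_and_isSeparable_of_perfectField (ZMod p)
    (IntermediateField.adjoin (ZMod p) (s : Set E))
  exact ⟨t, ht.1, h⟩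

theorem sepHom_of_charZero {S E : Type*} [Field S] [CharZero S] [Field E] (f : S →+* E) :
    SepHom f := by
  intro p hp hc
  exact absurd (CharP.eq S hc (CharP.ofCharZero S)) hp.ne_zero

end Paper

namespace Paper

section Expansion

open Polynomial

variable {O κ : Type*} [CommRing O] [Field κ]

/-- The quotient of a ring by a power of an element. -/
abbrev PowQuot (π : O) (N : ℕ) : Type _ := O ⧸ Ideal.span {π ^ (N + 1)}

/-- The projection to the quotient by a power of an element. -/
abbrev powMk (π : O) (N : ℕ) : O →+* PowQuot π N := Ideal.Quotient.mk _

theorem powMk_eq_zero_iff {π : O} {N : ℕ} {a : O} : powMk π N a = 0 ↔ π ^ (N + 1) ∣ a := by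
  rw [Ideal.Quotient.eq_zero_iff_mem, Ideal.mem_span_singleton]

theorem powMk_eq_iff {π : O} {N : ℕ} {a b : O} : powMk π N a = powMk π N b ↔
    π ^ (N + 1) ∣ a - b := by
  rw [← sub_eq_zero, ← map_sub, powMk_eq_zero_iff]

/-- The transition maps between the quotients by powers of an element. -/
noncomputable def powFactor (π : O) {M N : ℕ} (h : M ≤ N) : PowQuot π N →+* PowQuot π M :=
  Ideal.Quotient.factor (Ideal.span_singleton_le_span_singleton.2 (pow_dvd_pow π (by omega)))

@[simp]
theorem powFactor_powMk (π : O) {M N : ℕ} (h : M ≤ N) (a : O) :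
    powFactor π h (powMk π N a) = powMk π M a := rfl

/-- A compatible system of lifts of the residue field to the quotients by powers of `π`. -/
structure CoeffSystem (π : O) (res : O →+* κ) where
  σ : ∀ N, κ →+* PowQuot π N
  compat : ∀ {M N} (h : M ≤ N) c, powFactor π h (σ N c) = σ M c
  norm : ∀ a, powMk π 0 a = σ 0 (res a)

/-- Existence of systems of coefficient fields. -/
theorem exists_coeffSystem {k : Type*} [Field k] {π : O} {res : O →+* κ}
    (hres : Function.Surjective res) (hker : ∀ a, res a = 0 ↔ π ∣ a) {f : k →+* κ}
    (hf : SepHom f) (ρ : ∀ N, k →+* PowQuot π N)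
    (hρ : ∀ {M N} (h : M ≤ N) c, powFactor π h (ρ N c) = ρ M c)
    (hρ0 : ∀ a c, powMk π 0 a = ρ 0 c → res a = f c) :
    ∃ S : CoeffSystem π res, ∀ N c, S.σ N (f c) = ρ N c := by
  have hker' : ∀ a, res a = 0 ↔ powMk π 0 a = 0 := fun a => by
    rw [powMk_eq_zero_iff, zero_add, pow_one, hker]
  let q : PowQuot π 0 →+* κ := Ideal.Quotient.lift _ res fun a ha =>
    (hker' a).2 (Ideal.Quotient.eq_zero_iff_mem.2 ha)
  have hq : Function.Bijective q := by
    constructor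
    · rw [injective_iff_map_eq_zero]
      intro a ha
      obtain ⟨a, rfl⟩ := Ideal.Quotient.mk_surjective a
      exact (hker' a).1 ha
    · intro c
      obtain ⟨a, rfl⟩ := hres c
      exact ⟨powMk π 0 a, rfl⟩
  let e := RingEquiv.ofBijective q hq
  have hstep : ∀ N (σ : κ →+* PowQuot π N), (∀ c, σ (f c) = ρ N c) →
      ∃ τ : κ →+* PowQuot π (N + 1), (∀ c, powFactor π N.le_succ (τ c) = σ c) ∧
        ∀ c, τ (f c) = ρ (N + 1) c := by
    intro N σ hσ
    obtain ⟨τ, h1, h2⟩ := SepHom.exists_lift hf (ρ (N + 1)) (powFactor π N.le_succ)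
      (Ideal.Quotient.factor_surjective _) ⟨2, by
        rw [Ideal.zero_eq_bot, eq_bot_iff, pow_two, Ideal.mul_le]
        intro x hx y hy
        obtain ⟨x, rfl⟩ := Ideal.Quotient.mk_surjective x
        obtain ⟨y, rfl⟩ := Ideal.Quotient.mk_surjective y
        have hx' : powMk π N x = 0 := hx
        have hy' : powMk π N y = 0 := hy
        rw [powMk_eq_zero_iff] at hx' hy'
        rw [Ideal.mem_bot, ← map_mul, powMk_eq_zero_iff]
        exact (pow_dvd_pow π (by omega : N + 1 + 1 ≤ (N + 1) + (N + 1))).trans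
          (by rw [pow_add]; exact mul_dvd_mul hx' hy')⟩ σ (by
        ext c
        simp only [RingHom.comp_apply]
        rw [hσ, hρ])
    exact ⟨τ, fun c => RingHom.congr_fun h1 c, fun c => RingHom.congr_fun h2 c⟩
  choose τ hτ hτ' using hstep
  let s : ∀ N, {σ : κ →+* PowQuot π N // ∀ c, σ (f c) = ρ N c} := fun N =>
    Nat.rec ⟨e.symm, fun c => by
      obtain ⟨a, ha⟩ := Ideal.Quotient.mk_surjective (ρ 0 c)
      change e.symm (f c) = _
      rw [RingEquiv.symm_apply_eq, ← ha]
      exact (hρ0 a c ha).symm⟩ (fun N t => ⟨τ N t.1 t.2, hτ' N t.1 t.2⟩) N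
  have hs : ∀ N c, powFactor π N.le_succ ((s (N + 1)).1 c) = (s N).1 c := fun N c =>
    hτ N _ (s N).2 c
  refine ⟨⟨fun N => (s N).1, fun {M N} h c => ?_, fun a => ?_⟩, fun N => (s N).2⟩
  · induction N, h using Nat.le_induction with
    | base =>
      obtain ⟨a, ha⟩ := Ideal.Quotient.mk_surjective ((s M).1 c)
      rw [← ha]
      rfl
    | succ N h ih =>
      rw [← ih, ← hs N]
      obtain ⟨a, ha⟩ := Ideal.Quotient.mk_surjective ((s (N + 1)).1 c)
      rw [← ha]
      rfl
  · change _ = e.symm (res a)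
    rw [RingEquiv.eq_symm_apply]
    rfl

namespace CoeffSystem

variable {π : O} {res : O →+* κ} (S : CoeffSystem π res)

/-- Evaluation of polynomials in the quotients. -/
noncomputable def ev (N : ℕ) : κ[X] →+* PowQuot π N :=
  Polynomial.eval₂RingHom (S.σ N) (powMk π N π)

theorem powFactor_ev {M N : ℕ} (h : M ≤ N) (p : κ[X]) :
    powFactor π h (S.ev N p) = S.ev M p := by
  have : (powFactor π h).comp (S.ev N) = S.ev M := by
    refine Polynomial.ringHom_ext (fun a => ?_) ?_
    · simp [ev, S.compat]
    · simp [ev]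
  exact RingHom.congr_fun this p

theorem ev_eq_zero_of_dvd {N : ℕ} {p : κ[X]} (h : X ^ (N + 1) ∣ p) : S.ev N p = 0 := by
  obtain ⟨q, rfl⟩ := h
  have : S.ev N X = powMk π N π := by simp [ev]
  rw [map_mul, map_pow, this, ← map_pow, powMk_eq_zero_iff.2 dvd_rfl, zero_mul]

theorem ev_zero (p : κ[X]) : S.ev 0 p = S.σ 0 (p.coeff 0) := by
  have h := S.ev_eq_zero_of_dvd (N := 0) (p := p - C (p.coeff 0)) (by
    rw [zero_add, pow_one, X_dvd_iff]
    simp)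
  rw [map_sub, sub_eq_zero] at h
  rw [h]
  simp [ev]

variable (hker : ∀ a, res a = 0 ↔ π ∣ a)

include hker in
theorem res_eq_of_powMk_eq {N : ℕ} {a : O} {p : κ[X]} (h : powMk π N a = S.ev N p) :
    res a = p.coeff 0 := by
  have : Nontrivial (PowQuot π 0) := by
    refine Ideal.Quotient.nontrivial_iff.2 fun h => ?_
    have h1 : π ∣ 1 := by
      rw [← pow_one π, ← zero_add 1, ← Ideal.mem_span_singleton, h]
      trivial
    exact one_ne_zero ((map_one res).symm.trans ((hker 1).2 h1))
  have h1 := congrArg (powFactor π N.zero_le) h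
  rw [powFactor_powMk, powFactor_ev, S.norm, ev_zero] at h1
  exact (S.σ 0).injective h1

variable (hπ : ∀ a, π * a = 0 → a = 0)

include hker hπ in
theorem dvd_of_ev_eq_zero {N : ℕ} {p : κ[X]} (h : S.ev N p = 0) : X ^ (N + 1) ∣ p := by
  induction N with
  | zero =>
    rw [zero_add, pow_one, X_dvd_iff, ← S.res_eq_of_powMk_eq hker (a := 0) (by rw [map_zero, h]),
      map_zero]
  | succ N ih =>
    obtain ⟨q, rfl⟩ := ih (by rw [← S.powFactor_ev N.le_succ, h, map_zero])
    obtain ⟨b, hb⟩ := Ideal.Quotient.mk_surjective (S.ev (N + 1) q)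
    have hX : S.ev (N + 1) X = powMk π (N + 1) π := by simp [ev]
    rw [map_mul, map_pow, hX, ← hb, ← map_pow, ← map_mul, powMk_eq_zero_iff, pow_succ _ (N + 1)]
      at h
    have hreg : ∀ m : ℕ, ∀ a, π ^ m * a = 0 → a = 0 := by
      intro m
      induction m with
      | zero => simp
      | succ m ihm => exact fun a ha => hπ a (ihm _ (by rw [← ha]; ring))
    obtain ⟨d, hd⟩ := h
    have hbd : b = π * d := sub_eq_zero.1 (hreg (N + 1) _ (by rw [mul_sub, hd]; ring))
    have := S.res_eq_of_powMk_eq hker hb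
    rw [(hker b).2 ⟨d, hbd⟩] at this
    rw [pow_succ]
    exact mul_dvd_mul_left _ (X_dvd_iff.2 this.symm)

theorem ev_surjective (N : ℕ) (a : O) : ∃ p, S.ev N p = powMk π N a := by
  induction N with
  | zero => exact ⟨C (res a), by rw [ev_zero, S.norm, coeff_C_zero]⟩
  | succ N ih =>
    obtain ⟨p, hp⟩ := ih
    obtain ⟨b, hb⟩ := Ideal.Quotient.mk_surjective (S.ev (N + 1) p)
    have h1 : powMk π N b = powMk π N a := by
      rw [← hp, ← S.powFactor_ev N.le_succ, ← hb]
      rfl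
    obtain ⟨c, hc⟩ := powMk_eq_iff.1 h1.symm
    obtain ⟨d, hd⟩ := Ideal.Quotient.mk_surjective (S.σ (N + 1) (res c))
    have h2 : powMk π 0 c = powMk π 0 d := by
      rw [S.norm, ← S.compat (Nat.zero_le (N + 1)), ← hd]
      rfl
    obtain ⟨e, he⟩ := powMk_eq_iff.1 h2
    refine ⟨p + C (res c) * X ^ (N + 1), ?_⟩
    have h3 : S.ev (N + 1) (p + C (res c) * X ^ (N + 1)) =
        powMk π (N + 1) (b + d * π ^ (N + 1)) := by
      rw [map_add, map_mul, map_pow, map_add, map_mul, map_pow]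
      congr 1
      · exact hb.symm
      · congr 1
        · exact (by simp [ev] : S.ev (N + 1) (C (res c)) = S.σ (N + 1) (res c)).trans hd.symm
        · congr 1
          simp [ev]
    rw [h3, eq_comm, powMk_eq_iff]
    refine ⟨e, ?_⟩
    have hcd : c = d + π * e := by
      rw [zero_add, pow_one] at he
      rw [← he]; ring
    have ha : a = b + π ^ (N + 1) * c := by rw [← hc]; ring
    rw [ha, hcd]
    ring

/-- A power series is an expansion of a ring element. -/
def IsExp (a : O) (F : PowerSeries κ) : Prop :=
  ∀ N, S.ev N (PowerSeries.trunc (N + 1) F) = powMk π N a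

theorem ev_congr {N : ℕ} {p q : κ[X]} (h : ∀ i < N + 1, p.coeff i = q.coeff i) :
    S.ev N p = S.ev N q := by
  rw [← sub_eq_zero, ← map_sub]
  refine S.ev_eq_zero_of_dvd (X_pow_dvd_iff.2 fun i hi => ?_)
  rw [coeff_sub, h i hi, sub_self]

include hker hπ in
theorem coeff_eq_of_ev_eq {N : ℕ} {p q : κ[X]} (h : S.ev N p = S.ev N q) {i : ℕ} (hi : i ≤ N) :
    p.coeff i = q.coeff i := by
  rw [← sub_eq_zero, ← map_sub] at h
  have := X_pow_dvd_iff.1 (S.dvd_of_ev_eq_zero hker hπ h) i (by omega)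
  rwa [coeff_sub, sub_eq_zero] at this

include hker hπ in
theorem IsExp.unique {a : O} {F G : PowerSeries κ} (hF : S.IsExp a F) (hG : S.IsExp a G) :
    F = G := by
  ext i
  have := S.coeff_eq_of_ev_eq hker hπ ((hF i).trans (hG i).symm) le_rfl
  simpa [PowerSeries.coeff_trunc] using this

include hker hπ in
theorem exists_isExp (a : O) : ∃ F, S.IsExp a F := by
  choose p hp using fun N => S.ev_surjective N a
  refine ⟨PowerSeries.mk fun i => (p i).coeff i, fun N => ?_⟩
  rw [← hp N]
  refine S.ev_congr fun i hi => ?_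
  rw [PowerSeries.coeff_trunc, if_pos hi, PowerSeries.coeff_mk]
  refine S.coeff_eq_of_ev_eq hker hπ (N := i) ?_ le_rfl
  rw [hp, ← S.powFactor_ev (Nat.lt_succ_iff.1 hi), hp]
  rfl

theorem IsExp.add {S : CoeffSystem π res} {a b : O} {F G : PowerSeries κ} (hF : S.IsExp a F)
    (hG : S.IsExp b G) : S.IsExp (a + b) (F + G) := fun N => by
  rw [map_add, map_add, map_add, hF, hG]

theorem IsExp.mul {S : CoeffSystem π res} {a b : O} {F G : PowerSeries κ} (hF : S.IsExp a F)
    (hG : S.IsExp b G) : S.IsExp (a * b) (F * G) := fun N => by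
  rw [map_mul (powMk π N), ← hF, ← hG, ← map_mul (S.ev N)]
  refine S.ev_congr fun i hi => ?_
  rw [PowerSeries.coeff_trunc, if_pos hi, Polynomial.coeff_mul, PowerSeries.coeff_mul]
  refine Finset.sum_congr rfl fun ab hab => ?_
  have := Finset.HasAntidiagonal.mem_antidiagonal.1 hab
  rw [PowerSeries.coeff_trunc, PowerSeries.coeff_trunc, if_pos (by omega), if_pos (by omega)]

theorem isExp_C {a : O} {c : κ} (h : ∀ N, S.σ N c = powMk π N a) :
    S.IsExp a (PowerSeries.C c) := fun N => by
  rw [PowerSeries.trunc_C, ← h]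
  simp [ev]

theorem isExp_X : S.IsExp π PowerSeries.X := fun N => by
  trans S.ev N X
  · refine S.ev_congr fun i hi => ?_
    rw [PowerSeries.coeff_trunc, if_pos hi, PowerSeries.coeff_X, Polynomial.coeff_X]
    simp [eq_comm]
  · simp [ev]

include hker hπ in
/-- The expansion homomorphism of a system of coefficient fields. -/
theorem exists_expansion : ∃ α : O →+* PowerSeries κ, ∀ a, S.IsExp a (α a) := by
  choose α hα using S.exists_isExp hker hπ
  refine ⟨{ toFun := α, map_one' := ?_, map_mul' := ?_, map_zero' := ?_, map_add' := ?_ }, hα⟩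
  · rw [← map_one PowerSeries.C]
    exact IsExp.unique S hker hπ (hα 1) (S.isExp_C fun N => by rw [map_one, map_one])
  · exact fun a b => IsExp.unique S hker hπ (hα _) ((hα a).mul (hα b))
  · rw [← map_zero PowerSeries.C]
    exact IsExp.unique S hker hπ (hα 0) (S.isExp_C fun N => by rw [map_zero, map_zero])
  · exact fun a b => IsExp.unique S hker hπ (hα _) ((hα a).add (hα b))

/-- The expansion homomorphism of a system of coefficient fields. -/
noncomputable def expansion : O →+* PowerSeries κ := (S.exists_expansion hker hπ).choose

theorem isExp_expansion (a : O) : S.IsExp a (S.expansion hker hπ a) :=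
  (S.exists_expansion hker hπ).choose_spec a

theorem constantCoeff_expansion (a : O) :
    PowerSeries.constantCoeff (S.expansion hker hπ a) = res a := by
  rw [S.res_eq_of_powMk_eq hker (S.isExp_expansion hker hπ a 0).symm, PowerSeries.coeff_trunc,
    if_pos (by omega), PowerSeries.coeff_zero_eq_constantCoeff_apply]

theorem expansion_self : S.expansion hker hπ π = PowerSeries.X :=
  IsExp.unique S hker hπ (S.isExp_expansion hker hπ π) S.isExp_X

theorem X_pow_dvd_expansion_iff {N : ℕ} {a : O} :
    PowerSeries.X ^ N ∣ S.expansion hker hπ a ↔ π ^ N ∣ a := by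
  obtain _ | N := N
  · simp
  have h := S.isExp_expansion hker hπ a N
  constructor
  · intro h1
    rw [PowerSeries.X_pow_dvd_iff] at h1
    rw [← powMk_eq_zero_iff, ← h]
    refine S.ev_eq_zero_of_dvd (X_pow_dvd_iff.2 fun i hi => ?_)
    rw [PowerSeries.coeff_trunc, if_pos hi, h1 i hi]
  · intro h1
    rw [← powMk_eq_zero_iff, ← h] at h1
    rw [PowerSeries.X_pow_dvd_iff]
    intro i hi
    have := X_pow_dvd_iff.1 (S.dvd_of_ev_eq_zero hker hπ h1) i hi
    rwa [PowerSeries.coeff_trunc, if_pos hi] at this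

theorem IsExp.map {S : CoeffSystem π res} {O' κ' : Type*} [CommRing O'] [Field κ'] {i : O →+* O'}
    {res' : O' →+* κ'} (S' : CoeffSystem (i π) res') (g : κ →+* κ')
    (h : ∀ N c a, S.σ N c = powMk π N a → S'.σ N (g c) = powMk (i π) N (i a))
    {a : O} {F : PowerSeries κ} (hF : S.IsExp a F) : S'.IsExp (i a) (PowerSeries.map g F) := by
  intro N
  have hle : Ideal.span {π ^ (N + 1)} ≤ (Ideal.span {i π ^ (N + 1)}).comap i := by
    rw [Ideal.span_singleton_le_iff_mem, Ideal.mem_comap, map_pow]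
    exact Ideal.mem_span_singleton_self _
  let q : PowQuot π N →+* PowQuot (i π) N := Ideal.quotientMap _ i hle
  have h1 : ∀ p : κ[X], q (S.ev N p) = S'.ev N (p.map g) := by
    have : q.comp (S.ev N) = (S'.ev N).comp (Polynomial.mapRingHom g) := by
      refine Polynomial.ringHom_ext (fun c => ?_) ?_
      · obtain ⟨b, hb⟩ := Ideal.Quotient.mk_surjective (S.σ N c)
        have := h N c b hb.symm
        simp only [RingHom.comp_apply, coe_mapRingHom, map_C, ev, coe_eval₂RingHom, eval₂_C]
        rw [this, ← hb]
        rfl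
      · simp only [RingHom.comp_apply, coe_mapRingHom, map_X, ev, coe_eval₂RingHom, eval₂_X]
        rfl
    exact fun p => RingHom.congr_fun this p
  have h2 : q (powMk π N a) = powMk (i π) N (i a) := rfl
  rw [← h2, ← hF, h1]
  refine S'.ev_congr fun j hj => ?_
  rw [PowerSeries.coeff_trunc, if_pos hj, PowerSeries.coeff_map, Polynomial.coeff_map,
    PowerSeries.coeff_trunc, if_pos hj]

end CoeffSystem

/-- Expansion homomorphisms over a coefficient field. -/
theorem exists_expansion_of_base {k : Type*} [Field k] {π : O} {res : O →+* κ}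
    (hres : Function.Surjective res) (hker : ∀ a, res a = 0 ↔ π ∣ a)
    (hπ : ∀ a, π * a = 0 → a = 0) (j : k →+* O) (hj : SepHom (res.comp j)) :
    ∃ S : CoeffSystem π res, ∀ c, S.expansion hker hπ (j c) = PowerSeries.C (res (j c)) := by
  obtain ⟨S, hS⟩ := exists_coeffSystem hres hker hj (fun N => (powMk π N).comp j)
    (fun h c => rfl) (fun a c h => by
      have h1 := powMk_eq_iff.1 h
      rw [zero_add, pow_one, ← hker, map_sub, sub_eq_zero] at h1
      exact h1)
  exact ⟨S, fun c => CoeffSystem.IsExp.unique S hker hπ (S.isExp_expansion hker hπ _)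
    (S.isExp_C fun N => hS N c)⟩

/-- Extension of expansion homomorphisms. -/
theorem exists_expansion_extend {O' κ' : Type*} [CommRing O'] [Field κ'] {π : O} {res : O →+* κ}
    (hresO : Function.Surjective res)
    (hker : ∀ a, res a = 0 ↔ π ∣ a) (hπ : ∀ a, π * a = 0 → a = 0) (S : CoeffSystem π res)
    (i : O →+* O') {res' : O' →+* κ'} (hres : Function.Surjective res')
    (hker' : ∀ a, res' a = 0 ↔ i π ∣ a) (hπ' : ∀ a, i π * a = 0 → a = 0)
    (g : κ →+* κ') (hg : SepHom g) (hig : ∀ a, g (res a) = res' (i a)) :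
    ∃ S' : CoeffSystem (i π) res', ∀ a, S'.expansion hker' hπ' (i a) =
      PowerSeries.map g (S.expansion hker hπ a) := by
  have hle : ∀ N, Ideal.span {π ^ (N + 1)} ≤ (Ideal.span {i π ^ (N + 1)}).comap i := by
    intro N
    rw [Ideal.span_singleton_le_iff_mem, Ideal.mem_comap, map_pow]
    exact Ideal.mem_span_singleton_self _
  let q : ∀ N, PowQuot π N →+* PowQuot (i π) N := fun N => Ideal.quotientMap _ i (hle N)
  obtain ⟨S', hS'⟩ := exists_coeffSystem hres hker' hg (fun N => (q N).comp (S.σ N))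
    (fun {M N} h c => by
      simp only [RingHom.comp_apply]
      rw [← S.compat h]
      obtain ⟨b, hb⟩ := Ideal.Quotient.mk_surjective (S.σ N c)
      rw [← hb]
      rfl) (fun a c h => by
      obtain ⟨b, rfl⟩ := hresO c
      rw [RingHom.comp_apply, ← S.norm] at h
      have h1 := powMk_eq_iff.1 (h : powMk _ 0 a = powMk _ 0 (i b))
      rw [zero_add, pow_one, ← hker', map_sub, sub_eq_zero] at h1
      rw [h1, hig])
  refine ⟨S', fun a => CoeffSystem.IsExp.unique S' hker' hπ' (S'.isExp_expansion hker' hπ' _)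
    ((S.isExp_expansion hker hπ a).map S' g fun N c b hb => ?_)⟩
  rw [hS', RingHom.comp_apply, hb]
  rfl

end Expansion

end Paper

namespace Paper

section LaurentExpansion

open LaurentSeries

/-- The valuation of the field of Laurent series. -/
noncomputable abbrev laurentV (κ : Type*) [Field κ] :
    Valuation κ⸨X⸩ (WithZero (Multiplicative ℤ)) := Valued.v

/-- An expansion homomorphism into Laurent series over a field, defined on a coarsening of a
valuation ring. -/
structure LaurentExpansion {K : Type*} [Field K] (O : ValuationSubring K)
    (κ : Type*) [Field κ] where
  plus : ValuationSubring K
  le : O ≤ plus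
  α : plus →+* κ⸨X⸩
  valuation_le_one : ∀ a, laurentV κ (α a) ≤ 1 ↔ (a : K) ∈ O
  dense : ∀ y γ : κ⸨X⸩, γ ≠ 0 → ∃ a, laurentV κ (y - α a) < laurentV κ γ
  isUnit : ∀ a, α a ≠ 0 → IsUnit a

theorem laurentV_single {κ : Type*} [Field κ] (s : ℤ) :
    laurentV κ (HahnSeries.single s 1) = WithZero.exp (-s) :=
  LaurentSeries.valuation_single_zpow κ s

theorem laurentV_ofPowerSeries_le {κ : Type*} [Field κ] (q : PowerSeries κ) :
    laurentV κ (HahnSeries.ofPowerSeries ℤ κ q) ≤ 1 :=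
  (LaurentSeries.val_le_one_iff_eq_coe κ _).2 ⟨q, rfl⟩

theorem exists_eq_single_neg_mul {κ : Type*} [Field κ] (y : κ⸨X⸩) :
    ∃ (m : ℕ) (q : PowerSeries κ), y = HahnSeries.single (-(m : ℤ)) 1 *
      HahnSeries.ofPowerSeries ℤ κ q := by
  refine ⟨(-y.order).toNat, PowerSeries.X ^ y.order.toNat * y.powerSeriesPart, ?_⟩
  rw [map_mul, HahnSeries.ofPowerSeries_X_pow, ← mul_assoc, HahnSeries.single_mul_single, one_mul,
    show -((-y.order).toNat : ℤ) + (y.order.toNat : ℤ) = y.order by omega,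
    LaurentSeries.single_order_mul_powerSeriesPart]

variable {K : Type*} [Field K]

theorem exists_laurentExpansion (O : ValuationSubring K) {κ : Type*} [Field κ] (p : O)
    (α : O →+* PowerSeries κ) (hp : α p = PowerSeries.X)
    (hu : ∀ b, PowerSeries.constantCoeff (α b) ≠ 0 → IsUnit b)
    (hs : ∀ c, ∃ a, PowerSeries.constantCoeff (α a) = c) :
    ∃ E : LaurentExpansion O κ, ∀ (a : O) (h : (a : K) ∈ E.plus),
      E.α ⟨a, h⟩ = HahnSeries.ofPowerSeries ℤ κ (α a) := by
  let P := RingHom.ker α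
  have hP : P.IsPrime := RingHom.ker_isPrime α
  let O' := ValuationSubring.ofPrime O P
  have hle : O ≤ O' := O.le_ofPrime P
  let φ := (HahnSeries.ofPowerSeries ℤ κ).comp α
  have hφ0 : ∀ a, φ a = 0 ↔ α a = 0 := fun a => by
    change HahnSeries.ofPowerSeries ℤ κ (α a) = 0 ↔ _
    rw [← map_zero (HahnSeries.ofPowerSeries ℤ κ), HahnSeries.ofPowerSeries_injective.eq_iff]
  have hφ : ∀ y : P.primeCompl, IsUnit (φ y) := fun y =>
    IsUnit.mk0 _ fun h => y.2 ((hφ0 _).1 h)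
  let α' : O' →+* κ⸨X⸩ := IsLocalization.lift (M := P.primeCompl) hφ
  have hα : ∀ (a : O) (h : (a : K) ∈ O'), α' ⟨a, h⟩ = φ a := fun a h =>
    IsLocalization.lift_eq (M := P.primeCompl) hφ a
  have hα' : ∀ a : O, α' ⟨a, hle a.2⟩ = φ a := fun a => hα a _
  have hfrac : ∀ a : O', ∃ x s : O, α s ≠ 0 ∧ (a : K) * s = x := fun a => by
    obtain ⟨⟨x, s⟩, h⟩ := IsLocalization.surj P.primeCompl a
    exact ⟨x, s, fun h => s.2 h, congrArg Subtype.val h⟩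
  have hvu : ∀ b : O, 1 ≤ laurentV κ (φ b) → IsUnit b := fun b hb => by
    refine hu b fun h => ?_
    obtain ⟨q, hq⟩ := PowerSeries.X_dvd_iff.2 h
    have h2 : laurentV κ (φ b) < 1 := by
      change laurentV κ (HahnSeries.ofPowerSeries ℤ κ (α b)) < 1
      rw [hq, map_mul, map_mul, HahnSeries.ofPowerSeries_X, laurentV_single]
      refine mul_lt_one_of_lt_of_le ?_ (laurentV_ofPowerSeries_le q)
      rw [← WithZero.exp_zero, WithZero.exp_lt_exp]
      norm_num
    exact absurd hb (not_le.2 h2)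
  have hunit : ∀ a : O', α' a ≠ 0 → IsUnit a := fun a ha => by
    obtain ⟨x, s, hs0, h⟩ := hfrac a
    have hs1 : (s : K) ≠ 0 := fun h => hs0 (by
      rw [show s = 0 from Subtype.ext h, map_zero])
    have h1 : a * ⟨s, hle s.2⟩ = (⟨x, hle x.2⟩ : O') := Subtype.ext h
    have hx0 : α x ≠ 0 := fun hx => by
      have h2 := congrArg α' h1
      rw [map_mul, hα', hα', (hφ0 x).2 hx] at h2
      rcases mul_eq_zero.1 h2 with h2 | h2
      · exact ha h2
      · exact hs0 ((hφ0 _).1 h2)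
    have h2 : IsUnit (⟨x, hle x.2⟩ : O') := IsLocalization.map_units O' (⟨x, hx0⟩ : P.primeCompl)
    exact isUnit_of_mul_isUnit_left (h1 ▸ h2)
  let pp : O' := ⟨p, hle p.2⟩
  have hαp : α' pp = HahnSeries.single 1 1 := by
    rw [hα']
    change HahnSeries.ofPowerSeries ℤ κ (α p) = _
    rw [hp, HahnSeries.ofPowerSeries_X]
  have happrox : ∀ (q : PowerSeries κ) (N : ℕ), ∃ a, PowerSeries.X ^ N ∣ q - α a := by
    intro q N
    induction N with
    | zero => exact ⟨0, by simp⟩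
    | succ N ih =>
      obtain ⟨a, z, hz⟩ := ih
      obtain ⟨b, hb⟩ := hs (PowerSeries.constantCoeff z)
      obtain ⟨r, hr⟩ := PowerSeries.X_dvd_iff.2
        (show PowerSeries.constantCoeff (z - α b) = 0 by rw [map_sub, hb, sub_self])
      refine ⟨a + p ^ N * b, r, ?_⟩
      rw [map_add, map_mul, map_pow, hp, pow_succ, mul_assoc, ← hr, mul_sub, ← hz]
      ring
  refine ⟨⟨O', hle, α', fun a => ⟨fun h => ?_, fun h => ?_⟩, fun y γ hγ => ?_, hunit⟩, hα⟩
  · obtain ⟨x, s, hs0, hx⟩ := hfrac a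
    have hs1 : (s : K) ≠ 0 := fun h => hs0 (by
      rw [show s = 0 from Subtype.ext h, map_zero])
    have h1 : a * ⟨s, hle s.2⟩ = (⟨x, hle x.2⟩ : O') := Subtype.ext hx
    rcases O.mem_or_inv_mem a with ha | ha
    · exact ha
    by_cases ha0 : (a : K) = 0
    · rw [ha0]; exact O.zero_mem
    have h2 : (⟨(a : K)⁻¹, hle ha⟩ : O') * a = 1 := Subtype.ext (inv_mul_cancel₀ ha0)
    have h3 := congrArg α' h2
    have h4 : α' ⟨(a : K)⁻¹, hle ha⟩ = φ ⟨(a : K)⁻¹, ha⟩ := hα' ⟨(a : K)⁻¹, ha⟩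
    rw [map_mul, map_one, h4] at h3
    have h5 : 1 ≤ laurentV κ (φ ⟨(a : K)⁻¹, ha⟩) := by
      rw [← map_one (laurentV κ), ← h3, map_mul]
      exact mul_le_of_le_one_right' h
    obtain ⟨b, hb⟩ := hvu _ h5
    have h6 : (a : K) = ((b⁻¹ : Oˣ) : O) := by
      have h7 : ((b : O) : K) * ((b⁻¹ : Oˣ) : O) = 1 := by
        rw [← O.coe_mul, Units.mul_inv]
        rfl
      rw [hb] at h7
      exact (inv_mul_eq_one₀ ha0).1 h7
    rw [h6]
    exact SetLike.coe_mem _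
  · rw [show a = ⟨((⟨a, h⟩ : O) : K), a.2⟩ from rfl, hα]
    exact laurentV_ofPowerSeries_le _
  · obtain ⟨m, q, rfl⟩ := exists_eq_single_neg_mul y
    have hγ' : laurentV κ γ ≠ 0 := (Valuation.ne_zero_iff _).2 hγ
    obtain ⟨z, hz⟩ : ∃ z : ℤ, laurentV κ γ = WithZero.exp z :=
      ⟨_, (WithZero.exp_log hγ').symm⟩
    obtain ⟨a, r, hr⟩ := happrox q (m + z.natAbs + 1)
    obtain ⟨b, hb⟩ := (hunit pp (by rw [hαp]; exact single_ne_zero' _)).exists_left_inv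
    have hαb : α' b = HahnSeries.single (-1) 1 := by
      have h1 := congrArg α' hb
      rw [map_mul, map_one, hαp] at h1
      have h2 : (HahnSeries.single (-1) 1 : κ⸨X⸩) * HahnSeries.single 1 1 = 1 := by
        rw [HahnSeries.single_mul_single]
        simp
      exact mul_right_cancel₀ (single_ne_zero' 1) (h1.trans h2.symm)
    refine ⟨b ^ m * ⟨a, hle a.2⟩, ?_⟩
    have h1 : (HahnSeries.single (-1) 1 : κ⸨X⸩) ^ m = HahnSeries.single (-(m : ℤ)) 1 := by
      rw [HahnSeries.single_pow]
      simp
    rw [map_mul, map_pow, hαb, hα', h1, ← mul_sub]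
    change laurentV κ (_ * (_ - HahnSeries.ofPowerSeries ℤ κ (α a))) < _
    rw [← map_sub, hr, map_mul (HahnSeries.ofPowerSeries ℤ κ), HahnSeries.ofPowerSeries_X_pow,
      map_mul, map_mul, laurentV_single,
      laurentV_single, hz, ← mul_assoc, ← WithZero.exp_add]
    refine mul_lt_of_lt_of_le_one ?_ (laurentV_ofPowerSeries_le r)
    rw [WithZero.exp_lt_exp]
    push_cast
    have := neg_abs_le z
    have := Int.natCast_natAbs z
    omega

namespace LaurentExpansion

variable {O : ValuationSubring K} {κ : Type*} [Field κ] (E : LaurentExpansion O κ)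

theorem valuation_lt_one {a : E.plus} (h : laurentV κ (E.α a) < 1) : O.valuation a < 1 := by
  have ha := (E.valuation_le_one a).1 h.le
  refine lt_of_le_of_ne ((O.valuation_le_one_iff _).2 ha) fun h1 => ?_
  obtain ⟨b, hb⟩ := ((O.valuation_eq_one_iff ⟨a, ha⟩).2 h1).exists_left_inv
  have h2 : (⟨b, E.le b.2⟩ : E.plus) * a = 1 :=
    Subtype.ext (congrArg Subtype.val hb : (b : K) * a = 1)
  have h3 := congrArg (fun c => laurentV κ (E.α c)) h2
  simp only [map_mul, map_one] at h3
  have h4 : laurentV κ (E.α ⟨b, E.le b.2⟩) ≤ 1 := (E.valuation_le_one _).2 b.2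
  rw [mul_comm] at h3
  exact absurd h3 (mul_lt_one_of_lt_of_le h h4).ne

theorem valuation_lt {a c : E.plus} (h : laurentV κ (E.α a) < laurentV κ (E.α c)) :
    O.valuation a < O.valuation c := by
  have hc : E.α c ≠ 0 := fun h0 => by
    rw [h0, map_zero] at h
    exact not_lt_zero h
  obtain ⟨b, hb⟩ := (E.isUnit c hc).exists_left_inv
  have h1 : laurentV κ (E.α (b * a)) < 1 := by
    have h2 := congrArg (fun c => laurentV κ (E.α c)) hb
    simp only [map_mul, map_one] at h2
    rw [map_mul, map_mul, ← h2]
    refine (mul_lt_mul_iff_right₀ ?_).2 h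
    exact zero_lt_iff.2 (left_ne_zero_of_mul (h2 ▸ one_ne_zero))
  have h2 := E.valuation_lt_one h1
  have h3 : (a : K) = ((b * a : E.plus) : K) * c := by
    have := congrArg Subtype.val hb
    change (b : K) * c = 1 at this
    change (a : K) = b * a * c
    linear_combination (- a : K) * this
  have hc0 : (c : K) ≠ 0 := fun h => hc (by
    rw [show c = 0 from Subtype.ext h, map_zero])
  rw [h3, map_mul]
  exact mul_lt_of_lt_one_left (zero_lt_iff.2 ((Valuation.ne_zero_iff _).2 hc0)) h2

theorem ker_eq {a : E.plus} : E.α a = 0 ↔ IsLocalRing.residue E.plus a = 0 := by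
  rw [IsLocalRing.residue_eq_zero_iff, IsLocalRing.mem_maximalIdeal, mem_nonunits_iff]
  refine ⟨fun h h1 => ?_, fun h => ?_⟩
  · obtain ⟨b, hb⟩ := h1.exists_left_inv
    have h2 := congrArg E.α hb
    rw [map_mul, h, mul_zero, map_one] at h2
    exact zero_ne_one h2
  · by_contra h1
    exact h (E.isUnit a h1)

/-- The embedding of the residue field of the coarsening. -/
noncomputable def resHom : IsLocalRing.ResidueField E.plus →+* κ⸨X⸩ :=
  Ideal.Quotient.lift _ E.α fun a ha => E.ker_eq.2 ((IsLocalRing.residue_eq_zero_iff a).2 ha)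

end LaurentExpansion

end LaurentExpansion

end Paper

namespace Paper

section ValuedBase

open LaurentSeries

/-- An equicharacteristic local domain contains a prime field. -/
theorem exists_primeField {O κ : Type*} [CommRing O] [Field κ] (res : O →+* κ)
    (hu : ∀ a, res a ≠ 0 → IsUnit a) (h : ringChar O = ringChar κ) :
    ∃ (P : Type) (_ : Field P) (j : P →+* O), SepHom (res.comp j) := by
  obtain hp | hp := CharP.char_is_prime_or_zero κ (ringChar κ)
  · have : Fact (ringChar κ).Prime := ⟨hp⟩
    have : CharP O (ringChar κ) := h ▸ ringChar.charP O
    exact ⟨ZMod (ringChar κ), inferInstance, ZMod.castHom dvd_rfl O, sepHom_zmod _⟩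
  · have : CharZero κ := by
      have := ringChar.charP κ
      rw [hp] at this
      exact CharP.charP_to_charZero κ
    have hz : ∀ z : nonZeroDivisors ℤ, IsUnit (Int.castRingHom O z) := fun z => hu _ (by
      have := nonZeroDivisors.ne_zero z.2
      simpa using this)
    exact ⟨ℚ, inferInstance, IsLocalization.lift hz, sepHom_of_charZero _⟩

theorem hasBasis_uniformity_of_valued (R : Type*) [Field R] {Γ : Type*}
    [LinearOrderedCommGroupWithZero Γ] [hv : Valued R Γ] :
    (uniformity R).HasBasis (fun d : R => d ≠ 0)
      fun d => {p | hv.v (p.2 - p.1) < hv.v d} := by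
  refine (Valued.hasBasis_uniformity R Γ).to_hasBasis (fun γ _ => ?_) fun d hd => ?_
  · obtain ⟨d, hd⟩ := MonoidWithZeroHom.ValueGroup₀.restrict₀_surjective _ γ.1
    refine ⟨d, fun h => γ.ne_zero ?_, fun p hp => ?_⟩
    · rw [← hd, h, map_zero]
    · change hv.v.restrict _ < γ.1
      rw [← hd]
      exact (Valuation.restrict_lt_iff _).2 hp
  · refine ⟨Units.mk0 (hv.v.restrict d) fun h => hd ?_, trivial, fun p hp => ?_⟩
    · exact (Valuation.zero_iff _).1 h
    · exact (Valuation.restrict_lt_iff _).1 hp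

theorem ExcellentCompletion.sepHom {C : Type u} [Field C] {u : Valuation C Zm0}
    (hexc : ExcellentCompletion C u) {k : Type*} [Field k] (γ : C →+* k⸨X⸩)
    (hγ : ∀ a b, laurentV k (γ a) < laurentV k (γ b) ↔ u a < u b)
    (D : ∀ y e : k⸨X⸩, e ≠ 0 → ∃ c, laurentV k (y - γ c) < laurentV k e) : SepHom γ := by
  let _ : Valued C Zm0 := Valued.mk' u
  have hu : IsUniformInducing γ := by
    rw [(hasBasis_uniformity_of_valued C).isUniformInducing_iff
      (hasBasis_uniformity_of_valued k⸨X⸩)]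
    refine ⟨fun e he => ?_, fun d hd => ?_⟩
    · obtain ⟨c, hc⟩ := D e e he
      have hce : laurentV k (γ c) = laurentV k e := by
        refine Valuation.map_eq_of_sub_lt _ ?_
        rwa [Valuation.map_sub_swap]
      refine ⟨c, fun h => ?_, fun x y h => ?_⟩
      · rw [h, map_zero, map_zero, eq_comm, Valuation.zero_iff] at hce
        exact he hce
      · change laurentV k (γ y - γ x) < laurentV k e
        rw [← map_sub, ← hce]
        exact (hγ _ _).2 h
    · refine ⟨γ d, (map_ne_zero γ).2 hd, fun x y h => ?_⟩
      have h' : laurentV k (γ y - γ x) < laurentV k (γ d) := h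
      rw [← map_sub] at h'
      exact (hγ _ _).1 h'
  have hd : DenseRange γ := by
    intro y
    rw [mem_closure_iff_nhds_basis
      (nhds_basis_uniformity' (hasBasis_uniformity_of_valued k⸨X⸩))]
    intro e he
    obtain ⟨c, hc⟩ := D y e he
    refine ⟨γ c, ⟨c, rfl⟩, ?_⟩
    change laurentV k (γ c - y) < laurentV k e
    rwa [Valuation.map_sub_swap]
  have hs : SepHom (UniformSpace.Completion.coeRingHom : C →+* UniformSpace.Completion C) :=
    SepHom.of_isSepExtHom hexc
  have hc : UniformContinuous (UniformSpace.Completion.coeRingHom :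
      C →+* UniformSpace.Completion C) :=
    UniformSpace.Completion.uniformContinuous_coe C
  have he : (IsDenseInducing.extendRingHom hu hd hc).comp γ = UniformSpace.Completion.coeRingHom :=
    RingHom.ext fun c => (hu.isDenseInducing hd).extend_eq hc.continuous c
  rw [← he] at hs
  exact SepHom.of_comp hs

end ValuedBase

end Paper

namespace Paper

section Expansions

open LaurentSeries

theorem isUnit_of_map_ne_zero {O κ : Type*} [CommRing O] [IsLocalRing O] [Field κ] {res : O →+* κ}
    (hres : Function.Surjective res) {a : O} (ha : res a ≠ 0) : IsUnit a := by
  obtain ⟨b, hb⟩ := hres (res a)⁻¹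
  have h : res (1 - a * b) = 0 := by
    rw [map_sub, map_one, map_mul, hb, mul_inv_cancel₀ ha, sub_self]
  rcases IsLocalRing.isUnit_or_isUnit_of_add_one (add_sub_cancel (a * b) 1) with h1 | h1
  · exact isUnit_of_mul_isUnit_left h1
  · exact absurd h (h1.map res).ne_zero

theorem IsUniformizer.residue_eq_zero_iff {K Γ : Type*} [Field K]
    [LinearOrderedCommGroupWithZero Γ] {v : Valuation K Γ} {π : K} (h : IsUniformizer v π)
    (a : v.valuationSubring) :
    resMap v a = 0 ↔ (⟨π, h.2.1.le⟩ : v.valuationSubring) ∣ a := by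
  have h1 : resMap v a = 0 ↔ v (a : K) < 1 := by
    rw [IsLocalRing.residue_eq_zero_iff, ValuationSubring.valuation_lt_one_iff]
    have := (Valuation.isEquiv_valuation_valuationSubring v).lt_iff_lt (x := (a : K)) (y := 1)
    rw [map_one, map_one] at this
    exact this.symm
  rw [h1]
  have hπ : π ≠ 0 := fun h0 => by
    have := h.1
    rw [h0, map_zero] at this
    exact lt_irrefl _ this
  constructor
  · intro ha
    refine ⟨⟨π⁻¹ * a, ?_⟩, Subtype.ext (mul_inv_cancel_left₀ hπ _).symm⟩
    rw [Valuation.mem_valuationSubring_iff, map_mul, map_inv₀]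
    rw [inv_mul_le_iff₀ h.1, mul_one]
    exact h.2.2 _ ha
  · rintro ⟨b, rfl⟩
    change v (π * b) < 1
    rw [map_mul]
    exact mul_lt_one_of_lt_of_le h.2.1 b.2

theorem ringHom_ext_of_valuationSubring {C F : Type*} [Field C] [Field F] (O : ValuationSubring C)
    {f g : C →+* F} (h : ∀ c ∈ O, f c = g c) : f = g := by
  ext c
  rcases O.mem_or_inv_mem c with hc | hc
  · exact h c hc
  · rw [← inv_inj, ← map_inv₀, ← map_inv₀]
    exact h _ hc

theorem exists_expansions {C : Type u} [Field C] (u : Valuation C Zm0)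
    (hequichar : ringChar C = ringChar (ResF u)) (π : C) (hπu : IsUniformizer u π)
    (hexc : ExcellentCompletion C u) :
    ∃ γ : C →+* (ResF u)⸨X⸩, SepHom γ ∧ γ π = HahnSeries.single 1 1 ∧
      ∀ (K : Type u) [Field K] (f : C →+* K) (O : ValuationSubring K)
        (hO : ∀ c, f c ∈ O ↔ u c ≤ 1) (κ : Type u) [Field κ] (res : O →+* κ),
        Function.Surjective res →
        (∀ a, res a = 0 ↔ (⟨f π, (hO π).2 hπu.2.1.le⟩ : O) ∣ a) →
        ∀ g : ResF u →+* κ, SepHom g →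
        (∀ c : u.valuationSubring, g (resMap u c) = res ⟨f c, (hO c).2 c.2⟩) →
        ∃ (E : LaurentExpansion O κ) (σ : C →+* E.plus), (∀ c, (σ c : K) = f c) ∧
          E.α.comp σ = (laurentMap g).comp γ := by
  let OC := u.valuationSubring
  let p : OC := ⟨π, hπu.2.1.le⟩
  have hπ0 : π ≠ 0 := fun h0 => by
    have := hπu.1
    rw [h0, map_zero] at this
    exact lt_irrefl _ this
  have hres : Function.Surjective (resMap u) := IsLocalRing.residue_surjective
  have hker : ∀ a, resMap u a = 0 ↔ p ∣ a := hπu.residue_eq_zero_iff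
  have hp0 : p ≠ 0 := fun h => hπ0 (congrArg Subtype.val h)
  have hreg : ∀ a, p * a = 0 → a = 0 := fun a h => (mul_eq_zero.1 h).resolve_left hp0
  obtain ⟨P, _, j, hj⟩ := exists_primeField (resMap u) (fun a => isUnit_of_map_ne_zero hres) (by
    rw [← hequichar]
    have : CharP OC (ringChar C) := (RingHom.charP_iff OC.subtype
      Subtype.val_injective _).2 (ringChar.charP C)
    exact ringChar.eq OC _)
  obtain ⟨S, -⟩ := exists_expansion_of_base hres hker hreg j hj
  let αC := S.expansion hker hreg
  have hcc : ∀ a, PowerSeries.constantCoeff (αC a) = resMap u a :=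
    S.constantCoeff_expansion hker hreg
  obtain ⟨EC, hEC⟩ := exists_laurentExpansion OC p αC (S.expansion_self hker hreg)
    (fun b hb => isUnit_of_map_ne_zero hres (by rwa [hcc] at hb))
    (fun c => by
      obtain ⟨a, rfl⟩ := hres c
      exact ⟨a, hcc a⟩)
  have hinj : ∀ a, αC a = 0 → a = 0 := by
    intro a ha
    by_contra h0
    have h1 : u (a : C) ≠ 0 := (Valuation.ne_zero_iff _).2 fun h => h0 (Subtype.ext h)
    obtain ⟨N, hN⟩ := exists_pow_lt₀ hπu.2.1 (Units.mk0 _ h1)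
    obtain ⟨b, hb⟩ := (S.X_pow_dvd_expansion_iff hker hreg (N := N) (a := a)).1
      (by
        change _ ∣ αC a
        rw [ha]
        exact dvd_zero _)
    have h2 := congrArg (fun x : OC => u (x : C)) hb
    change u (a : C) = u (π ^ N * b) at h2
    rw [map_mul, map_pow] at h2
    rw [Units.val_mk0, h2] at hN
    exact absurd hN (not_lt.2 (mul_le_of_le_one_right' b.2))
  have htop : ∀ c : C, c ∈ EC.plus := by
    intro c
    rcases OC.mem_or_inv_mem c with hc | hc
    · exact EC.le hc
    by_cases hc0 : c = 0
    · rw [hc0]; exact EC.plus.zero_mem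
    have h1 : EC.α ⟨c⁻¹, EC.le hc⟩ ≠ 0 := by
      rw [hEC ⟨c⁻¹, hc⟩]
      intro h
      rw [← map_zero (HahnSeries.ofPowerSeries ℤ _), HahnSeries.ofPowerSeries_injective.eq_iff] at h
      exact inv_ne_zero hc0 (congrArg Subtype.val (hinj _ h))
    obtain ⟨b, hb⟩ := (EC.isUnit _ h1).exists_right_inv
    have h2 : c = (b : C) := (inv_mul_eq_one₀ hc0).1 (congrArg Subtype.val hb)
    rw [h2]
    exact b.2
  let γ : C →+* (ResF u)⸨X⸩ := EC.α.comp ((RingHom.id C).codRestrict EC.plus htop)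
  have hγ : ∀ a : OC, γ a = HahnSeries.ofPowerSeries ℤ _ (αC a) := fun a => hEC a _
  have hequiv : ((laurentV (ResF u)).comap γ).IsEquiv u :=
    Valuation.isEquiv_of_val_le_one fun {x} => EC.valuation_le_one ⟨x, htop x⟩
  have hsep : SepHom γ := hexc.sepHom γ (fun a b => hequiv.lt_iff_lt) fun y e he => by
    obtain ⟨a, ha⟩ := EC.dense y e he
    exact ⟨a, ha⟩
  refine ⟨γ, hsep, ?_, ?_⟩
  · have := hγ p
    rw [show αC p = PowerSeries.X from S.expansion_self hker hreg, HahnSeries.ofPowerSeries_X]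
      at this
    exact this
  intro K _ f O hO κ _ res hresO hkerO g hg hig
  let i : OC →+* O := (f.comp OC.subtype).codRestrict O.toSubring fun c => (hO c).2 c.2
  have hip : i p ≠ 0 := fun h => hπ0 ((map_eq_zero f).1 (congrArg Subtype.val h))
  have hreg' : ∀ a, i p * a = 0 → a = 0 := fun a h => (mul_eq_zero.1 h).resolve_left hip
  obtain ⟨S', hS'⟩ := exists_expansion_extend hres hker hreg S i hresO hkerO hreg' g hg hig
  let αK := S'.expansion hkerO hreg'
  have hccK : ∀ a, PowerSeries.constantCoeff (αK a) = res a :=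
    S'.constantCoeff_expansion hkerO hreg'
  obtain ⟨E, hE⟩ := exists_laurentExpansion O (i p) αK (S'.expansion_self hkerO hreg')
    (fun b hb => isUnit_of_map_ne_zero hresO (by rwa [hccK] at hb))
    (fun c => by
      obtain ⟨a, rfl⟩ := hresO c
      exact ⟨a, hccK a⟩)
  have hval : ∀ a : OC, E.α ⟨i a, E.le (i a).2⟩ = laurentMap g (γ a) := fun a => by
    rw [hE, hγ, laurentMap_ofPowerSeries]
    congr 1
    exact hS' a
  have hmem : ∀ c, f c ∈ E.plus := by
    intro c
    rcases OC.mem_or_inv_mem c with hc | hc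
    · exact E.le ((hO c).2 hc)
    by_cases hc0 : c = 0
    · rw [hc0, map_zero]; exact E.plus.zero_mem
    have h1 := hval ⟨c⁻¹, hc⟩
    have h2 : E.α ⟨i ⟨c⁻¹, hc⟩, E.le (i ⟨c⁻¹, hc⟩).2⟩ ≠ 0 := by
      rw [h1]
      exact (map_ne_zero _).2 ((map_ne_zero _).2 (inv_ne_zero hc0))
    obtain ⟨b, hb⟩ := (E.isUnit _ h2).exists_right_inv
    have h3 : f c⁻¹ * (b : K) = 1 := congrArg Subtype.val hb
    rw [map_inv₀] at h3
    rw [(inv_mul_eq_one₀ ((map_ne_zero f).2 hc0)).1 h3]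
    exact b.2
  exact ⟨E, f.codRestrict E.plus.toSubring hmem, fun c => rfl,
    ringHom_ext_of_valuationSubring OC fun c hc => hval ⟨c, hc⟩⟩

end Expansions

end Paper

namespace Paper

open Filter

section Solv

theorem Solv.map {m : ℕ} {S M N : Type*} [CommRing S] [CommRing M] [CommRing N] {f : S →+* M}
    {fs : Finset (MvPolynomial (Fin m) S)} {g : MvPolynomial (Fin m) S} (h : Solv f fs g)
    (r : M →+* N) (hr : Function.Injective r) : Solv (r.comp f) fs g := by
  obtain ⟨x, hx, hg⟩ := h
  have e : ∀ p, MvPolynomial.eval₂ (r.comp f) (fun j => r (x j)) p = r (MvPolynomial.eval₂ f x p) :=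
    fun p => (MvPolynomial.eval₂_comp_left r f x p).symm
  refine ⟨fun j => r (x j), fun p hp => by rw [e, hx p hp, map_zero], ?_⟩
  rw [e, Ne, map_eq_zero_iff r hr]
  exact hg

theorem solv_map {m : ℕ} {R S M : Type*} [CommRing R] [CommRing S] [CommRing M] (r : R →+* S)
    (f : S →+* M) [DecidableEq (MvPolynomial (Fin m) S)] (fs : Finset (MvPolynomial (Fin m) R))
    (g : MvPolynomial (Fin m) R) :
    Solv f (fs.image (MvPolynomial.map r)) (MvPolynomial.map r g) ↔ Solv (f.comp r) fs g := by
  simp only [Solv, Finset.forall_mem_image, MvPolynomial.eval₂_map]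

theorem solv_of_germDiag {m : ℕ} {I : Type*} {U : Ultrafilter I} {S K : Type*} [CommRing S]
    [Field K] {f : S →+* K} {fs : Finset (MvPolynomial (Fin m) S)} {g : MvPolynomial (Fin m) S}
    (h : Solv ((germDiag U K).comp f) fs g) : Solv f fs g := by
  obtain ⟨x, hx, hg⟩ := h
  obtain ⟨a, ha⟩ := exists_germ_rep x
  obtain rfl : x = fun j => (a j : Germ (U : Filter I) K) := funext ha
  simp only [eval₂_germDiag, coe_eq_zero_iff, Ne] at hx hg
  rw [← Ultrafilter.eventually_not] at hg
  obtain ⟨i, hi, hi'⟩ := (((Filter.eventually_all_finset fs).2 hx).and hg).exists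
  exact ⟨fun j => a j i, hi, hi'⟩

end Solv

section Limit

/-- A sequence of fields has a direct limit. -/
theorem exists_field_limit (E : ℕ → Type u) [∀ n, Field (E n)] (ι : ∀ n, E n →+* E (n + 1)) :
    ∃ (Ω : Type u) (_ : Field Ω) (φ : ∀ n, E n →+* Ω), (∀ n x, φ (n + 1) (ι n x) = φ n x) ∧
      ∀ y, ∃ n x, φ n x = y := by
  let t : ∀ m n, m ≤ n → E m →+* E n := fun m n h =>
    Nat.leRecOn h (fun {k} (g : E m →+* E k) => (ι k).comp g) (RingHom.id _)
  have t0 : ∀ m, t m m le_rfl = RingHom.id _ := fun m => Nat.leRecOn_self _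
  have t1 : ∀ m n (h : m ≤ n), t m (n + 1) (h.trans n.le_succ) = (ι n).comp (t m n h) :=
    fun m n h => Nat.leRecOn_succ h _
  have : DirectedSystem E fun m n h => t m n h :=
    { map_self := fun m x => by rw [t0]; rfl
      map_map := by
        intro k j i hij hjk x
        induction hjk with
        | refl => rw [t0]; rfl
        | step h ih => rw [t1 _ _ h, t1 _ _ (hij.trans h), RingHom.comp_apply, ih]; rfl }
  refine ⟨DirectLimit E t, inferInstance, fun n =>
    { toFun := fun x => ⟦⟨n, x⟩⟧
      map_one' := (DirectLimit.one_def n).symm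
      map_zero' := (DirectLimit.zero_def n).symm
      map_mul' := fun x y => (DirectLimit.mul_def n x y).symm
      map_add' := fun x y => (DirectLimit.add_def n x y).symm }, fun n x => ?_, fun y => ?_⟩
  · have : ι n x = t n (n + 1) n.le_succ x := by
      rw [t1 n n le_rfl, t0]
      rfl
    change (⟦⟨n + 1, ι n x⟩⟧ : DirectLimit E t) = ⟦⟨n, x⟩⟧
    rw [this]
    exact (DirectLimit.eq_of_le (f := t) ⟨n, x⟩ (n + 1) n.le_succ).symm
  · obtain ⟨n, x, rfl⟩ := DirectLimit.exists_eq_mk (f := t) y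
    exact ⟨n, x, rfl⟩

end Limit

/-- A field with a henselian valuation ring, a coarsening of the latter, and a subfield of the
coarsening. -/
structure Stage where
  K : Type u
  S : Type u
  [fieldK : Field K]
  [fieldS : Field S]
  O : ValuationSubring K
  Op : ValuationSubring K
  le : O ≤ Op
  nh : NewtonHensel O
  σ : S →+* Op
  sep : SepHom ((IsLocalRing.residue Op).comp σ)

attribute [instance] Stage.fieldK Stage.fieldS

/-- An extension of stages in which the subfield of the second one lifts the residue field of
the coarsening of the first one. -/
structure Step (s s' : Stage.{u}) where
  ι : s.K →+* s'.K
  mem_iff : ∀ x, ι x ∈ s'.O ↔ x ∈ s.O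
  mem_iff' : ∀ x, ι x ∈ s'.Op ↔ x ∈ s.Op
  κ : s.S →+* s'.S
  comm : ∀ c, (s'.σ (κ c) : s'.K) = ι (s.σ c)
  surj : ∀ a ∈ s.Op, ∃ c : s'.S, s'.Op.valuation (s'.σ c - ι a) < 1
  descent : ∀ {m : ℕ} (fs : Finset (MvPolynomial (Fin m) s.S)) (g : MvPolynomial (Fin m) s.S),
    Solv (((IsLocalRing.residue s'.Op).comp s'.σ).comp κ) fs g →
      Solv ((IsLocalRing.residue s.Op).comp s.σ) fs g

/-- Finite parts of the residue field can be lifted. -/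
theorem exists_residue_lift {K S : Type*} [Field K] [Field S] (O : ValuationSubring K)
    (hO : NewtonHensel O) (σ : S →+* O) (hσ : SepHom ((IsLocalRing.residue O).comp σ))
    (Z : Finset (MvPolynomial (IsLocalRing.ResidueField O) S))
    (s : Finset (IsLocalRing.ResidueField O))
    (hZ : ∀ p ∈ Z, MvPolynomial.eval₂ ((IsLocalRing.residue O).comp σ) id p = 0) :
    ∃ x : IsLocalRing.ResidueField O → K,
      (∀ p ∈ Z, MvPolynomial.eval₂ (O.subtype.comp σ) x p = 0) ∧
      ∀ a ∈ s, ∃ h : x a ∈ O, IsLocalRing.residue O ⟨x a, h⟩ = a := by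
  classical
  let ν : Valuation (IsLocalRing.ResidueField O) (WithZero (Multiplicative ℤ)) := 1
  have hν : ∀ a, ν a < 1 ↔ a = 0 := fun a => Valuation.one_apply_lt_one_iff
  have H : ∀ a c : O, ν (IsLocalRing.residue O a) < ν (IsLocalRing.residue O c) →
      O.valuation (O.subtype a) < O.valuation (O.subtype c) := by
    intro a c h
    have hc : IsLocalRing.residue O c ≠ 0 := by
      intro h0
      rw [h0, map_zero] at h
      exact not_lt_zero h
    have ha : IsLocalRing.residue O a = 0 := by
      by_contra h0
      rw [show ν (IsLocalRing.residue O a) = 1 from Valuation.one_apply_of_ne_zero h0,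
        show ν (IsLocalRing.residue O c) = 1 from Valuation.one_apply_of_ne_zero hc] at h
      exact lt_irrefl _ h
    rw [IsLocalRing.residue_eq_zero_iff] at ha
    replace ha := (ValuationSubring.valuation_lt_one_iff O _).1 ha
    have hc1 : O.valuation c = 1 := by
      rw [Ne, IsLocalRing.residue_eq_zero_iff] at hc
      exact le_antisymm ((O.valuation_le_one_iff _).2 c.2)
        (not_lt.1 fun h => hc ((ValuationSubring.valuation_lt_one_iff O _).2 h))
    change O.valuation (a : K) < O.valuation (c : K)
    rw [hc1]
    exact ha
  have D : ∀ y γ : IsLocalRing.ResidueField O, γ ≠ 0 →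
      ∃ a, ν (y - IsLocalRing.residue O a) < ν γ := by
    intro y γ hγ
    obtain ⟨a, rfl⟩ := IsLocalRing.residue_surjective y
    refine ⟨a, ?_⟩
    rw [sub_self, map_zero, zero_lt_iff, ν.ne_zero_iff]
    exact hγ
  obtain ⟨B, ψ, hB, hψ, hv⟩ := exists_subring_hom_of_newtonHensel ν (IsLocalRing.residue O)
    O.subtype O hO H D σ hσ (s ∪ Z.biUnion fun p => p.vars)
  choose hB1 hB2 using hψ
  let σ' : S →+* B := ((IsLocalRing.residue O).comp σ).codRestrict B hB1
  have hσ' : ψ.comp σ' = O.subtype.comp σ := RingHom.ext hB2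
  let x' : IsLocalRing.ResidueField O → B := fun a => if h : a ∈ B then ⟨a, h⟩ else 0
  have hx' : ∀ a ∈ B, (x' a : IsLocalRing.ResidueField O) = a := fun a h => by simp [x', h]
  refine ⟨fun a => ψ (x' a), fun p hp => ?_, fun a ha => ?_⟩
  · have h1 : MvPolynomial.eval₂ (O.subtype.comp σ) (fun a => ψ (x' a)) p =
        ψ (MvPolynomial.eval₂ σ' x' p) := by
      rw [← hσ']
      exact (MvPolynomial.eval₂_comp_left ψ σ' x' p).symm
    have h2 : B.subtype (MvPolynomial.eval₂ σ' x' p) =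
        MvPolynomial.eval₂ ((IsLocalRing.residue O).comp σ) (fun a => (x' a).1) p :=
      MvPolynomial.eval₂_comp_left B.subtype σ' x' p
    have h3 : MvPolynomial.eval₂ ((IsLocalRing.residue O).comp σ) (fun a => (x' a).1) p =
        MvPolynomial.eval₂ ((IsLocalRing.residue O).comp σ) id p := by
      refine MvPolynomial.eval₂Hom_congr' (f₁ := (IsLocalRing.residue O).comp σ) rfl
        (fun a ha _ => hx' a (hB a ?_)) rfl
      exact Finset.mem_union_right _ (Finset.mem_biUnion.2 ⟨p, hp, ha⟩)
    rw [h3, hZ p hp] at h2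
    rw [h1, show MvPolynomial.eval₂ σ' x' p = 0 from Subtype.ext h2, map_zero]
  · have haB : a ∈ B := hB a (Finset.mem_union_left _ ha)
    have hx : x' a = ⟨a, haB⟩ := Subtype.ext (hx' a haB)
    have key : ∀ c : O, IsLocalRing.residue O c = a → a ≠ 0 →
        O.valuation (ψ (x' a) - c) < 1 := by
      intro c hc h0
      have h1 := hv ⟨a, haB⟩ (Finset.mem_union_left _ ha) c (by
        simp only [hc, sub_self, map_zero]
        rw [zero_lt_iff, ν.ne_zero_iff]
        exact h0)
      rw [hx]
      refine lt_of_lt_of_le h1 ?_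
      exact (O.valuation_le_one_iff _).2 c.2
    obtain ⟨c, hc, h1⟩ : ∃ c : O, IsLocalRing.residue O c = a ∧
        O.valuation (ψ (x' a) - c) < 1 := by
      rcases eq_or_ne a 0 with h0 | h0
      · refine ⟨0, (map_zero _).trans h0.symm, ?_⟩
        rw [show x' a = 0 from Subtype.ext ((hx' a haB).trans h0)]
        simp
      · obtain ⟨c, hc⟩ := IsLocalRing.residue_surjective a
        exact ⟨c, hc, key c hc h0⟩
    have hm : ψ (x' a) ∈ O := by
      have := add_mem ((O.valuation_le_one_iff _).1 h1.le) c.2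
      rwa [sub_add_cancel] at this
    refine ⟨hm, Eq.trans ?_ hc⟩
    rw [← sub_eq_zero, ← map_sub, IsLocalRing.residue_eq_zero_iff]
    exact (ValuationSubring.valuation_lt_one_iff O _).2 h1

theorem exists_step (s : Stage.{u}) : ∃ s' : Stage.{u}, Nonempty (Step s s') := by
  obtain ⟨I, U, ζ, h1, h2⟩ := exists_hom_germ ((IsLocalRing.residue s.Op).comp s.σ)
    (s.Op.subtype.comp s.σ)
    (fun a => {y | ∃ h : y ∈ s.Op, IsLocalRing.residue s.Op ⟨y, h⟩ = a})
    (exists_residue_lift s.Op (s.nh.of_le s.le) s.σ s.sep)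
  have hm : ∀ a, ζ a ∈ germSubring U s.Op := by
    intro a
    obtain ⟨x, hx, h⟩ := h2 a
    rw [hx, coe_mem_germSubring]
    exact h.mono fun i hi => hi.1
  let σ' : IsLocalRing.ResidueField s.Op →+* germSubring U s.Op :=
    ζ.codRestrict (germSubring U s.Op).toSubring hm
  have hres : (germResidue U s.Op).comp ((IsLocalRing.residue (germSubring U s.Op)).comp σ') =
      germDiag U _ := by
    ext a
    obtain ⟨x, hx, h⟩ := h2 a
    have e : σ' a = ⟨(x : Germ (U : Filter I) s.K), hx ▸ hm a⟩ := Subtype.ext hx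
    simp only [RingHom.comp_apply]
    rw [e, germResidue_coe]
    refine Germ.coe_eq.2 (h.mono fun i hi => ?_)
    obtain ⟨h3, h4⟩ := hi
    simp only [resFun_of_mem _ h3]
    exact h4
  refine ⟨{ K := Germ (U : Filter I) s.K, S := IsLocalRing.ResidueField s.Op,
            O := germSubring U s.O, Op := germSubring U s.Op, le := germSubring_mono s.le,
            nh := s.nh.germ, σ := σ',
            sep := SepHom.of_comp (g := germResidue U s.Op) (by rw [hres]; exact sepHom_germDiag) },
    ⟨{ ι := germDiag U s.K, mem_iff := fun x => germDiag_mem_germSubring _,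
       mem_iff' := fun x => germDiag_mem_germSubring _, 
       κ := (IsLocalRing.residue s.Op).comp s.σ,
       comm := fun c => h1 c
       surj := ?_, descent := ?_ }⟩⟩
  · intro a ha
    refine ⟨IsLocalRing.residue s.Op ⟨a, ha⟩, ?_⟩
    obtain ⟨x, hx, h⟩ := h2 (IsLocalRing.residue s.Op ⟨a, ha⟩)
    change (germSubring U s.Op).valuation (ζ _ - germDiag U s.K a) < 1
    rw [hx, germDiag_apply]
    refine (germ_valuation_lt_one_iff s.Op (a := x - fun _ => a)).2 (h.mono fun i hi => ?_)
    obtain ⟨h3, h4⟩ := hi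
    rw [← resFun_of_mem _ h3, ← resFun_of_mem _ ha, resFun_eq_iff _ h3 ha] at h4
    exact h4
  · intro m fs g h
    have h3 := h.map (germResidue U s.Op) (RingHom.injective _)
    refine solv_of_germDiag (U := U) ?_
    rw [← hres]
    exact h3

end Paper

namespace Paper

open Filter

section Extension

variable {K Ω : Type*} [Field K] [Field Ω] {f : K →+* Ω} {O : ValuationSubring K}
  {O' : ValuationSubring Ω}

theorem valuation_le_iff_div_mem (O : ValuationSubring K) {x y : K} (hy : y ≠ 0) :
    O.valuation x ≤ O.valuation y ↔ x / y ∈ O := by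
  rw [← O.valuation_le_one_iff, map_div₀,
    div_le_one₀ (zero_lt_iff.2 ((Valuation.ne_zero_iff _).2 hy))]

theorem valuation_map_le_iff (h : ∀ x, f x ∈ O' ↔ x ∈ O) {x y : K} :
    O'.valuation (f x) ≤ O'.valuation (f y) ↔ O.valuation x ≤ O.valuation y := by
  rcases eq_or_ne y 0 with rfl | hy
  · simp
  · rw [valuation_le_iff_div_mem O hy, valuation_le_iff_div_mem O' ((map_ne_zero f).2 hy),
      ← map_div₀, h]

theorem valuation_map_lt_iff (h : ∀ x, f x ∈ O' ↔ x ∈ O) {x y : K} :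
    O'.valuation (f x) < O'.valuation (f y) ↔ O.valuation x < O.valuation y := by
  rw [← not_le, ← not_le, valuation_map_le_iff h]

theorem valuation_map_lt_one_iff (h : ∀ x, f x ∈ O' ↔ x ∈ O) {x : K} :
    O'.valuation (f x) < 1 ↔ O.valuation x < 1 := by
  have := valuation_map_lt_iff h (x := x) (y := 1)
  rwa [map_one, map_one, map_one] at this

end Extension

section Chain

variable {E : ℕ → Type u} [∀ n, Field (E n)] {ι : ∀ n, E n →+* E (n + 1)} {Ω : Type u} [Field Ω]
  {φ : ∀ n, E n →+* Ω} (hφ : ∀ n x, φ (n + 1) (ι n x) = φ n x) (hs : ∀ y, ∃ n x, φ n x = y)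
  (O : ∀ n, ValuationSubring (E n)) (hO : ∀ n x, ι n x ∈ O (n + 1) ↔ x ∈ O n)

include hφ

include hO in
theorem exists_later_rep {n N : ℕ} (h : n ≤ N) (x : E n) :
    ∃ x' : E N, φ N x' = φ n x ∧ (x' ∈ O N ↔ x ∈ O n) := by
  induction N, h using Nat.le_induction with
  | base => exact ⟨x, rfl, Iff.rfl⟩
  | succ N h ih =>
    obtain ⟨x', h1, h2⟩ := ih
    exact ⟨ι N x', (hφ N x').trans h1, (hO N x').trans h2⟩

include hO in
theorem mem_iff_of_limit_eq {n m : ℕ} {x : E n} {y : E m} (h : φ n x = φ m y) :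
    x ∈ O n ↔ y ∈ O m := by
  obtain ⟨x', h1, h2⟩ := exists_later_rep hφ O hO (le_max_left n m) x
  obtain ⟨y', h3, h4⟩ := exists_later_rep hφ O hO (le_max_right n m) y
  rw [← h2, ← h4, (φ _).injective ((h1.trans h).trans h3.symm)]

include hs in
/-- Finitely many elements of a limit are defined at a common stage. -/
theorem exists_common_rep {J : Type*} [Finite J] (y : J → Ω) : ∃ N, ∀ j, ∃ x : E N, φ N x = y j :=
    by
  have := Fintype.ofFinite J
  choose n x hx using fun j => hs (y j)
  refine ⟨Finset.univ.sup n, fun j => ?_⟩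
  obtain ⟨x', h, -⟩ := exists_later_rep hφ (fun _ => ⊤) (by simp)
    (Finset.le_sup (Finset.mem_univ j)) (x j)
  exact ⟨x', h.trans (hx j)⟩

include hs hO in
theorem exists_limit_valuationSubring :
    ∃ O' : ValuationSubring Ω, ∀ n x, φ n x ∈ O' ↔ x ∈ O n := by
  have key : ∀ n x, (∃ m z, z ∈ O m ∧ φ m z = φ n x) ↔ x ∈ O n := fun n x =>
    ⟨fun ⟨m, z, hz, h⟩ => (mem_iff_of_limit_eq hφ O hO h).1 hz, fun h => ⟨n, x, h, rfl⟩⟩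
  have two : ∀ a b : Ω, ∃ n x y, φ n x = a ∧ φ n y = b := by
    intro a b
    obtain ⟨N, h⟩ := exists_common_rep hφ hs ![a, b]
    obtain ⟨x, hx⟩ := h 0
    obtain ⟨y, hy⟩ := h 1
    exact ⟨N, x, y, hx, hy⟩
  refine ⟨{ carrier := {y | ∃ m z, z ∈ O m ∧ φ m z = y}
            mul_mem' := ?_, one_mem' := ⟨0, 1, one_mem _, map_one _⟩, add_mem' := ?_
            zero_mem' := ⟨0, 0, zero_mem _, map_zero _⟩, neg_mem' := ?_
            mem_or_inv_mem' := ?_ }, key⟩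
  · intro a b ha hb
    obtain ⟨n, x, y, rfl, rfl⟩ := two a b
    exact ⟨n, x * y, mul_mem ((key n x).1 ha) ((key n y).1 hb), map_mul _ _ _⟩
  · intro a b ha hb
    obtain ⟨n, x, y, rfl, rfl⟩ := two a b
    exact ⟨n, x + y, add_mem ((key n x).1 ha) ((key n y).1 hb), map_add _ _ _⟩
  · rintro _ ⟨n, x, hx, rfl⟩
    exact ⟨n, -x, neg_mem hx, map_neg _ _⟩
  · intro y
    obtain ⟨n, x, rfl⟩ := hs y
    rcases (O n).mem_or_inv_mem x with h | h
    · exact Or.inl ⟨n, x, h, rfl⟩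
    · exact Or.inr ⟨n, x⁻¹, h, map_inv₀ _ _⟩

include hs in
theorem newtonHensel_limit {O' : ValuationSubring Ω} (hO' : ∀ n x, φ n x ∈ O' ↔ x ∈ O n)
    (hN : ∀ n, NewtonHensel (O n)) : NewtonHensel O' := by
  intro d g hd h1 hg
  obtain ⟨N, h⟩ := exists_common_rep hφ hs (fun i : Fin (d + 1) => g i)
  choose a ha using h
  let b : ℕ → E N := fun i => if h : i < d + 1 then a ⟨i, h⟩ else 0
  have hb : ∀ i, i ≤ d → φ N (b i) = g i := fun i hi => by
    simp only [b, dif_pos (Nat.lt_succ_of_le hi), ha]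
  obtain ⟨z, hz, hzv⟩ := hN N d b hd (fun h0 => h1 (by rw [← hb 1 hd, h0, map_zero]))
    (fun i h2 hi => by
      rw [← valuation_map_lt_iff (hO' N), map_mul, map_pow, map_pow, hb i hi, hb 0 (by omega),
        hb 1 hd]
      exact hg i h2 hi)
  refine ⟨φ N z, ?_, ?_⟩
  · rw [← map_zero (φ N), ← hz, map_sum]
    refine Finset.sum_congr rfl fun i hi => ?_
    rw [map_mul, map_pow, hb i (Nat.lt_succ_iff.1 (Finset.mem_range.1 hi))]
  · rw [← hb 1 hd, ← hb 0 (by omega), ← map_mul, valuation_map_le_iff (hO' N)]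
    exact hzv

end Chain

/-- A field of representatives for a coarsening of a henselian valuation ring inherits a
henselian valuation. -/
theorem newtonHensel_comap {E : Type*} [Field E] {O Op : ValuationSubring E} (h : O ≤ Op)
    (hO : NewtonHensel O) (F : Subfield E) (hF : ∀ y : F, (y : E) ∈ Op)
    (hr : ∀ y ∈ Op, ∃ x : F, Op.valuation (y - x) < 1) : NewtonHensel (O.comap F.subtype) := by
  have hm : ∀ x, F.subtype x ∈ O ↔ x ∈ O.comap F.subtype := fun x => Iff.rfl
  have hF0 : ∀ y : F, Op.valuation (y : E) < 1 → y = 0 := by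
    intro y hy
    by_contra h0
    have h1 := (Op.valuation_le_one_iff _).2 (hF y⁻¹)
    have h2 : Op.valuation ((y⁻¹ : F) : E) * Op.valuation (y : E) < 1 :=
      mul_lt_one_of_nonneg_of_lt_one_right h1 zero_le hy
    rw [← map_mul, ← Subfield.coe_mul, inv_mul_cancel₀ h0] at h2
    simp at h2
  intro d g hd h1 hg
  obtain ⟨z, hz, hzv⟩ := hO d (fun i => (g i : E)) hd (by simpa using h1) (fun i h2 hi => by
    have := (valuation_map_lt_iff hm).2 (hg i h2 hi)
    simpa using this)
  have hz1 : z * (g 1 : E) ∈ Op := by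
    have := valuation_le_of_le h hzv
    exact (Op.valuation_le_one_iff _).1 (this.trans ((Op.valuation_le_one_iff _).2 (hF (g 0))))
  have hz2 : z ∈ Op := by
    have := mul_mem hz1 (hF (g 1)⁻¹)
    rwa [mul_assoc, ← Subfield.coe_mul, mul_inv_cancel₀ h1, Subfield.coe_one, mul_one] at this
  obtain ⟨x, hx⟩ := hr z hz2
  refine ⟨x, ?_, ?_⟩
  · apply hF0
    have e : ((∑ i ∈ Finset.range (d + 1), g i * x ^ i : F) : E) =
        ∑ i ∈ Finset.range (d + 1), (g i : E) * ((x : E) ^ i - z ^ i) := by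
      have : ((∑ i ∈ Finset.range (d + 1), g i * x ^ i : F) : E) =
          ∑ i ∈ Finset.range (d + 1), (g i : E) * (x : E) ^ i := by simp
      rw [this, ← sub_zero (∑ i ∈ _, (g i : E) * (x : E) ^ i), ← hz, ← Finset.sum_sub_distrib]
      exact Finset.sum_congr rfl fun i _ => by ring
    rw [e]
    refine Valuation.map_sum_lt _ one_ne_zero fun i _ => ?_
    obtain ⟨c, hc, hce⟩ : ∃ c ∈ Op, (x : E) ^ i - z ^ i = c * (z - x) := by
      refine ⟨-∑ k ∈ Finset.range i, (x : E) ^ k * z ^ (i - 1 - k), neg_mem (sum_mem fun k _ =>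
        mul_mem (pow_mem (hF x) _) (pow_mem hz2 _)), ?_⟩
      rw [← (Commute.all (x : E) z).geom_sum₂_mul i]
      ring
    rw [hce, ← mul_assoc, map_mul]
    exact mul_lt_one_of_nonneg_of_lt_one_right
      ((Op.valuation_le_one_iff _).2 (mul_mem (hF _) hc)) zero_le hx
  · rw [← valuation_map_le_iff hm]
    change O.valuation ((x * g 1 : F) : E) ≤ O.valuation (g 0 : E)
    rcases eq_or_ne (g 0) 0 with h0 | h0
    · have hz0 : z = 0 := by
        rw [h0] at hzv
        simpa [h1] using hzv
      have : x = 0 := hF0 x (by rw [hz0, zero_sub, Valuation.map_neg] at hx; exact hx)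
      simp [this]
    · by_contra! hlt
      have h3 : O.valuation ((x * g 1 : F) : E) = O.valuation ((x * g 1 : E) - z * g 1) := by
        rw [Valuation.map_sub_eq_of_lt_left]
        · simp
        · simpa using hzv.trans_lt hlt
      have h4 : Op.valuation ((x * g 1 : E) - z * g 1) < 1 := by
        rw [← sub_mul, map_mul, Valuation.map_sub_swap]
        exact mul_lt_one_of_lt_of_le hx ((Op.valuation_le_one_iff _).2 (hF _))
      have h5 := valuation_le_of_le h (hlt.le.trans h3.le)
      exact h0 (hF0 _ (h5.trans_lt h4))

end Paper

namespace Paper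

open Filter

theorem eval₂_congr_hom {m : ℕ} {R S M : Type*} [CommRing R] [CommRing S] [CommRing M] {f : R →+* S}
    {j : S →+* M} {f' : R →+* M} (h : ∀ c, j (f c) = f' c) (x : Fin m → S)
    (p : MvPolynomial (Fin m) R) :
    j (MvPolynomial.eval₂ f x p) = MvPolynomial.eval₂ f' (fun i => j (x i)) p := by
  rw [← show j.comp f = f' from RingHom.ext h]
  exact MvPolynomial.eval₂_comp_left j f x p

/-- Descending the solvability of systems along an injective homomorphism hitting a solution. -/
theorem Solv.of_injective {m : ℕ} {R S M : Type*} [CommRing R] [CommRing S] [CommRing M]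
    {f : R →+* S} {j : S →+* M} {f' : R →+* M} (h : ∀ c, j (f c) = f' c)
    (hj : Function.Injective j) {fs : Finset (MvPolynomial (Fin m) R)}
    {g : MvPolynomial (Fin m) R} (x : Fin m → S)
    (h1 : ∀ p ∈ fs, MvPolynomial.eval₂ f' (fun i => j (x i)) p = 0)
    (h2 : MvPolynomial.eval₂ f' (fun i => j (x i)) g ≠ 0) : Solv f fs g := by
  refine ⟨x, fun p hp => hj ?_, fun h0 => h2 ?_⟩
  · rw [eval₂_congr_hom h, map_zero, h1 p hp]
  · rw [← eval₂_congr_hom h, h0, map_zero]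

/-- Under `(R4_m)`, systems of polynomial equations in `m` variables descend to the residue field
along a sequence of stages. -/
theorem solv_residue_of_steps {m : ℕ} (hR4 : R4N.{u} m) (s : ℕ → Stage.{u})
    (st : ∀ n, Step (s n) (s (n + 1))) (π : (s 0).S) (hπ0 : π ≠ 0)
    (hπ : (s 0).O.valuation ((s 0).σ π : (s 0).K) < 1)
    (fs : Finset (MvPolynomial (Fin m) (s 0).S)) (g : MvPolynomial (Fin m) (s 0).S)
    (h : Solv ((s 0).Op.subtype.comp (s 0).σ) fs g) :
    Solv ((IsLocalRing.residue (s 0).Op).comp (s 0).σ) fs g := by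
  classical
  obtain ⟨Ω, _, φ, hφ, hs⟩ :=
    @exists_field_limit (fun n => (s n).K) (fun n => (s n).fieldK) (fun n => (st n).ι)
  obtain ⟨O', hO'⟩ := exists_limit_valuationSubring hφ hs (fun n => (s n).O)
    (fun n => (st n).mem_iff)
  obtain ⟨Op', hOp'⟩ := exists_limit_valuationSubring hφ hs (fun n => (s n).Op)
    (fun n => (st n).mem_iff')
  have hle' : O' ≤ Op' := by
    intro y hy
    obtain ⟨n, x, rfl⟩ := hs y
    exact (hOp' n x).2 ((s n).le ((hO' n x).1 hy))
  have hN : NewtonHensel O' := newtonHensel_limit hφ hs _ hO' fun n => (s n).nh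
  let τ : ∀ n, (s n).S →+* Ω := fun n => (φ n).comp ((s n).Op.subtype.comp (s n).σ)
  have hτ : ∀ n c, τ (n + 1) ((st n).κ c) = τ n c := fun n c => by
    change φ (n + 1) ((s (n + 1)).σ ((st n).κ c)) = φ n ((s n).σ c)
    rw [(st n).comm, hφ]
  have later : ∀ {n N : ℕ}, n ≤ N → ∀ c, ∃ c', τ N c' = τ n c := fun {n N} h c => by
    obtain ⟨c', h, -⟩ := exists_later_rep hτ (fun _ => ⊤) (by simp) h c
    exact ⟨c', h⟩
  have two : ∀ a b : Ω, (∃ n c, τ n c = a) → (∃ n c, τ n c = b) →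
      ∃ n c d, τ n c = a ∧ τ n d = b := by
    rintro a b ⟨n, c, rfl⟩ ⟨k, d, rfl⟩
    obtain ⟨c', hc⟩ := later (le_max_left n k) c
    obtain ⟨d', hd⟩ := later (le_max_right n k) d
    exact ⟨_, c', d', hc, hd⟩
  let F : Subfield Ω :=
    { carrier := {y | ∃ n c, τ n c = y}
      mul_mem' := fun {a b} ha hb => by
        obtain ⟨n, c, d, rfl, rfl⟩ := two a b ha hb
        exact ⟨n, c * d, map_mul _ _ _⟩
      one_mem' := ⟨0, 1, map_one _⟩
      add_mem' := fun {a b} ha hb => by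
        obtain ⟨n, c, d, rfl, rfl⟩ := two a b ha hb
        exact ⟨n, c + d, map_add _ _ _⟩
      zero_mem' := ⟨0, 0, map_zero _⟩
      neg_mem' := by
        rintro _ ⟨n, c, rfl⟩
        exact ⟨n, -c, map_neg _ _⟩
      inv_mem' := by
        rintro _ ⟨n, c, rfl⟩
        exact ⟨n, c⁻¹, map_inv₀ _ _⟩ }
  have hF : ∀ y : F, (y : Ω) ∈ Op' := by
    rintro ⟨_, n, c, rfl⟩
    exact (hOp' n _).2 ((s n).σ c).2
  have hr : ∀ y ∈ Op', ∃ x : F, Op'.valuation (y - x) < 1 := by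
    intro y hy
    obtain ⟨n, a, rfl⟩ := hs y
    obtain ⟨c, hc⟩ := (st n).surj a ((hOp' n a).1 hy)
    refine ⟨⟨τ (n + 1) c, n + 1, c, rfl⟩, ?_⟩
    rw [Valuation.map_sub_swap, ← hφ]
    change Op'.valuation (φ (n + 1) ((s (n + 1)).σ c) - _) < 1
    rw [← map_sub, valuation_map_lt_one_iff (hOp' (n + 1))]
    exact hc
  have hlarge : LargeField.{u} F := by
    refine largeField_of_newtonHensel (O'.comap F.subtype) (newtonHensel_comap hle' hN F hF hr)
      ⟨⟨τ 0 π, 0, π, rfl⟩, ?_, ?_⟩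
    · intro h0
      exact (map_ne_zero (τ 0)).2 hπ0 (congrArg Subtype.val h0)
    · rw [← valuation_map_lt_one_iff (f := F.subtype) (O' := O') (fun x => Iff.rfl)]
      exact (valuation_map_lt_one_iff (hO' 0)).2 hπ
  have htriv : ∀ y : F, (y : Ω) ≠ 0 → Op'.valuation y = 1 := by
    intro y hy
    refine le_antisymm ((Op'.valuation_le_one_iff _).2 (hF y)) ?_
    have h1 := (Op'.valuation_le_one_iff _).2 (hF y⁻¹)
    rw [Subfield.coe_inv, map_inv₀] at h1
    exact (inv_le_one₀ (zero_lt_iff.2 ((Valuation.ne_zero_iff _).2 hy))).1 h1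
  have hR : ∀ (fs : Finset (MvPolynomial (Fin m) F)) (g : MvPolynomial (Fin m) F),
      Solv F.subtype fs g → Solv (RingHom.id F) fs g := by
    intro fs g h
    obtain ⟨ψ, hψ, hψ'⟩ := exists_sentence_solv fs g
    exact (hψ' F (RingHom.id F)).1 (hR4 Ω _ Op'.valuation F hlarge htriv
      (fun y hy => hr y ((Op'.valuation_le_one_iff _).1 hy)) ψ hψ ((hψ' Ω F.subtype).2 h))
  let τF : (s 0).S →+* F := (τ 0).codRestrict F fun c => ⟨0, c, rfl⟩
  have h1 : Solv τF fs g := by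
    have h2 := h.map (φ 0) (RingHom.injective _)
    have h3 := hR (fs.image (MvPolynomial.map τF)) (MvPolynomial.map τF g)
      ((solv_map τF F.subtype fs g).2 h2)
    exact (solv_map τF (RingHom.id F) fs g).1 h3
  obtain ⟨x, hx, hg⟩ := h1
  obtain ⟨N, hc⟩ : ∃ N, ∀ j, ∃ c : (s N).S, τ N c = x j := by
    choose n c hc using fun j => (x j).2
    refine ⟨Finset.univ.sup n, fun j => ?_⟩
    obtain ⟨c', h⟩ := later (Finset.le_sup (Finset.mem_univ j)) (c j)
    exact ⟨c', h.trans (hc j)⟩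
  choose c hc using hc
  obtain ⟨κ, hκ, hdesc⟩ : ∃ κ : (s 0).S →+* (s N).S, (∀ c, τ N (κ c) = τ 0 c) ∧
      ∀ (fs : Finset (MvPolynomial (Fin m) (s 0).S)) (g : MvPolynomial (Fin m) (s 0).S),
        Solv (((IsLocalRing.residue (s N).Op).comp (s N).σ).comp κ) fs g →
          Solv ((IsLocalRing.residue (s 0).Op).comp (s 0).σ) fs g := by
    clear hc c hx hg h
    induction N with
    | zero => exact ⟨RingHom.id _, fun _ => rfl, fun fs g h => h⟩
    | succ N ih =>
      obtain ⟨κ, hκ, hdesc⟩ := ih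
      refine ⟨(st N).κ.comp κ, fun c => (hτ N _).trans (hκ c), fun fs g h => hdesc fs g ?_⟩
      rw [← solv_map]
      apply (st N).descent
      rw [solv_map]
      exact h
  refine hdesc fs g (Solv.map ?_ _ (RingHom.injective _))
  have hτF : ∀ y : Fin m → F, ∀ p, F.subtype (MvPolynomial.eval₂ τF y p) =
      MvPolynomial.eval₂ (τ 0) (fun i => (y i : Ω)) p := fun y p =>
        eval₂_congr_hom (fun _ => rfl) y p
  refine Solv.of_injective hκ (RingHom.injective _) c (fun p hp => ?_) ?_
  · simp only [hc]
    rw [← hτF, hx p hp, map_zero]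
  · simp only [hc]
    rw [← hτF, Ne, map_eq_zero]
    exact hg

/-- Under `(R4_m)`, systems of polynomial equations in `m` variables descend from a henselian
valued field to the residue field of a coarsening of its valuation. -/
theorem solv_residue_of_R4 {m : ℕ} (hR4 : R4N.{u} m) {K C : Type u} [Field K] [Field C]
    (O Op : ValuationSubring K) (hle : O ≤ Op) (hO : NewtonHensel O) (σ : C →+* Op)
    (hσ : SepHom ((IsLocalRing.residue Op).comp σ)) (π : C) (hπ0 : π ≠ 0)
    (hπ : O.valuation (σ π : K) < 1) (fs : Finset (MvPolynomial (Fin m) C))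
    (g : MvPolynomial (Fin m) C) (h : Solv (Op.subtype.comp σ) fs g) :
    Solv ((IsLocalRing.residue Op).comp σ) fs g := by
  choose next hnext using exists_step.{u}
  let s : ℕ → Stage.{u} := fun n => Nat.rec
    { K := K, S := C, O := O, Op := Op, le := hle, nh := hO, σ := σ, sep := hσ }
    (fun _ t => next t) n
  exact solv_residue_of_steps hR4 s (fun n => (hnext (s n)).some) π hπ0 hπ fs g h

end Paper

namespace Paper

open Filter
open LaurentSeries

section Parity

variable {κ : Type*} [Field κ]

theorem exists_laurentV_eq_exp {r : κ⸨X⸩} (hr : r ≠ 0) : ∃ k : ℤ, laurentV κ r = WithZero.exp k :=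
  ⟨_, (WithZero.exp_log ((Valuation.ne_zero_iff _).2 hr)).symm⟩

theorem exp_le_one_iff' {k : ℤ} : (WithZero.exp k : WithZero (Multiplicative ℤ)) ≤ 1 ↔ k ≤ 0 := by
  rw [← WithZero.exp_zero, WithZero.exp_le_exp]

theorem laurentV_le_one_of_sq_add {r s : κ⸨X⸩}
    (h : laurentV κ (r ^ 2 + HahnSeries.single (1 : ℤ) 1 * s ^ 2) ≤ 1) :
    laurentV κ r ≤ 1 ∧ laurentV κ s ≤ 1 := by
  rcases eq_or_ne r 0 with rfl | hr
  · refine ⟨by simp, ?_⟩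
    rcases eq_or_ne s 0 with rfl | hs
    · simp
    obtain ⟨l, hl⟩ := exists_laurentV_eq_exp hs
    rw [zero_pow two_ne_zero, zero_add, map_mul, map_pow, laurentV_single, hl, ← WithZero.exp_nsmul,
      ← WithZero.exp_add, exp_le_one_iff'] at h
    rw [hl, exp_le_one_iff']
    simp only [nsmul_eq_mul] at h
    push_cast at h
    omega
  · obtain ⟨k, hk⟩ := exists_laurentV_eq_exp hr
    have h1 : laurentV κ (r ^ 2) = WithZero.exp (2 * k) := by
      rw [map_pow, hk, ← WithZero.exp_nsmul]
      simp
    rcases eq_or_ne s 0 with rfl | hs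
    · refine ⟨?_, by simp⟩
      rw [zero_pow two_ne_zero, mul_zero, add_zero, h1, exp_le_one_iff'] at h
      rw [hk, exp_le_one_iff']
      omega
    obtain ⟨l, hl⟩ := exists_laurentV_eq_exp hs
    have h2 : laurentV κ (HahnSeries.single (1 : ℤ) 1 * s ^ 2) = WithZero.exp (2 * l - 1) := by
      rw [map_mul, map_pow, laurentV_single, hl, ← WithZero.exp_nsmul, ← WithZero.exp_add]
      congr 1
      simp
      ring
    rw [Valuation.map_add_of_distinct_val, h1, h2, max_le_iff, exp_le_one_iff', exp_le_one_iff']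
      at h
    · rw [hk, hl, exp_le_one_iff', exp_le_one_iff']
      omega
    · rw [h1, h2, Ne, WithZero.exp_inj]
      omega

theorem laurentV_le_one_of_artinSchreier {z c : κ⸨X⸩}
    (h : z ^ 2 + z = HahnSeries.single (1 : ℤ) 1 * c ^ 2) : laurentV κ c ≤ 1 := by
  rcases eq_or_ne c 0 with rfl | hc
  · simp
  obtain ⟨l, hl⟩ := exists_laurentV_eq_exp hc
  rw [hl, exp_le_one_iff']
  have h1 : laurentV κ (z ^ 2 + z) = WithZero.exp (2 * l - 1) := by
    rw [h, map_mul, map_pow, laurentV_single, hl, ← WithZero.exp_nsmul, ← WithZero.exp_add]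
    congr 1
    simp
    ring
  rcases eq_or_ne z 0 with rfl | hz
  · rw [zero_pow two_ne_zero, add_zero, map_zero] at h1
    exact absurd h1.symm WithZero.exp_ne_zero
  obtain ⟨k, hk⟩ := exists_laurentV_eq_exp hz
  have h2 : laurentV κ (z ^ 2) = WithZero.exp (2 * k) := by
    rw [map_pow, hk, ← WithZero.exp_nsmul]
    simp
  rcases le_or_gt k 0 with hk0 | hk0
  · have h3 : laurentV κ (z ^ 2 + z) ≤ 1 := by
      refine Valuation.map_add_le _ ?_ ?_
      · rw [h2, exp_le_one_iff']
        omega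
      · rw [hk, exp_le_one_iff']
        omega
    rw [h1, exp_le_one_iff'] at h3
    omega
  · rw [Valuation.map_add_eq_of_lt_left, h2, WithZero.exp_inj] at h1
    · omega
    · rw [h2, hk, WithZero.exp_lt_exp]
      omega

end Parity

/-- Under `(R4_{n+1})`, tuples in a henselian field can be transferred to the field of Laurent
series over its residue field, preserving finitely many polynomial conditions. -/
theorem exists_laurent_agreement {n : ℕ} (hR4 : R4N.{u} (n + 1)) {K C : Type u} [Field K] [Field C]
    {κ : Type u} [Field κ] (O : ValuationSubring K) (hO : NewtonHensel O) (E : LaurentExpansion O κ)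
    (σ : C →+* E.plus) (hσ : SepHom (E.α.comp σ)) (π : C) (hπ0 : π ≠ 0)
    (hπ1 : O.valuation (σ π : K) < 1) (hπ : ∀ y, y ∉ O → ((σ π : K) * y)⁻¹ ∈ O)
    (hαπ : E.α (σ π) = HahnSeries.single 1 1) (Z : Finset (MvPolynomial (Fin n) C))
    (x : Fin n → K) :
    ∃ y : Fin n → κ⸨X⸩, ∀ p ∈ Z,
      (MvPolynomial.eval₂ (E.plus.subtype.comp σ) x p = 0 ↔
        MvPolynomial.eval₂ (E.α.comp σ) y p = 0) ∧
      (MvPolynomial.eval₂ (E.plus.subtype.comp σ) x p ∈ O ↔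
        laurentV κ (MvPolynomial.eval₂ (E.α.comp σ) y p) ≤ 1) := by
  classical
  set f : C →+* K := E.plus.subtype.comp σ with hf
  set h : C →+* κ⸨X⸩ := E.α.comp σ with hh
  have hfπ : f π = σ π := rfl
  have hhπ : h π = HahnSeries.single 1 1 := hαπ
  have hπO : f π ∈ O := (O.valuation_le_one_iff _).1 hπ1.le
  have pairs : ∀ s : Finset (MvPolynomial (Fin n) C × MvPolynomial (Fin n) C),
      (∀ q ∈ s, MvPolynomial.eval₂ f x q.2 ≠ 0 ∧
        MvPolynomial.eval₂ f x q.1 / MvPolynomial.eval₂ f x q.2 ∈ O) →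
      ∃ a b : MvPolynomial (Fin n) C, MvPolynomial.eval₂ f x b ≠ 0 ∧
        MvPolynomial.eval₂ f x a / MvPolynomial.eval₂ f x b ∈ O ∧
        ∀ y : Fin n → κ⸨X⸩, MvPolynomial.eval₂ h y b ≠ 0 →
          laurentV κ (MvPolynomial.eval₂ h y a / MvPolynomial.eval₂ h y b) ≤ 1 →
          ∀ q ∈ s, MvPolynomial.eval₂ h y q.2 ≠ 0 ∧
            laurentV κ (MvPolynomial.eval₂ h y q.1 / MvPolynomial.eval₂ h y q.2) ≤ 1 := by
    intro s
    induction s using Finset.induction_on with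
    | empty => exact fun _ => ⟨0, 1, by simp, by simp, by simp⟩
    | insert q s hq ih =>
      intro hs
      obtain ⟨a, b, hb, hab, hy⟩ := ih fun q hq => hs q (Finset.mem_insert_of_mem hq)
      obtain ⟨hq2, hq1⟩ := hs q (Finset.mem_insert_self _ _)
      refine ⟨a ^ 2 * q.2 ^ 2 + MvPolynomial.C π * q.1 ^ 2 * b ^ 2, b ^ 2 * q.2 ^ 2, ?_, ?_, ?_⟩
      · simp only [MvPolynomial.eval₂_mul, MvPolynomial.eval₂_pow]
        exact mul_ne_zero (pow_ne_zero _ hb) (pow_ne_zero _ hq2)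
      · simp only [MvPolynomial.eval₂_mul, MvPolynomial.eval₂_pow, MvPolynomial.eval₂_add,
          MvPolynomial.eval₂_C]
        convert! add_mem (pow_mem hab 2) (mul_mem hπO (pow_mem hq1 2)) using 1
        field_simp
      · intro y h0 hle q' hq'
        simp only [MvPolynomial.eval₂_mul, MvPolynomial.eval₂_pow, MvPolynomial.eval₂_add,
          MvPolynomial.eval₂_C] at h0 hle
        have hb0 : MvPolynomial.eval₂ h y b ≠ 0 := fun h1 => h0 (by simp [h1])
        have hq0 : MvPolynomial.eval₂ h y q.2 ≠ 0 := fun h1 => h0 (by simp [h1])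
        have e : (MvPolynomial.eval₂ h y a ^ 2 * MvPolynomial.eval₂ h y q.2 ^ 2 +
            h π * MvPolynomial.eval₂ h y q.1 ^ 2 * MvPolynomial.eval₂ h y b ^ 2) /
            (MvPolynomial.eval₂ h y b ^ 2 * MvPolynomial.eval₂ h y q.2 ^ 2) =
            (MvPolynomial.eval₂ h y a / MvPolynomial.eval₂ h y b) ^ 2 +
            HahnSeries.single (1 : ℤ) 1 *
              (MvPolynomial.eval₂ h y q.1 / MvPolynomial.eval₂ h y q.2) ^ 2 := by
          rw [← hhπ]
          field_simp
        rw [e] at hle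
        obtain ⟨h1, h2⟩ := laurentV_le_one_of_sq_add hle
        rcases Finset.mem_insert.1 hq' with rfl | hq'
        · exact ⟨hq0, h2⟩
        · exact hy y hb0 h1 q' hq'
  have hOinv : ∀ p : MvPolynomial (Fin n) C, MvPolynomial.eval₂ f x p ∉ O →
      MvPolynomial.eval₂ f x (MvPolynomial.C π * p) ≠ 0 := by
    intro p hp
    simp only [MvPolynomial.eval₂_mul, MvPolynomial.eval₂_C]
    exact mul_ne_zero ((map_ne_zero f).2 hπ0) fun h0 => hp (h0 ▸ zero_mem O)
  obtain ⟨a, b, hb, hab, hy⟩ := pairs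
    (((Z.filter fun p => MvPolynomial.eval₂ f x p ∈ O).image fun p => (p, 1)) ∪
      ((Z.filter fun p => MvPolynomial.eval₂ f x p ∉ O).image fun p => (1, MvPolynomial.C π * p)))
    (by
      intro q hq
      rcases Finset.mem_union.1 hq with hq | hq
      · obtain ⟨p, hp, rfl⟩ := Finset.mem_image.1 hq
        simpa using (Finset.mem_filter.1 hp).2
      · obtain ⟨p, hp, rfl⟩ := Finset.mem_image.1 hq
        refine ⟨hOinv p (Finset.mem_filter.1 hp).2, ?_⟩
        simp only [MvPolynomial.eval₂_mul, MvPolynomial.eval₂_C, MvPolynomial.eval₂_one, one_div]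
        exact hπ _ (Finset.mem_filter.1 hp).2)
  obtain ⟨z, hz⟩ : ∃ z : K, z ^ 2 + z =
      f π * (MvPolynomial.eval₂ f x a / MvPolynomial.eval₂ f x b) ^ 2 := by
    set c := MvPolynomial.eval₂ f x a / MvPolynomial.eval₂ f x b
    obtain ⟨z, hz, -⟩ := hO 2 (fun i => if i = 0 then -(f π * c ^ 2) else 1) (by norm_num) (by simp)
      (fun i h2 h3 => by
        obtain rfl : i = 2 := by omega
        have h4 := (O.valuation_le_one_iff _).2 (pow_mem hab 2)
        simp only [OfNat.ofNat_ne_zero, if_false, if_true, one_mul, one_ne_zero, one_pow, map_one,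
          Nat.add_one_sub_one, pow_one, Valuation.map_neg, map_mul]
        exact mul_lt_one_of_lt_of_le hπ1 h4)
    refine ⟨z, ?_⟩
    simp [Finset.sum_range_succ] at hz
    linear_combination hz
  let ρ : MvPolynomial (Fin n) C →+* MvPolynomial (Fin (n + 1)) C :=
    (MvPolynomial.rename Fin.castSucc).toRingHom
  have hρ : ∀ {M : Type u} [Field M] (f : C →+* M) (y : Fin (n + 1) → M) p,
      MvPolynomial.eval₂ f y (ρ p) = MvPolynomial.eval₂ f (fun i => y i.castSucc) p :=
    fun f y p => MvPolynomial.eval₂_rename f Fin.castSucc y p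
  let fs : Finset (MvPolynomial (Fin (n + 1)) C) :=
    insert (ρ b ^ 2 * (MvPolynomial.X (Fin.last n) ^ 2 + MvPolynomial.X (Fin.last n)) -
      MvPolynomial.C π * ρ a ^ 2) ((Z.filter fun p => MvPolynomial.eval₂ f x p = 0).image ρ)
  let g : MvPolynomial (Fin (n + 1)) C :=
    ρ b * ∏ p ∈ Z.filter fun p => MvPolynomial.eval₂ f x p ≠ 0, ρ p
  have hprod : ∀ {M : Type u} [Field M] (f : C →+* M) (y : Fin (n + 1) → M)
      (s : Finset (MvPolynomial (Fin n) C)), MvPolynomial.eval₂ f y (∏ p ∈ s, ρ p) =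
        ∏ p ∈ s, MvPolynomial.eval₂ f (fun i => y i.castSucc) p := by
    intro M _ f y s
    rw [← MvPolynomial.coe_eval₂Hom, map_prod]
    exact Finset.prod_congr rfl fun p _ => hρ f y p
  have hsolv : Solv f fs g := by
    refine ⟨Fin.snoc (α := fun _ => K) x z, ?_, ?_⟩
    · intro p hp
      rcases Finset.mem_insert.1 hp with rfl | hp
      · simp only [MvPolynomial.eval₂_sub, MvPolynomial.eval₂_mul, MvPolynomial.eval₂_pow,
          MvPolynomial.eval₂_add, MvPolynomial.eval₂_X, MvPolynomial.eval₂_C, hρ, Fin.snoc_castSucc,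
          Fin.snoc_last, hz]
        field_simp
        ring
      · obtain ⟨q, hq, rfl⟩ := Finset.mem_image.1 hp
        simp only [hρ, Fin.snoc_castSucc]
        exact (Finset.mem_filter.1 hq).2
    · simp only [g, MvPolynomial.eval₂_mul, hρ, hprod, Fin.snoc_castSucc]
      exact mul_ne_zero hb (Finset.prod_ne_zero_iff.2 fun p hp => (Finset.mem_filter.1 hp).2)
  have hsep : SepHom ((IsLocalRing.residue E.plus).comp σ) :=
    SepHom.of_comp (g := E.resHom) hσ
  have h1 := (solv_residue_of_R4 hR4 O E.plus E.le hO σ hsep π hπ0 hπ1 fs g hsolv).map E.resHom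
    (RingHom.injective _)
  obtain ⟨y, hy1, hy2⟩ : Solv h fs g := h1
  simp only [g, MvPolynomial.eval₂_mul, hρ, hprod, mul_ne_zero_iff, Finset.prod_ne_zero_iff] at hy2
  have hy3 := hy1 _ (Finset.mem_insert_self _ _)
  simp only [MvPolynomial.eval₂_sub, MvPolynomial.eval₂_mul, MvPolynomial.eval₂_pow,
    MvPolynomial.eval₂_add, MvPolynomial.eval₂_X, MvPolynomial.eval₂_C, hρ] at hy3
  have hc := laurentV_le_one_of_artinSchreier (z := y (Fin.last n))
    (c := MvPolynomial.eval₂ h (fun i => y i.castSucc) a /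
      MvPolynomial.eval₂ h (fun i => y i.castSucc) b) (by
      rw [← hhπ, div_pow, ← mul_div_assoc, eq_div_iff (pow_ne_zero 2 hy2.1)]
      linear_combination hy3)
  have hq := hy (fun i => y i.castSucc) hy2.1 hc
  refine ⟨fun i => y i.castSucc, fun p hp => ⟨⟨fun h0 => ?_, fun h0 => ?_⟩, ⟨fun h0 => ?_,
    fun h0 => ?_⟩⟩⟩
  · rw [← hρ]
    exact hy1 _ (Finset.mem_insert_of_mem (Finset.mem_image_of_mem _
      (Finset.mem_filter.2 ⟨hp, h0⟩)))
  · by_contra h3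
    exact hy2.2 p (Finset.mem_filter.2 ⟨hp, h3⟩) h0
  · have := (hq _ (Finset.mem_union_left _ (Finset.mem_image_of_mem _
      (Finset.mem_filter.2 ⟨hp, h0⟩)))).2
    simpa using this
  · by_contra h3
    obtain ⟨h4, h5⟩ := hq _ (Finset.mem_union_right _ (Finset.mem_image_of_mem _
      (Finset.mem_filter.2 ⟨hp, h3⟩)))
    simp only [MvPolynomial.eval₂_mul, MvPolynomial.eval₂_C, MvPolynomial.eval₂_one, hhπ] at h4 h5
    obtain ⟨k, hk⟩ := exists_laurentV_eq_exp (right_ne_zero_of_mul h4)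
    rw [hk, exp_le_one_iff'] at h0
    rw [map_div₀, map_one, map_mul, laurentV_single, hk, ← WithZero.exp_add, one_div,
      ← WithZero.exp_neg, exp_le_one_iff'] at h5
    omega

end Paper

namespace Paper

open LaurentSeries

section ResidueField

variable {κ : Type u} [Field κ]

/-- The residue field of a subfield of a field of Laurent series. -/
noncomputable def laurentResField (M : Subfield κ⸨X⸩) : Subfield κ where
  carrier := {c | ∃ q : PowerSeries κ, HahnSeries.ofPowerSeries ℤ κ q ∈ M ∧
    PowerSeries.constantCoeff q = c}
  mul_mem' := by
    rintro _ _ ⟨q, hq, rfl⟩ ⟨r, hr, rfl⟩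
    exact ⟨q * r, by rw [map_mul]; exact mul_mem hq hr, map_mul _ _ _⟩
  add_mem' := by
    rintro _ _ ⟨q, hq, rfl⟩ ⟨r, hr, rfl⟩
    exact ⟨q + r, by rw [map_add]; exact add_mem hq hr, map_add _ _ _⟩
  one_mem' := ⟨1, by rw [map_one]; exact one_mem M, map_one _⟩
  zero_mem' := ⟨0, by rw [map_zero]; exact zero_mem M, map_zero _⟩
  neg_mem' := by
    rintro _ ⟨q, hq, rfl⟩
    exact ⟨-q, by rw [map_neg]; exact neg_mem hq, map_neg _ _⟩
  inv_mem' := by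
    rintro _ ⟨q, hq, rfl⟩
    rcases eq_or_ne (PowerSeries.constantCoeff q) 0 with h | h
    · exact ⟨0, by rw [map_zero]; exact zero_mem M, by rw [h, inv_zero, map_zero]⟩
    · refine ⟨q⁻¹, ?_, PowerSeries.constantCoeff_inv q⟩
      have h1 : HahnSeries.ofPowerSeries ℤ κ q⁻¹ = (HahnSeries.ofPowerSeries ℤ κ q)⁻¹ := by
        rw [eq_comm, inv_eq_iff_eq_inv, eq_comm, inv_eq_iff_eq_inv]
        refine eq_inv_of_mul_eq_one_left ?_
        rw [← map_mul, PowerSeries.inv_mul_cancel _ h, map_one]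
      rw [h1]
      exact inv_mem hq

variable {k : Type u} [Field k] [Algebra k κ] [Algebra k⸨X⸩ κ⸨X⸩]

theorem algebraicIndependent_ofPowerSeries
    (h : algebraMap k⸨X⸩ κ⸨X⸩ = laurentMap (algebraMap k κ)) {ι : Type*} (q : ι → PowerSeries κ)
    (hq : AlgebraicIndependent k fun i => PowerSeries.constantCoeff (q i)) :
    AlgebraicIndependent k⸨X⸩ fun i => HahnSeries.ofPowerSeries ℤ κ (q i) := by
  classical
  rw [algebraicIndependent_iff]
  intro p hp
  by_contra hp0
  have hy : (fun j : p.support => p.coeff j) ≠ 0 := by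
    obtain ⟨j, hj⟩ := MvPolynomial.support_nonempty.2 hp0
    exact fun h0 => (MvPolynomial.mem_support_iff.1 hj) (congrFun h0 ⟨j, hj⟩)
  obtain ⟨m, r, hr, ⟨j₀, hj₀⟩⟩ := exists_ofPowerSeries_of_ne_zero _ hy
  have hsum : ∑ j : p.support, PowerSeries.map (algebraMap k κ) (r j) *
      ∏ i ∈ (j : ι →₀ ℕ).support, q i ^ (j : ι →₀ ℕ) i = 0 := by
    refine HahnSeries.ofPowerSeries_injective (Γ := ℤ) ?_
    rw [map_zero]
    refine (mul_eq_zero.1 ?_).resolve_left (single_ne_zero' m)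
    rw [← hp, MvPolynomial.aeval_def, MvPolynomial.eval₂_eq, ← Finset.sum_coe_sort p.support,
      map_sum,
      Finset.mul_sum]
    refine Finset.sum_congr rfl fun j _ => ?_
    rw [hr j, h, map_mul, map_mul, laurentMap_single, laurentMap_ofPowerSeries,
      map_one (algebraMap k κ), map_prod,
      mul_assoc]
    simp only [map_pow]
  have h2 := congrArg PowerSeries.constantCoeff hsum
  let P : MvPolynomial ι k := ∑ j : p.support,
    MvPolynomial.monomial (j : ι →₀ ℕ) (PowerSeries.constantCoeff (r j))
  have hP : P = 0 := by
    refine hq.eq_zero_of_aeval_eq_zero P ?_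
    rw [map_zero, map_sum] at h2
    rw [map_sum, ← h2]
    refine Finset.sum_congr rfl fun j _ => ?_
    rw [MvPolynomial.aeval_monomial, map_mul, map_prod, Finsupp.prod,
      ← PowerSeries.coeff_zero_eq_constantCoeff_apply (PowerSeries.map _ _), PowerSeries.coeff_map,
      PowerSeries.coeff_zero_eq_constantCoeff_apply]
    simp only [map_pow]
  refine hj₀ ?_
  have h3 := congrArg (MvPolynomial.coeff (j₀ : ι →₀ ℕ)) hP
  rw [MvPolynomial.coeff_sum, Finset.sum_eq_single j₀ (fun j _ hj => by
    rw [MvPolynomial.coeff_monomial, if_neg fun h => hj (Subtype.ext h)]) (by simp),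
    MvPolynomial.coeff_monomial, if_pos rfl] at h3
  simpa using h3

theorem natCast_le_trdeg_of_isAlgebraic {D : Type u} [Field D] [Algebra k D] [Algebra D κ]
    [IsScalarTower k D κ] {d : ℕ} (b : Fin d → κ) (hb : AlgebraicIndependent k b)
    (hD : ∀ i, IsAlgebraic D (b i)) : (d : Cardinal.{u}) ≤ Algebra.trdeg k D := by
  let B : IntermediateField D κ := algebraicClosure D κ
  let b' : Fin d → B := fun i => ⟨b i, mem_algebraicClosure_iff.2 (hD i)⟩
  have : IsScalarTower k B κ := IsScalarTower.of_algebraMap_eq fun _ => rfl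
  have hb' : AlgebraicIndependent k b' := by
    refine AlgebraicIndependent.of_comp (IsScalarTower.toAlgHom k B κ) ?_
    exact hb
  have h1 : (d : Cardinal.{u}) ≤ Algebra.trdeg k B := by
    have := hb'.lift_cardinalMk_le_trdeg
    simpa using this
  have h2 : FaithfulSMul D B := (faithfulSMul_iff_algebraMap_injective D B).2
    (algebraMap D B).injective
  rwa [← trdeg_add_eq k D (A := B), trdeg_eq_zero (R := D) (A := B), add_zero] at h1

/-- The Abhyankar inequality for subfields of fields of Laurent series. -/
theorem card_le_of_algebraicIndependent_residue
    (h : algebraMap k⸨X⸩ κ⸨X⸩ = laurentMap (algebraMap k κ)) {m : ℕ} (x : Fin m → κ⸨X⸩)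
    (A : Subfield κ) (hA : ∀ a ∈ A, IsAlgebraic
      (laurentResField (IntermediateField.adjoin k⸨X⸩ (Set.range x)).toSubfield) a)
    {d : ℕ} (b : Fin d → κ) (hbA : ∀ i, b i ∈ A) (hb : AlgebraicIndependent k b) : d ≤ m := by
  classical
  set M := IntermediateField.adjoin k⸨X⸩ (Set.range x) with hM
  set D := laurentResField M.toSubfield with hD
  have hkD : ∀ c : k, algebraMap k κ c ∈ D := fun c => by
    refine ⟨PowerSeries.map (algebraMap k κ) (PowerSeries.C c), ?_, by simp⟩
    rw [← laurentMap_ofPowerSeries, ← h]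
    exact M.algebraMap_mem _
  let D' : IntermediateField k κ := { D with algebraMap_mem' := hkD }
  have h1 : (d : Cardinal.{u}) ≤ Algebra.trdeg k D' :=
    natCast_le_trdeg_of_isAlgebraic b hb fun i => hA _ (hbA i)
  obtain ⟨s, hs⟩ := exists_isTranscendenceBasis k D'
  rw [← hs.cardinalMk_eq_trdeg] at h1
  have h2 : ∀ i : s, ∃ q : PowerSeries κ, HahnSeries.ofPowerSeries ℤ κ q ∈ M.toSubfield ∧
    PowerSeries.constantCoeff q = (i : D') := fun i => i.1.2
  choose q hqM hq using h2
  have h3 : AlgebraicIndependent k fun i => PowerSeries.constantCoeff (q i) := by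
    have := hs.1.map' (f := IsScalarTower.toAlgHom k D' κ) Subtype.val_injective
    simp only [hq]
    exact this
  have h4 := algebraicIndependent_ofPowerSeries h q h3
  let y : s → M := fun i => ⟨_, hqM i⟩
  have h5 : AlgebraicIndependent k⸨X⸩ y := by
    refine AlgebraicIndependent.of_comp (IsScalarTower.toAlgHom k⸨X⸩ M κ⸨X⸩) ?_
    exact h4
  let t : Set M := Set.range fun i => (⟨x i, IntermediateField.subset_adjoin _ _ ⟨i, rfl⟩⟩ : M)
  have ht : IntermediateField.adjoin k⸨X⸩ t = ⊤ := by
    apply IntermediateField.lift_injective M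
    rw [IntermediateField.lift_adjoin, IntermediateField.lift_top]
    conv_rhs => rw [hM]
    congr 1
    ext z
    simp [t]
  have : Algebra.IsAlgebraic (Algebra.adjoin k⸨X⸩ t) M := by
    rw [← IntermediateField.isAlgebraic_adjoin_iff_top, ht, Algebra.isAlgebraic_iff_isIntegral]
    exact Algebra.isIntegral_of_surjective IntermediateField.topEquiv.surjective
  have h6 := (h5.cardinalMk_le_trdeg).trans (Algebra.IsAlgebraic.trdeg_le_cardinalMk k⸨X⸩ t)
  have h7 : Cardinal.mk t ≤ m := by
    have := Cardinal.mk_range_le_lift (f := fun i => (⟨x i, IntermediateField.subset_adjoin _ _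
      ⟨i, rfl⟩⟩ : M))
    simpa using this
  have h8 := (h1.trans h6).trans h7
  simpa using h8

end ResidueField

end Paper

namespace Paper

open LaurentSeries

theorem exists_polynomial_expansion {F : Type*} [Field F] (f : Polynomial F)
    (hf : f.natDegree ≠ 0) (h : Polynomial F) :
    ∃ R : Polynomial (Polynomial F), R.eval f = h ∧ ∀ i, (R.coeff i).natDegree < f.natDegree := by
  induction hd : h.natDegree using Nat.strong_induction_on generalizing h with
  | _ d ih =>
    by_cases hlt : h.natDegree < f.natDegree
    · refine ⟨Polynomial.C h, by simp, fun i => ?_⟩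
      rw [Polynomial.coeff_C]
      split_ifs
      · exact hlt
      · simpa using Nat.pos_of_ne_zero hf
    · have h0 : h ≠ 0 := by
        rintro rfl
        exact hlt (by simpa using Nat.pos_of_ne_zero hf)
      have h1 : (h / f).natDegree < d := by
        rw [← hd]
        rcases eq_or_ne (h / f) 0 with h2 | h2
        · rw [h2, Polynomial.natDegree_zero]
          omega
        · exact Polynomial.natDegree_lt_natDegree h2
            (Polynomial.degree_div_lt h0 (Polynomial.natDegree_pos_iff_degree_pos.1 (by omega)))
      obtain ⟨R, hR, hR'⟩ := ih _ h1 (h / f) rfl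
      refine ⟨Polynomial.C (h % f) + Polynomial.X * R, ?_, fun i => ?_⟩
      · rw [Polynomial.eval_add, Polynomial.eval_C, Polynomial.eval_mul, Polynomial.eval_X, hR,
          add_comm, EuclideanDomain.div_add_mod]
      · have h2 := Polynomial.natDegree_mod_lt h hf
        rcases i with _ | i
        · simpa using h2
        · simpa [Polynomial.coeff_C] using hR' i

section Ruled

variable {κ : Type u} [Field κ]

theorem single_zpow_mem {M : Subfield κ⸨X⸩} (ht : HahnSeries.single 1 1 ∈ M) (m : ℤ) :
    (HahnSeries.single m 1 : κ⸨X⸩) ∈ M := by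
  have h : ∀ n : ℕ, (HahnSeries.single (n : ℤ) 1 : κ⸨X⸩) ∈ M := fun n => by
    have := pow_mem ht n
    rwa [HahnSeries.single_pow, one_pow, nsmul_one] at this
  obtain ⟨n, rfl | rfl⟩ := m.eq_nat_or_neg
  · exact h n
  · have := inv_mem (h n)
    rwa [HahnSeries.inv_single, inv_one] at this

theorem constantCoeff_eq_aeval (M : Subfield κ⸨X⸩) (ht : HahnSeries.single 1 1 ∈ M) (x : κ⸨X⸩)
    (f : Polynomial M) (qf : PowerSeries κ)
    (hf : f.eval₂ M.subtype x = HahnSeries.ofPowerSeries ℤ κ qf)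
    (hτ : Transcendental (laurentResField M) (PowerSeries.constantCoeff qf))
    (hmin : ∀ (h : Polynomial M) (q : PowerSeries κ), h.natDegree < f.natDegree →
      h.eval₂ M.subtype x = HahnSeries.ofPowerSeries ℤ κ q →
      IsAlgebraic (laurentResField M) (PowerSeries.constantCoeff q))
    (h : Polynomial M) (q : PowerSeries κ)
    (hq : h.eval₂ M.subtype x = HahnSeries.ofPowerSeries ℤ κ q) :
    ∃ P : Polynomial (algebraicClosure (laurentResField M) κ),
      Polynomial.aeval (PowerSeries.constantCoeff qf) P = PowerSeries.constantCoeff q := by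
  classical
  have hfdeg : f.natDegree ≠ 0 := by
    intro h0
    rw [Polynomial.eq_C_of_natDegree_eq_zero h0, Polynomial.eval₂_C] at hf
    exact hτ (isAlgebraic_algebraMap (⟨_, qf, hf ▸ (f.coeff 0).2, rfl⟩ : laurentResField M))
  obtain ⟨R, rfl, hR⟩ := exists_polynomial_expansion f hfdeg h
  have hsum : (R.eval f).eval₂ M.subtype x =
      ∑ i ∈ R.support, (R.coeff i).eval₂ M.subtype x * HahnSeries.ofPowerSeries ℤ κ qf ^ i := by
    rw [Polynomial.eval_eq_sum, Polynomial.sum, Polynomial.eval₂_finsetSum]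
    refine Finset.sum_congr rfl fun i _ => ?_
    rw [Polynomial.eval₂_mul, Polynomial.eval₂_pow, hf]
  let y : R.support → κ⸨X⸩ := fun i => (R.coeff i).eval₂ M.subtype x
  rw [hsum, ← Finset.sum_coe_sort R.support] at hq
  by_cases hy : y = 0
  · refine ⟨0, ?_⟩
    have : q = 0 := by
      refine HahnSeries.ofPowerSeries_injective (Γ := ℤ) ?_
      rw [map_zero, ← hq]
      refine Finset.sum_eq_zero fun i _ => ?_
      rw [show (R.coeff i).eval₂ M.subtype x = 0 from congrFun hy i, zero_mul]
    rw [this, map_zero, map_zero]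
  obtain ⟨m, r, hr, j, hj⟩ := exists_ofPowerSeries_of_ne_zero y hy
  have hr' : ∀ i, IsAlgebraic (laurentResField M) (PowerSeries.constantCoeff (r i)) := fun i => by
    refine hmin (Polynomial.C ⟨HahnSeries.single (-m) 1, single_zpow_mem ht _⟩ * R.coeff i) _
      (lt_of_le_of_lt (Polynomial.natDegree_C_mul_le _ _) (hR i)) ?_
    rw [Polynomial.eval₂_mul, Polynomial.eval₂_C]
    change HahnSeries.single (-m) 1 * y i = _
    rw [hr, ← mul_assoc, HahnSeries.single_mul_single]
    simp
  let P : Polynomial (algebraicClosure (laurentResField M) κ) :=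
    ∑ i : R.support, Polynomial.monomial (i : ℕ)
      ⟨PowerSeries.constantCoeff (r i), mem_algebraicClosure_iff.2 (hr' i)⟩
  have hP : P ≠ 0 := by
    intro h0
    have h1 := congrArg (fun p => Polynomial.coeff p (j : ℕ)) h0
    simp only [P, Polynomial.finsetSum_coeff, Polynomial.coeff_monomial, Polynomial.coeff_zero]
      at h1
    rw [Finset.sum_eq_single j (fun i _ hi => if_neg fun h => hi (Subtype.ext h)) (by simp),
      if_pos rfl] at h1
    exact hj (congrArg Subtype.val h1)
  have hPτ : Polynomial.aeval (PowerSeries.constantCoeff qf) P ≠ 0 := fun h0 =>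
    hτ (IsAlgebraic.restrictScalars (laurentResField M) ⟨P, hP, h0⟩)
  let W : PowerSeries κ := ∑ i : R.support, r i * qf ^ (i : ℕ)
  have hW : PowerSeries.constantCoeff W = Polynomial.aeval (PowerSeries.constantCoeff qf) P := by
    simp only [W, P, map_sum, map_mul, map_pow, Polynomial.aeval_monomial]
    rfl
  have hqW : HahnSeries.ofPowerSeries ℤ κ q =
      HahnSeries.single m 1 * HahnSeries.ofPowerSeries ℤ κ W := by
    rw [← hq, map_sum, Finset.mul_sum]
    refine Finset.sum_congr rfl fun i _ => ?_
    rw [show (R.coeff i).eval₂ M.subtype x = y i from rfl, hr, map_mul, map_pow, mul_assoc]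
  rcases lt_trichotomy m 0 with hm | rfl | hm
  · have h1 : W = PowerSeries.X ^ (-m).toNat * q := by
      refine HahnSeries.ofPowerSeries_injective (Γ := ℤ) ?_
      rw [map_mul, hqW, HahnSeries.ofPowerSeries_X_pow, Int.toNat_of_nonneg (by omega), ← mul_assoc,
        HahnSeries.single_mul_single]
      simp
    rw [h1, map_mul, map_pow, PowerSeries.constantCoeff_X, zero_pow (by omega), zero_mul] at hW
    exact absurd hW.symm hPτ
  · refine ⟨P, ?_⟩
    rw [← hW]
    congr 1
    refine HahnSeries.ofPowerSeries_injective (Γ := ℤ) ?_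
    rw [hqW]
    simp
  · refine ⟨0, ?_⟩
    have h1 : q = PowerSeries.X ^ m.toNat * W := by
      refine HahnSeries.ofPowerSeries_injective (Γ := ℤ) ?_
      rw [map_mul, hqW, HahnSeries.ofPowerSeries_X_pow, Int.toNat_of_nonneg (by omega)]
    rw [h1, map_mul, map_pow, PowerSeries.constantCoeff_X, zero_pow (by omega), zero_mul, map_zero]

/-- The ruled residue theorem for simple extensions of subfields of Laurent series fields. -/
theorem exists_ruled_residue (M M' : Subfield κ⸨X⸩) (ht : HahnSeries.single 1 1 ∈ M) (x : κ⸨X⸩)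
    (hM' : ∀ y ∈ M', ∃ a b : Polynomial M, b.eval₂ M.subtype x ≠ 0 ∧
      y * b.eval₂ M.subtype x = a.eval₂ M.subtype x) :
    (∀ c ∈ laurentResField M', IsAlgebraic (laurentResField M) c) ∨
    ∃ τ, Transcendental (laurentResField M) τ ∧ ∀ c ∈ laurentResField M',
      ∃ P Q : Polynomial (algebraicClosure (laurentResField M) κ), Polynomial.aeval τ Q ≠ 0 ∧
        c * Polynomial.aeval τ Q = Polynomial.aeval τ P := by
  classical
  have key : ∀ c ∈ laurentResField M', ∃ (a b : Polynomial M) (qa qb : PowerSeries κ),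
      a.eval₂ M.subtype x = HahnSeries.ofPowerSeries ℤ κ qa ∧
      b.eval₂ M.subtype x = HahnSeries.ofPowerSeries ℤ κ qb ∧
      PowerSeries.constantCoeff qb ≠ 0 ∧
      c * PowerSeries.constantCoeff qb = PowerSeries.constantCoeff qa := by
    rintro _ ⟨q, hq, rfl⟩
    obtain ⟨a, b, hb, hab⟩ := hM' _ hq
    obtain ⟨m, r, hr, ⟨⟩, hj⟩ := exists_ofPowerSeries_of_ne_zero
      (fun _ : Unit => b.eval₂ M.subtype x) (fun h0 => hb (congrFun h0 ()))
    let s : M := ⟨HahnSeries.single (-m) 1, single_zpow_mem ht _⟩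
    have hs : M.subtype s * b.eval₂ M.subtype x = HahnSeries.ofPowerSeries ℤ κ (r ()) := by
      rw [hr (), ← mul_assoc]
      change HahnSeries.single (-m) 1 * HahnSeries.single m 1 * _ = _
      rw [HahnSeries.single_mul_single]
      simp
    refine ⟨Polynomial.C s * a, Polynomial.C s * b, q * r (), r (), ?_, ?_, hj, ?_⟩
    · rw [Polynomial.eval₂_mul, Polynomial.eval₂_C, ← hab, map_mul, ← hs]
      ring
    · rw [Polynomial.eval₂_mul, Polynomial.eval₂_C, hs]
    · rw [map_mul]
  by_cases hex : ∃ e : ℕ, ∃ (f : Polynomial M) (qf : PowerSeries κ), f.natDegree = e ∧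
      f.eval₂ M.subtype x = HahnSeries.ofPowerSeries ℤ κ qf ∧
      Transcendental (laurentResField M) (PowerSeries.constantCoeff qf)
  · right
    obtain ⟨f, qf, hfe, hf, hτ⟩ := Nat.find_spec hex
    have hmin : ∀ (h : Polynomial M) (q : PowerSeries κ), h.natDegree < f.natDegree →
      h.eval₂ M.subtype x = HahnSeries.ofPowerSeries ℤ κ q →
      IsAlgebraic (laurentResField M) (PowerSeries.constantCoeff q) := fun h q hlt hq => by
      by_contra h1
      exact Nat.find_min hex (hfe ▸ hlt) ⟨h, q, rfl, hq, h1⟩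
    refine ⟨_, hτ, fun c hc => ?_⟩
    obtain ⟨a, b, qa, qb, ha, hb, h1, h2⟩ := key c hc
    obtain ⟨P, hP⟩ := constantCoeff_eq_aeval M ht x f qf hf hτ hmin a qa ha
    obtain ⟨Q, hQ⟩ := constantCoeff_eq_aeval M ht x f qf hf hτ hmin b qb hb
    exact ⟨P, Q, hQ ▸ h1, by rw [hP, hQ, h2]⟩
  · left
    push Not at hex
    have h0 : ∀ (f : Polynomial M) (q : PowerSeries κ),
        f.eval₂ M.subtype x = HahnSeries.ofPowerSeries ℤ κ q →
        IsAlgebraic (laurentResField M) (PowerSeries.constantCoeff q) := fun f q hq => by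
      have := hex _ f q rfl hq
      simpa [Transcendental] using this
    intro c hc
    obtain ⟨a, b, qa, qb, ha, hb, h1, h2⟩ := key c hc
    rw [eq_div_of_mul_eq h1 h2, div_eq_mul_inv]
    exact (h0 _ _ ha).mul (h0 _ _ hb).inv

end Ruled

end Paper

namespace Paper

open LaurentSeries Filter

/-- A field extension whose finitely generated subrings admit compatible homomorphisms to another
extension of the base. -/
def LocallyEmbeds {k D N : Type*} [Field k] [Field D] [Field N] (f : k →+* D) (g : k →+* N) :
    Prop :=
  ∀ s : Finset D, ∃ (B : Subring D) (ψ : B →+* N), (∀ y ∈ s, y ∈ B) ∧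
    ∀ c, ∃ h : f c ∈ B, ψ ⟨f c, h⟩ = g c

theorem LocallyEmbeds.exists_hom_germ {k D N : Type u} [Field k] [Field D] [Field N]
    {f : k →+* D} {g : k →+* N} (h : LocallyEmbeds f g) :
    ∃ (I : Type u) (U : Ultrafilter I) (ζ : D →+* Germ (U : Filter I) N),
      ∀ c, ζ (f c) = germDiag U N (g c) := by
  classical
  obtain ⟨I, U, ζ, hζ, -⟩ := Paper.exists_hom_germ f g (fun _ => Set.univ) (fun Z s hZ => by
    obtain ⟨B, ψ, hB, hψ⟩ := h (Z.biUnion fun p => p.vars)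
    refine ⟨fun a => if h : a ∈ B then ψ ⟨a, h⟩ else 0, fun p hp => ?_, fun _ _ => trivial⟩
    have hvars : ∀ a ∈ p.vars, a ∈ B := fun a ha => hB a (Finset.mem_biUnion.2 ⟨p, hp, ha⟩)
    let fB : k →+* B := f.codRestrict B fun c => (hψ c).1
    have hfB : ψ.comp fB = g := RingHom.ext fun c => (hψ c).2
    let y : D → B := fun a => if h : a ∈ B then ⟨a, h⟩ else 0
    have h1 : MvPolynomial.eval₂ fB y p = 0 := by
      refine B.subtype_injective ?_
      rw [map_zero, MvPolynomial.eval₂_comp_left, ← hZ p hp]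
      refine MvPolynomial.eval₂Hom_congr' rfl (fun a ha _ => ?_) rfl
      simp [y, hvars a ha]
    have h2 := congrArg ψ h1
    rw [map_zero, MvPolynomial.eval₂_comp_left, hfB] at h2
    have h3 : (fun a => if h : a ∈ B then ψ ⟨a, h⟩ else 0) = ψ ∘ y := by
      funext a
      by_cases ha : a ∈ B <;> simp [y, ha]
    rw [h3]
    exact h2)
  exact ⟨I, U, ζ, hζ⟩

/-- A polynomial over a multivariate polynomial ring, as a multivariate polynomial in prescribed
variables. -/
noncomputable def renamePair (k : Type*) [CommRing k] {ι J : Type*} (e : ι → J) (l : J) :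
    Polynomial (MvPolynomial ι k) →+* MvPolynomial J k :=
  Polynomial.eval₂RingHom (MvPolynomial.rename e).toRingHom (MvPolynomial.X l)

theorem eval₂_renamePair {k M J : Type*} {d : ℕ} [Field k] [Field M] (e : Fin d → J) (l : J)
    (f : k →+* M)
    (y : J → M) (p : Polynomial (MvPolynomial (Fin d) k)) :
    MvPolynomial.eval₂ f y (renamePair k e l p) = evalPair f (y ∘ e) (y l) p := by
  have : (MvPolynomial.eval₂Hom f y).comp (renamePair k e l) = evalPair f (y ∘ e) (y l) := by
    refine Polynomial.ringHom_ext (fun a => ?_) ?_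
    · simp [renamePair, evalPair, MvPolynomial.eval₂_rename]
    · simp [renamePair, evalPair]
  exact RingHom.congr_fun this p

theorem LocallyEmbeds.of_solv {k D N : Type*} [Field k] [Field D] [Field N]
    {f : k →+* D} {g : k →+* N} (hf : SepHom f) {m : ℕ}
    (hm : ∀ (d : ℕ) (b : Fin d → D), Function.Injective (MvPolynomial.eval₂Hom f b) → d ≤ m)
    (hs : ∀ (fs : Finset (MvPolynomial (Fin (m + 1)) k)) q, Solv f fs q → Solv g fs q) :
    LocallyEmbeds f g := by
  classical
  intro s
  obtain ⟨Q⟩ := hf.exists_etalePresentation s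
  have hd := hm _ _ Q.injective
  let e : Fin Q.d → Fin (m + 1) := fun i => (Fin.castLE hd i).castSucc
  let ρ := renamePair k e (Fin.last m)
  have h1 : Solv f {ρ Q.P} (ρ Q.G) := by
    let y : Fin (m + 1) → D := Fin.snoc (α := fun _ => D) (fun i =>
      if h : (i : ℕ) < Q.d then Q.b ⟨i, h⟩ else 0) Q.θ
    have hy : y ∘ e = Q.b := by
      funext i
      have : y (Fin.castLE hd i).castSucc = _ := Fin.snoc_castSucc _ _ _
      exact this.trans (dif_pos i.2)
    have hy' : y (Fin.last m) = Q.θ := by simp [y]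
    refine ⟨y, fun p hp => ?_, ?_⟩
    · rw [Finset.mem_singleton.1 hp, eval₂_renamePair, hy, hy', Q.eval_P]
    · rw [eval₂_renamePair, hy, hy']
      exact Q.eval_G
  obtain ⟨y, hy1, hy2⟩ := hs _ _ h1
  have hy1 := hy1 _ (Finset.mem_singleton_self _)
  rw [eval₂_renamePair] at hy1 hy2
  obtain ⟨B, ψ, hB, hψ, -⟩ := Q.exists_hom g _ _ hy1 hy2
  exact ⟨B, ψ, hB, hψ⟩

theorem exists_subring_hom_of_injective {R κ N : Type*} [CommRing R] [Field κ] [Field N]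
    (Φ₀ : R →+* κ) (h₀ : Function.Injective Φ₀) (Φ : R →+* N) :
    ∃ (B : Subring κ) (ψ : B →+* N), (∀ r, ∃ h : Φ₀ r ∈ B, ψ ⟨_, h⟩ = Φ r) ∧
      ∀ y a b, Φ b ≠ 0 → y * Φ₀ b = Φ₀ a → y ∈ B := by
  classical
  let S : Submonoid R := (nonZeroDivisors N).comap Φ
  have hS : ∀ b, Φ b ≠ 0 → b ∈ S := fun b hb => mem_nonZeroDivisors_of_ne_zero hb
  have hS' : ∀ b ∈ S, Φ b ≠ 0 := fun b hb => nonZeroDivisors.ne_zero hb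
  have hS₀ : ∀ b : S, IsUnit (Φ₀ b) := fun b => by
    refine isUnit_iff_ne_zero.2 fun h => hS' b b.2 ?_
    rw [h₀ (h.trans (map_zero Φ₀).symm), map_zero]
  let φ₀ : Localization S →+* κ := IsLocalization.lift (M := S) hS₀
  let φ : Localization S →+* N := IsLocalization.lift (M := S) (g := Φ)
    fun b => isUnit_iff_ne_zero.2 (hS' b b.2)
  have hinj : Function.Injective φ₀ := by
    rw [injective_iff_map_eq_zero]
    intro z hz
    obtain ⟨⟨a, b⟩, hab⟩ := IsLocalization.surj S z
    have h1 := congrArg φ₀ hab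
    rw [map_mul, hz, zero_mul, IsLocalization.lift_eq] at h1
    have h2 : a = 0 := h₀ (h1.symm.trans (map_zero Φ₀).symm)
    rw [h2, map_zero] at hab
    exact (IsLocalization.map_units (Localization S) b).mul_left_eq_zero.1 hab
  let e : Localization S ≃+* φ₀.range := RingEquiv.ofBijective φ₀.rangeRestrict
    ⟨fun a b hab => hinj (congrArg Subtype.val hab), φ₀.rangeRestrict_surjective⟩
  refine ⟨φ₀.range, φ.comp e.symm.toRingHom, fun r => ?_, fun y a b hb hy => ?_⟩
  · have h1 : φ₀ (algebraMap R _ r) = Φ₀ r := IsLocalization.lift_eq _ _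
    refine ⟨⟨_, h1⟩, ?_⟩
    have h2 : e (algebraMap R _ r) = ⟨Φ₀ r, ⟨_, h1⟩⟩ := Subtype.ext h1
    rw [← h2]
    change φ (e.symm (e _)) = _
    rw [e.symm_apply_apply]
    exact IsLocalization.lift_eq _ _
  · refine ⟨IsLocalization.mk' _ a ⟨b, hS b hb⟩, ?_⟩
    rw [IsLocalization.lift_mk'_spec]
    rw [mul_comm]
    exact hy.symm

theorem LocallyEmbeds.of_ruled {k A E κ N : Type*} [Field k] [Field A] [Field E] [Field κ] [Field N]
    [Infinite N] {f : k →+* A} {f' : k →+* E} {g : k →+* N} (h : LocallyEmbeds f g)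
    (i : A →+* κ) (j : E →+* κ) (hij : ∀ c, j (f' c) = i (f c)) (τ : κ)
    (hτ : ∀ P : Polynomial A, P.eval₂ i τ = 0 → P = 0)
    (hE : ∀ c, ∃ P Q : Polynomial A, Q.eval₂ i τ ≠ 0 ∧ j c * Q.eval₂ i τ = P.eval₂ i τ) :
    LocallyEmbeds f' g := by
  classical
  intro s
  choose P Q hQ hPQ using hE
  obtain ⟨B, ψ, hB, hψ⟩ := h (s.biUnion fun c => insert ((Q c).leadingCoeff)⁻¹
    ((P c).coeffs ∪ (Q c).coeffs))
  have hlift : ∀ p : Polynomial A, (∀ a ∈ p.coeffs, a ∈ B) →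
      ∃ p' : Polynomial B, p'.map B.subtype = p := fun p hp =>
    ⟨p.toSubring B fun a ha => hp a ha, Polynomial.map_toSubring _ _ _⟩
  have hP' : ∀ c : s, ∃ p' : Polynomial B, p'.map B.subtype = P c := fun c =>
    hlift _ fun a ha => hB a (Finset.mem_biUnion.2 ⟨c, c.2, by simp [ha]⟩)
  have hQ' : ∀ c : s, ∃ p' : Polynomial B, p'.map B.subtype = Q c := fun c =>
    hlift _ fun a ha => hB a (Finset.mem_biUnion.2 ⟨c, c.2, by simp [ha]⟩)
  choose P' hP' using hP'
  choose Q' hQ' using hQ'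
  have hQψ : ∀ c : s, (Q' c).map ψ ≠ 0 := fun c h0 => by
    have h1 : (Q c).leadingCoeff ≠ 0 := by
      rw [Ne, Polynomial.leadingCoeff_eq_zero]
      intro h
      exact hQ c (by rw [h, Polynomial.eval₂_zero])
    have h2 : ((Q c).leadingCoeff)⁻¹ ∈ B :=
      hB _ (Finset.mem_biUnion.2 ⟨c, c.2, Finset.mem_insert_self _ _⟩)
    have h3 : (Q' c).coeff (Q c).natDegree * ⟨_, h2⟩ = 1 := by
      refine Subtype.ext ?_
      have : ((Q' c).coeff (Q c).natDegree : A) = (Q c).leadingCoeff := by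
        rw [Polynomial.leadingCoeff, ← hQ' c, Polynomial.coeff_map]
        rfl
      rw [Subring.coe_mul, this]
      exact mul_inv_cancel₀ h1
    have h4 := congrArg (fun p => Polynomial.coeff p (Q c).natDegree) h0
    simp only [Polynomial.coeff_map, Polynomial.coeff_zero] at h4
    have h5 := congrArg ψ h3
    rw [map_mul, h4, zero_mul, map_one] at h5
    exact zero_ne_one h5
  obtain ⟨τ', hτ'⟩ := Infinite.exists_notMem_finset (∏ c : s, (Q' c).map ψ).roots.toFinset
  have hτQ : ∀ c : s, (Q' c).eval₂ ψ τ' ≠ 0 := fun c h0 => by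
    apply hτ'
    rw [Multiset.mem_toFinset, Polynomial.mem_roots (Finset.prod_ne_zero_iff.2 fun c _ => hQψ c),
      Polynomial.IsRoot, Polynomial.eval_prod]
    exact Finset.prod_eq_zero (Finset.mem_univ c) (by rw [Polynomial.eval_map, h0])
  let Φ₀ : Polynomial B →+* κ := Polynomial.eval₂RingHom (i.comp B.subtype) τ
  have hΦ₀ : ∀ p, Φ₀ p = (p.map B.subtype).eval₂ i τ := fun p => by
    rw [Polynomial.eval₂_map]
    rfl
  have hinj : Function.Injective Φ₀ := by
    rw [injective_iff_map_eq_zero]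
    intro p hp
    rw [hΦ₀] at hp
    exact (Polynomial.map_eq_zero_iff B.subtype_injective).1 (hτ _ hp)
  obtain ⟨B', ψ', h1, h2⟩ := exists_subring_hom_of_injective Φ₀ hinj
    (Polynomial.eval₂RingHom ψ τ')
  refine ⟨B'.comap j, ψ'.comp (j.restrict (B'.comap j) B' fun y hy => hy), fun c hc => ?_,
    fun c => ?_⟩
  · refine h2 (j c) (P' ⟨c, hc⟩) (Q' ⟨c, hc⟩) (hτQ _) ?_
    rw [hΦ₀, hΦ₀, hP', hQ', hPQ]
  · obtain ⟨h3, h4⟩ := hψ c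
    obtain ⟨h5, h6⟩ := h1 (Polynomial.C ⟨f c, h3⟩)
    have h7 : Φ₀ (Polynomial.C ⟨f c, h3⟩) = j (f' c) := by
      rw [hij]
      exact Polynomial.eval₂_C _ _
    have h9 : j (f' c) ∈ B' := h7 ▸ h5
    refine ⟨h9, ?_⟩
    have h8 : ψ' ⟨j (f' c), h9⟩ = g c := by
      rw [← h4]
      have : Polynomial.eval₂RingHom ψ τ' (Polynomial.C ⟨f c, h3⟩) = ψ ⟨f c, h3⟩ :=
        Polynomial.eval₂_C _ _
      rw [← this, ← h6]
      congr 1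
      exact Subtype.ext h7.symm
    exact h8

end Paper

namespace Paper

open LaurentSeries Filter

theorem infinite_of_solv {k κ N : Type*} [Field k] [Field κ] [Field N] [Infinite κ]
    {g : k →+* κ} {gN : k →+* N} {m : ℕ}
    (hs : ∀ (fs : Finset (MvPolynomial (Fin (m + 1)) k)) q, Solv g fs q → Solv gN fs q) :
    Infinite N := by
  classical
  by_contra hN
  have : Finite N := not_infinite_iff_finite.1 hN
  let _ := Fintype.ofFinite N
  set q := Fintype.card N with hq
  obtain ⟨a, ha⟩ := Infinite.exists_notMem_finset
    ((Polynomial.X ^ q - Polynomial.X : Polynomial κ).roots.toFinset)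
  have h1 : (Polynomial.X ^ q - Polynomial.X : Polynomial κ) ≠ 0 :=
    FiniteField.X_pow_card_sub_X_ne_zero κ Fintype.one_lt_card
  rw [Multiset.mem_toFinset, Polynomial.mem_roots h1, Polynomial.IsRoot] at ha
  obtain ⟨y, -, hy⟩ := hs ∅ (MvPolynomial.X 0 ^ q - MvPolynomial.X 0)
    ⟨fun _ => a, by simp, by simpa using ha⟩
  apply hy
  simp [hq, FiniteField.pow_card]

theorem algebraicIndependent_of_injective {k D κ ι : Type*} [Field k] [Field D] [Field κ]
    [Algebra k κ] {f : k →+* D} (i : D →+* κ) (hi : i.comp f = algebraMap k κ) {b : ι → D}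
    (hb : Function.Injective (MvPolynomial.eval₂Hom f b)) :
    AlgebraicIndependent k fun j => i (b j) := by
  have h : ∀ p, MvPolynomial.aeval (R := k) (fun j => i (b j)) p =
      i (MvPolynomial.eval₂Hom f b p) := fun p => by
    rw [MvPolynomial.aeval_def, ← hi, MvPolynomial.coe_eval₂Hom, MvPolynomial.eval₂_comp_left]
    rfl
  intro p q hpq
  rw [h, h] at hpq
  exact hb (i.injective hpq)

theorem exists_locallyEmbeds_residue {k κ N : Type u} [Field k] [Field κ] [Field N]
    {g : k →+* κ} (hg : SepHom g) {gN : k →+* N} {m : ℕ} (x : Fin (m + 1) → κ⸨X⸩)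
    (hs : ∀ (fs : Finset (MvPolynomial (Fin (m + 1)) k)) q, Solv g fs q → Solv gN fs q) :
    ∃ M : Subfield κ⸨X⸩, (∀ c : k⸨X⸩, laurentMap g c ∈ M) ∧ (∀ i, x i ∈ M) ∧
      ∃ f : k →+* laurentResField M, (∀ c, (f c : κ) = g c) ∧ LocallyEmbeds f gN := by
  classical
  let _ := g.toAlgebra
  let _ := (laurentMap g).toAlgebra
  have halg : algebraMap k⸨X⸩ κ⸨X⸩ = laurentMap (algebraMap k κ) := rfl
  let M₀ := IntermediateField.adjoin k⸨X⸩ (Set.range (x ∘ Fin.castSucc))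
  let M₁ := IntermediateField.adjoin M₀ {x (Fin.last m)}
  let M := M₁.toSubfield
  have h0 : ∀ y ∈ M₀, y ∈ M := fun y hy => M₁.algebraMap_mem ⟨y, hy⟩
  have hkM₀ : ∀ c, laurentMap g c ∈ M₀ := fun c => M₀.algebraMap_mem c
  have hkM : ∀ c, laurentMap g c ∈ M := fun c => h0 _ (hkM₀ c)
  have ht : HahnSeries.single (1 : ℤ) (1 : κ) ∈ M₀.toSubfield := by
    have := hkM₀ (HahnSeries.single 1 1)
    rwa [laurentMap_single, map_one] at this
  have hM' : ∀ y ∈ M, ∃ a b : Polynomial M₀.toSubfield,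
      b.eval₂ M₀.toSubfield.subtype (x (Fin.last m)) ≠ 0 ∧
      y * b.eval₂ M₀.toSubfield.subtype (x (Fin.last m)) =
        a.eval₂ M₀.toSubfield.subtype (x (Fin.last m)) := by
    intro y hy
    obtain ⟨a, b, hab⟩ := (IntermediateField.mem_adjoin_simple_iff M₀ y).1 hy
    by_cases hb : Polynomial.aeval (x (Fin.last m)) b = 0
    · refine ⟨0, 1, by simp, ?_⟩
      rw [hab, hb]
      simp
    · refine ⟨a, b, hb, ?_⟩
      rw [hab]
      exact div_mul_cancel₀ _ hb
  have hx : ∀ i, x i ∈ M := by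
    intro i
    induction i using Fin.lastCases with
    | last => exact IntermediateField.mem_adjoin_simple_self M₀ _
    | cast i => exact h0 _ (IntermediateField.subset_adjoin _ _ ⟨i, rfl⟩)
  have hres : ∀ (M : Subfield κ⸨X⸩), (∀ c, laurentMap g c ∈ M) → ∀ c, g c ∈ laurentResField M := by
    intro M hM c
    refine ⟨PowerSeries.C (g c), ?_, PowerSeries.constantCoeff_C _⟩
    have := hM (HahnSeries.C c)
    rwa [show laurentMap g (HahnSeries.C c) = HahnSeries.ofPowerSeries ℤ κ (PowerSeries.C (g c)) by
      rw [HahnSeries.ofPowerSeries_C]; exact laurentMap_single g _ _] at this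
  let D₀ := laurentResField M₀.toSubfield
  let f₀ : k →+* D₀ := g.codRestrict D₀ (hres _ hkM₀)
  let f : k →+* laurentResField M := g.codRestrict _ (hres _ hkM)
  refine ⟨M, hkM, hx, f, fun c => rfl, ?_⟩
  rcases exists_ruled_residue M₀.toSubfield M ht (x (Fin.last m)) hM' with h | ⟨τ, hτ, h⟩
  · have hf : SepHom f := SepHom.of_comp (g := (laurentResField M).subtype) hg
    refine LocallyEmbeds.of_solv (m := m) hf (fun d b hb => ?_)
      fun fs q h' => hs fs q (h'.map (laurentResField M).subtype (RingHom.injective _))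
    refine card_le_of_algebraicIndependent_residue halg (x ∘ Fin.castSucc) (laurentResField M) h
      (fun i => (b i : κ)) (fun i => (b i).2) ?_
    exact algebraicIndependent_of_injective (laurentResField M).subtype rfl hb
  · let A := algebraicClosure D₀ κ
    let fA : k →+* A := (algebraMap D₀ A).comp f₀
    have hfA : SepHom fA := SepHom.of_comp (g := A.val.toRingHom) hg
    have : Infinite κ := by
      by_contra hκ
      have : Finite κ := not_infinite_iff_finite.1 hκ
      exact hτ (Algebra.IsAlgebraic.isAlgebraic τ)
    have : Infinite N := infinite_of_solv hs
    have hA : LocallyEmbeds fA gN := by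
      refine LocallyEmbeds.of_solv (m := m) hfA (fun d b hb => ?_)
        fun fs q h' => hs fs q (h'.map A.val.toRingHom (RingHom.injective _))
      refine card_le_of_algebraicIndependent_residue halg (x ∘ Fin.castSucc) A.toSubfield
        (fun a ha => (mem_algebraicClosure_iff.1 ha)) (fun i => (b i : κ)) (fun i => (b i).2) ?_
      exact algebraicIndependent_of_injective A.val.toRingHom rfl hb
    refine hA.of_ruled (A.val.toRingHom) (laurentResField M).subtype (fun c => rfl) τ
      (fun P hP => ?_) fun c => h c c.2
    by_contra hP0
    have h1 : IsAlgebraic A τ := ⟨P, hP0, hP⟩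
    exact hτ (h1.restrictScalars D₀)

end Paper

namespace Paper

open LaurentSeries Filter

theorem X_pow_dvd_iff_laurentV {κ : Type*} [Field κ] (m : ℕ) (q : PowerSeries κ) :
    PowerSeries.X ^ m ∣ q ↔
      laurentV κ (HahnSeries.single (-(m : ℤ)) 1 * HahnSeries.ofPowerSeries ℤ κ q) ≤ 1 := by
  have hX : HahnSeries.single (-(m : ℤ)) (1 : κ) *
      HahnSeries.ofPowerSeries ℤ κ (PowerSeries.X ^ m) = 1 := by
    rw [HahnSeries.ofPowerSeries_X_pow, HahnSeries.single_mul_single, neg_add_cancel, one_mul]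
    rfl
  constructor
  · rintro ⟨r, rfl⟩
    rw [map_mul (HahnSeries.ofPowerSeries ℤ κ), ← mul_assoc, hX, one_mul]
    exact laurentV_ofPowerSeries_le r
  · intro h
    obtain ⟨r, hr⟩ := (LaurentSeries.val_le_one_iff_eq_coe κ _).1 h
    refine ⟨r, HahnSeries.ofPowerSeries_injective (Γ := ℤ) ?_⟩
    rw [map_mul]
    change _ = _ * ((r : PowerSeries κ) : κ⸨X⸩)
    rw [hr, ← mul_assoc, mul_comm _ (HahnSeries.single _ _), hX, one_mul]

/-- The power series contained in a field of Laurent series. -/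
noncomputable def powerSeriesSubring {κ : Type*} [Field κ] (M : Subfield κ⸨X⸩) :
    Subring (PowerSeries κ) :=
  M.toSubring.comap (HahnSeries.ofPowerSeries ℤ κ)

theorem ofPowerSeries_X_pow_mul_single {κ : Type*} [Field κ] (m : ℕ) (y : κ⸨X⸩) :
    HahnSeries.ofPowerSeries ℤ κ (PowerSeries.X ^ m) * (HahnSeries.single (-(m : ℤ)) 1 * y) = y :=
      by
  rw [HahnSeries.ofPowerSeries_X_pow, ← mul_assoc, HahnSeries.single_mul_single,
    add_neg_cancel, one_mul]
  exact one_mul _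

theorem single_mul_ofPowerSeries_X_pow_mul {κ : Type*} [Field κ] (m : ℕ) (y : κ⸨X⸩) :
    HahnSeries.single (-(m : ℤ)) 1 * (HahnSeries.ofPowerSeries ℤ κ (PowerSeries.X ^ m) * y) = y :=
      by
  rw [mul_left_comm]
  exact ofPowerSeries_X_pow_mul_single m y

section PowerSeriesSubring

variable {κ D : Type*} [Field κ] [Field D] {M : Subfield κ⸨X⸩}
  (hX : PowerSeries.X ∈ powerSeriesSubring M)

theorem single_mem_of_X_mem (hX : PowerSeries.X ∈ powerSeriesSubring M) (i : ℤ) :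
    HahnSeries.single i (1 : κ) ∈ M :=
  single_zpow_mem (by
    have : HahnSeries.ofPowerSeries ℤ κ PowerSeries.X ∈ M := hX
    rwa [HahnSeries.ofPowerSeries_X] at this) i

theorem pow_dvd_powerSeriesSubring_iff (m : ℕ) (q : powerSeriesSubring M) :
    (⟨PowerSeries.X, hX⟩ : powerSeriesSubring M) ^ m ∣ q ↔
      (PowerSeries.X : PowerSeries κ) ^ m ∣ q := by
  constructor
  · rintro ⟨r, rfl⟩
    exact ⟨r, rfl⟩
  · rintro ⟨r, hr⟩
    refine ⟨⟨r, ?_⟩, Subtype.ext hr⟩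
    change HahnSeries.ofPowerSeries ℤ κ r ∈ M
    rw [← single_mul_ofPowerSeries_X_pow_mul m (HahnSeries.ofPowerSeries ℤ κ r), ← map_mul, ← hr]
    exact M.mul_mem (single_mem_of_X_mem hX _) q.2

theorem exists_eq_single_neg_mul_of_mem (hX : PowerSeries.X ∈ powerSeriesSubring M) (y : M) :
    ∃ (m : ℕ) (q : powerSeriesSubring M), (y : κ⸨X⸩) = HahnSeries.single (-(m : ℤ)) 1 *
      HahnSeries.ofPowerSeries ℤ κ q := by
  obtain ⟨m, q, hq⟩ := exists_eq_single_neg_mul (y : κ⸨X⸩)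
  refine ⟨m, ⟨q, ?_⟩, hq⟩
  change HahnSeries.ofPowerSeries ℤ κ q ∈ M
  rw [← ofPowerSeries_X_pow_mul_single m (HahnSeries.ofPowerSeries ℤ κ q), ← hq]
  refine M.mul_mem ?_ y.2
  rw [HahnSeries.ofPowerSeries_X_pow]
  exact single_mem_of_X_mem hX _

theorem exists_extend_powerSeriesSubring (e : powerSeriesSubring M →+* PowerSeries D)
    (heX : e ⟨PowerSeries.X, hX⟩ = PowerSeries.X)
    (hed : ∀ (m : ℕ) q, PowerSeries.X ^ m ∣ e q ↔ (PowerSeries.X : PowerSeries κ) ^ m ∣ q) :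
    ∃ Ψ : M →+* D⸨X⸩, ∀ (y : M) (m : ℕ) (q : powerSeriesSubring M),
      (y : κ⸨X⸩) = HahnSeries.single (-(m : ℤ)) 1 * HahnSeries.ofPowerSeries ℤ κ q →
      Ψ y = HahnSeries.single (-(m : ℤ)) 1 * HahnSeries.ofPowerSeries ℤ D (e q) := by
  let π : powerSeriesSubring M := ⟨PowerSeries.X, hX⟩
  let ι : powerSeriesSubring M →+* M :=
    ((HahnSeries.ofPowerSeries ℤ κ).comp (powerSeriesSubring M).subtype).codRestrict M fun q => q.2
  have hιc : ∀ q, (ι q : κ⸨X⸩) = HahnSeries.ofPowerSeries ℤ κ q := fun q => rfl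
  have hι : Function.Injective ι := fun a b h =>
    Subtype.ext (HahnSeries.ofPowerSeries_injective (congrArg Subtype.val h))
  let _ := ι.toAlgebra
  have hfr : ∀ (y : M) (m : ℕ) (q : powerSeriesSubring M), (y : κ⸨X⸩) =
      HahnSeries.single (-(m : ℤ)) 1 * HahnSeries.ofPowerSeries ℤ κ q → ι (π ^ m) * y = ι q := by
    intro y m q h
    refine Subtype.ext ?_
    rw [MulMemClass.coe_mul, hιc, hιc, h, SubmonoidClass.coe_pow]
    exact ofPowerSeries_X_pow_mul_single m _
  have hπ0 : ∀ m : ℕ, π ^ m ≠ 0 := fun m => pow_ne_zero _ fun h =>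
    PowerSeries.X_ne_zero (congrArg Subtype.val h)
  have : FaithfulSMul (powerSeriesSubring M) M := (faithfulSMul_iff_algebraMap_injective _ _).2 hι
  have : IsFractionRing (powerSeriesSubring M) M := IsFractionRing.of_field _ _ fun y => by
    obtain ⟨m, q, h⟩ := exists_eq_single_neg_mul_of_mem hX y
    refine ⟨q, π ^ m, ?_⟩
    rw [eq_div_iff]
    · exact (mul_comm _ _).trans (hfr y m q h)
    · exact fun h => hπ0 m (hι (h.trans (map_zero ι).symm))
  have heinj : Function.Injective e := by
    rw [injective_iff_map_eq_zero]
    intro q hq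
    refine Subtype.ext (PowerSeries.ext fun m => ?_)
    have h1 := (hed (m + 1) q).1 (by rw [hq]; exact dvd_zero _)
    rw [PowerSeries.X_pow_dvd_iff] at h1
    exact h1 m (by omega)
  have hginj : Function.Injective ((HahnSeries.ofPowerSeries ℤ D).comp e) :=
    fun a b h => heinj (HahnSeries.ofPowerSeries_injective h)
  refine ⟨IsFractionRing.lift hginj, fun y m q h => ?_⟩
  have hΨ : ∀ q, IsFractionRing.lift (K := M) hginj (ι q) = HahnSeries.ofPowerSeries ℤ D (e q) :=
    fun q => IsFractionRing.lift_algebraMap hginj q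
  have h1 := congrArg (IsFractionRing.lift (K := M) hginj) (hfr y m q h)
  rw [map_mul, hΨ, hΨ, map_pow e, heX] at h1
  rw [← h1, single_mul_ofPowerSeries_X_pow_mul]

end PowerSeriesSubring

theorem powerSeries_hom_eq_map {k D : Type*} [Field k] [Field D] (f : k →+* D)
    (φ : PowerSeries k →+* PowerSeries D) (hC : ∀ c, φ (PowerSeries.C c) = PowerSeries.C (f c))
    (hX : φ PowerSeries.X = PowerSeries.X) : φ = PowerSeries.map f := by
  have hpoly : ∀ p : Polynomial k, φ p = PowerSeries.map f p := by
    have : φ.comp Polynomial.coeToPowerSeries.ringHom =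
        (PowerSeries.map f).comp Polynomial.coeToPowerSeries.ringHom := by
      refine Polynomial.ringHom_ext (fun c => ?_) ?_
      · simp [hC]
      · simp [hX]
    exact RingHom.congr_fun this
  refine RingHom.ext fun P => ?_
  rw [← sub_eq_zero]
  ext N
  have h1 : PowerSeries.X ^ (N + 1) ∣ P - (PowerSeries.trunc (N + 1) P : PowerSeries k) := by
    rw [PowerSeries.X_pow_dvd_iff]
    intro m hm
    rw [map_sub, Polynomial.coeff_coe, PowerSeries.coeff_trunc, if_pos hm, sub_self]
  have h2 : PowerSeries.X ^ (N + 1) ∣ φ P - PowerSeries.map f P := by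
    have : φ P - PowerSeries.map f P = φ (P - (PowerSeries.trunc (N + 1) P : PowerSeries k)) -
        PowerSeries.map f (P - (PowerSeries.trunc (N + 1) P : PowerSeries k)) := by
      rw [map_sub φ, hpoly, map_sub (PowerSeries.map f)]
      ring
    rw [this]
    refine dvd_sub ?_ ?_
    · have := map_dvd φ h1
      rwa [map_pow, hX] at this
    · have := map_dvd (PowerSeries.map f) h1
      rwa [map_pow, PowerSeries.map_X] at this
  rw [PowerSeries.X_pow_dvd_iff] at h2
  rw [h2 N (by omega), map_zero]

/-- Fields between the Laurent series over the base and the Laurent series over an extension embed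
into the Laurent series over their own residue field. -/
theorem exists_laurent_hom {k κ : Type*} [Field k] [Field κ] {g : k →+* κ} (hg : SepHom g)
    (M : Subfield κ⸨X⸩) (hM : ∀ c, laurentMap g c ∈ M) (f : k →+* laurentResField M)
    (hf : ∀ c, (f c : κ) = g c) :
    ∃ Ψ : M →+* (laurentResField M)⸨X⸩,
      (∀ c, Ψ ⟨laurentMap g c, hM c⟩ = laurentMap f c) ∧
      ∀ y, laurentV _ (Ψ y) ≤ 1 ↔ laurentV κ (y : κ⸨X⸩) ≤ 1 := by
  classical
  have hmap : ∀ P : PowerSeries k, PowerSeries.map g P ∈ powerSeriesSubring M := fun P => by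
    have := hM (HahnSeries.ofPowerSeries ℤ k P)
    rwa [laurentMap_ofPowerSeries] at this
  have hX : (PowerSeries.X : PowerSeries κ) ∈ powerSeriesSubring M := by
    simpa using hmap PowerSeries.X
  let res : powerSeriesSubring M →+* laurentResField M :=
    (PowerSeries.constantCoeff.comp (powerSeriesSubring M).subtype).codRestrict _
      fun q => ⟨q, q.2, rfl⟩
  have hresc : ∀ q : powerSeriesSubring M,
    (res q : κ) = PowerSeries.constantCoeff (q : PowerSeries κ) := fun q => rfl
  have hres : Function.Surjective res := fun ⟨c, q, hq, hc⟩ => ⟨⟨q, hq⟩, Subtype.ext hc⟩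
  let π : powerSeriesSubring M := ⟨PowerSeries.X, hX⟩
  have hker : ∀ a, res a = 0 ↔ π ∣ a := fun a => by
    rw [← pow_one π, pow_dvd_powerSeriesSubring_iff, pow_one, PowerSeries.X_dvd_iff, ← hresc]
    exact Subtype.ext_iff
  have hreg : ∀ a, π * a = 0 → a = 0 := fun a h =>
    (mul_eq_zero.1 h).resolve_left fun h => PowerSeries.X_ne_zero (congrArg Subtype.val h)
  let i : PowerSeries k →+* powerSeriesSubring M :=
    (PowerSeries.map g).codRestrict (powerSeriesSubring M) hmap
  have hif : res.comp (i.comp PowerSeries.C) = f := RingHom.ext fun c => Subtype.ext (by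
    rw [hf]
    change PowerSeries.constantCoeff (PowerSeries.map g (PowerSeries.C c)) = _
    simp)
  have hfs : SepHom f := SepHom.of_comp (g := (laurentResField M).subtype) (by
    rwa [show (laurentResField M).subtype.comp f = g from RingHom.ext hf])
  obtain ⟨S, hS⟩ := exists_expansion_of_base hres hker hreg (i.comp PowerSeries.C)
    (by rw [hif]; exact hfs)
  let e := S.expansion hker hreg
  have heX : e π = PowerSeries.X := S.expansion_self hker hreg
  have hed : ∀ (m : ℕ) q, PowerSeries.X ^ m ∣ e q ↔ (PowerSeries.X : PowerSeries κ) ^ m ∣ q :=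
    fun m q => (S.X_pow_dvd_expansion_iff hker hreg).trans (pow_dvd_powerSeriesSubring_iff hX m q)
  have hemap : e.comp i = PowerSeries.map f := by
    refine powerSeries_hom_eq_map f _ (fun c => ?_) ?_
    · refine (hS c).trans ?_
      rw [← hif]
      rfl
    · rw [← heX]
      exact congrArg e (Subtype.ext (PowerSeries.map_X g))
  obtain ⟨Ψ, hΨ⟩ := exists_extend_powerSeriesSubring hX e heX hed
  refine ⟨Ψ, fun c => ?_, fun y => ?_⟩
  · obtain ⟨m, q, rfl⟩ := exists_eq_single_neg_mul c
    rw [hΨ _ m (i q) (by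
      change laurentMap g _ = _
      rw [map_mul, laurentMap_single, map_one, laurentMap_ofPowerSeries]
      rfl), map_mul, laurentMap_single, map_one f, laurentMap_ofPowerSeries, ← hemap]
    rfl
  · obtain ⟨m, q, h⟩ := exists_eq_single_neg_mul_of_mem hX y
    rw [hΨ y m q h, h, ← X_pow_dvd_iff_laurentV, ← X_pow_dvd_iff_laurentV]
    exact hed m q

end Paper

namespace Paper

open LaurentSeries Filter

theorem laurentMap_comp {k D N : Type*} [Field k] [Field D] [Field N] (f : k →+* D) (ζ : D →+* N)
    (c : k⸨X⸩) : laurentMap ζ (laurentMap f c) = laurentMap (ζ.comp f) c := by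
  ext i
  rfl

/-- A transfer of `∃`-sentences between residue fields lifts to the fields of Laurent series over
them, up to an ultrapower. -/
theorem exists_laurent_agreement_residue {k κ N C : Type u} [Field k] [Field κ] [Field N] [Field C]
    (γ : C →+* k⸨X⸩) {g : k →+* κ} (hg : SepHom g) {gN : k →+* N} {m : ℕ}
    (hs : ∀ (fs : Finset (MvPolynomial (Fin (m + 1)) k)) q, Solv g fs q → Solv gN fs q)
    (x : Fin (m + 1) → κ⸨X⸩) :
    ∃ (I : Type u) (U : Ultrafilter I) (y : Fin (m + 1) → (Germ (U : Filter I) N)⸨X⸩),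
      ∀ p : MvPolynomial (Fin (m + 1)) C,
        (MvPolynomial.eval₂ ((laurentMap g).comp γ) x p = 0 ↔
          MvPolynomial.eval₂ ((laurentMap ((germDiag U N).comp gN)).comp γ) y p = 0) ∧
        (laurentV κ (MvPolynomial.eval₂ ((laurentMap g).comp γ) x p) ≤ 1 ↔
          laurentV _ (MvPolynomial.eval₂ ((laurentMap ((germDiag U N).comp gN)).comp γ) y p) ≤ 1)
            := by
  obtain ⟨M, hM, hx, f, hf, hemb⟩ := exists_locallyEmbeds_residue hg x hs
  obtain ⟨I, U, ζ, hζ⟩ := hemb.exists_hom_germ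
  obtain ⟨Ψ, hΨ, hΨv⟩ := exists_laurent_hom hg M hM f hf
  let Φ : M →+* (Germ (U : Filter I) N)⸨X⸩ := (laurentMap ζ).comp Ψ
  let δ : C →+* M := ((laurentMap g).comp γ).codRestrict M fun c => hM _
  let x' : Fin (m + 1) → M := fun i => ⟨x i, hx i⟩
  have hδ : Φ.comp δ = (laurentMap ((germDiag U N).comp gN)).comp γ := RingHom.ext fun c => by
    change laurentMap ζ (Ψ ⟨laurentMap g (γ c), hM _⟩) = laurentMap _ (γ c)
    rw [hΨ, laurentMap_comp, show ζ.comp f = (germDiag U N).comp gN from RingHom.ext hζ]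
  refine ⟨I, U, Φ ∘ x', fun p => ?_⟩
  have h1 : MvPolynomial.eval₂ ((laurentMap g).comp γ) x p = (MvPolynomial.eval₂ δ x' p : M) :=
    (MvPolynomial.eval₂_comp_left M.subtype δ x' p).symm
  have h2 : MvPolynomial.eval₂ ((laurentMap ((germDiag U N).comp gN)).comp γ) (Φ ∘ x') p =
      Φ (MvPolynomial.eval₂ δ x' p) := by
    rw [← hδ]
    exact (MvPolynomial.eval₂_comp_left Φ δ x' p).symm
  rw [h1, h2]
  refine ⟨?_, ?_⟩
  · rw [map_eq_zero, ZeroMemClass.coe_eq_zero]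
  · rw [← hΨv]
    have := valuation_laurentMap_le_iff ζ (Ψ (MvPolynomial.eval₂ δ x' p)) 1
    rw [map_one, map_one, map_one] at this
    exact this.symm

theorem LaurentExpansion.exists_agreement {C K κ : Type*} [Field C] [Field K] [Field κ]
    {O : ValuationSubring K} (hO : NewtonHensel O) (E : LaurentExpansion O κ) (σ : C →+* E.plus)
    (hσ : SepHom (E.α.comp σ)) {J : Type*} [Finite J] (Z : Finset (MvPolynomial J C))
    (x : J → κ⸨X⸩) :
    ∃ y : J → K, ∀ p ∈ Z,
      (MvPolynomial.eval₂ (E.α.comp σ) x p = 0 ↔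
        MvPolynomial.eval₂ (E.plus.subtype.comp σ) y p = 0) ∧
      (laurentV κ (MvPolynomial.eval₂ (E.α.comp σ) x p) ≤ 1 ↔
        MvPolynomial.eval₂ (E.plus.subtype.comp σ) y p ∈ O) := by
  obtain ⟨y, hy⟩ := exists_agreement_of_newtonHensel (laurentV κ) E.α E.plus.subtype O hO
    (fun a c h => E.valuation_lt h) E.dense σ hσ Z x
  refine ⟨y, fun p hp => ?_⟩
  obtain ⟨h1, h2⟩ := hy p hp
  by_cases h0 : MvPolynomial.eval₂ (E.α.comp σ) x p = 0
  · rw [h0, h1 h0]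
    simp [O.zero_mem]
  · obtain ⟨c, -, hc, hc0, hc'⟩ := h2 h0
    refine ⟨⟨fun h => absurd h h0, fun h => ?_⟩, ?_⟩
    · rw [h, map_zero] at hc'
      exact absurd ((map_eq_zero _).1 hc'.symm) hc0
    · rw [hc, E.valuation_le_one, ← O.valuation_le_one_iff, ← O.valuation_le_one_iff, hc']
      rfl

theorem exists_agreement_of_germ {C K I : Type*} [Field C] [Field K] {U : Ultrafilter I}
    (O : ValuationSubring K) (f : C →+* K) {J : Type*} (Z : Finset (MvPolynomial J C))
    (x : J → Germ (U : Filter I) K) :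
    ∃ y : J → K, ∀ p ∈ Z,
      (MvPolynomial.eval₂ ((germDiag U K).comp f) x p = 0 ↔ MvPolynomial.eval₂ f y p = 0) ∧
      (MvPolynomial.eval₂ ((germDiag U K).comp f) x p ∈ germSubring U O ↔
        MvPolynomial.eval₂ f y p ∈ O) := by
  obtain ⟨a, ha⟩ := exists_germ_rep x
  obtain rfl : x = fun j => (a j : Germ (U : Filter I) K) := funext ha
  have key : ∀ P : I → Prop, ∀ᶠ i in (U : Filter I), ((∀ᶠ j in (U : Filter I), P j) ↔ P i) := by
    intro P
    by_cases h : ∀ᶠ j in (U : Filter I), P j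
    · exact h.mono fun i hi => iff_of_true h hi
    · exact (Ultrafilter.eventually_not.2 h).mono fun i hi => iff_of_false h hi
  have : ∀ᶠ i in (U : Filter I), ∀ p ∈ Z,
      (MvPolynomial.eval₂ ((germDiag U K).comp f) (fun j => (a j : Germ (U : Filter I) K)) p = 0 ↔
        MvPolynomial.eval₂ f (fun j => a j i) p = 0) ∧
      (MvPolynomial.eval₂ ((germDiag U K).comp f) (fun j => (a j : Germ (U : Filter I) K)) p ∈
        germSubring U O ↔ MvPolynomial.eval₂ f (fun j => a j i) p ∈ O) := by
    rw [Filter.eventually_all_finset]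
    intro p hp
    rw [eval₂_germDiag, coe_eq_zero_iff, coe_mem_germSubring]
    exact (key _).and (key _)
  obtain ⟨i, hi⟩ := this.exists
  exact ⟨fun j => a j i, hi⟩

theorem residue_eq_zero_iff_dvd {K : Type*} [Field K] (O : ValuationSubring K) (p : O)
    (h0 : (p : K) ≠ 0) (h1 : O.valuation (p : K) < 1)
    (h : ∀ x, O.valuation x < 1 → O.valuation x ≤ O.valuation (p : K)) (a : O) :
    IsLocalRing.residue O a = 0 ↔ p ∣ a := by
  rw [IsLocalRing.residue_eq_zero_iff]
  constructor
  · intro ha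
    have h2 := h a ((ValuationSubring.valuation_lt_one_iff O a).1 ha)
    refine ⟨⟨a / p, (valuation_le_iff_div_mem O h0).1 h2⟩, Subtype.ext ?_⟩
    exact (mul_div_cancel₀ _ h0).symm
  · rintro ⟨b, rfl⟩
    exact Ideal.mul_mem_right _ _ ((ValuationSubring.valuation_lt_one_iff O p).2 h1)

end Paper

namespace Paper
open LaurentSeries Filter

theorem IsUniformizer.valuationSubring {K : Type*} [Field K] {Γ : Type*}
    [LinearOrderedCommGroupWithZero Γ] {v : Valuation K Γ} {π : K} (h : IsUniformizer v π) :
    IsUniformizer v.valuationSubring.valuation π := by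
  have e := v.isEquiv_valuation_valuationSubring
  have hlt : ∀ x, v.valuationSubring.valuation x < 1 ↔ v x < 1 := fun x =>
    (Valuation.isEquiv_iff_val_lt_one.1 e).symm
  refine ⟨?_, (hlt π).2 h.2.1, fun x hx => (e x π).1 (h.2.2 x ((hlt x).1 hx))⟩
  exact zero_lt_iff.2 ((Valuation.ne_zero_iff _).2 ((Valuation.ne_zero_iff v).1 h.1.ne'))

theorem IsUniformizer.germDiag {K : Type*} [Field K] {O : ValuationSubring K} {π : K}
    (h : IsUniformizer O.valuation π) {I : Type*} (U : Ultrafilter I) :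
    IsUniformizer (germSubring U O).valuation (germDiag U K π) := by
  have h0 : π ≠ 0 := (Valuation.ne_zero_iff _).1 h.1.ne'
  refine ⟨zero_lt_iff.2 ((Valuation.ne_zero_iff _).2 ((map_ne_zero _).2 h0)),
    (germ_valuation_lt_one_iff O).2 (Eventually.of_forall fun _ => h.2.1), fun x => ?_⟩
  refine Germ.inductionOn x fun a ha => ?_
  exact (germ_valuation_le_iff O).2 (((germ_valuation_lt_one_iff O).1 ha).mono fun i hi =>
    h.2.2 _ hi)

theorem IsUniformizer.inv_mul_mem {K : Type*} [Field K] {O : ValuationSubring K} {π : K}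
    (h : IsUniformizer O.valuation π) {y : K} (hy : y ∉ O) : (π * y)⁻¹ ∈ O := by
  have h0 : π ≠ 0 := (Valuation.ne_zero_iff _).1 h.1.ne'
  have h1 : O.valuation y⁻¹ < 1 := by
    rw [← O.valuation_le_one_iff, not_le] at hy
    rw [map_inv₀]
    exact inv_lt_one_of_one_lt₀ hy
  have := (valuation_le_iff_div_mem O h0).1 (h.2.2 _ h1)
  rwa [mul_inv, mul_comm, ← div_eq_mul_inv]

theorem algebraMap_mem_iff {C : Type*} [Field C] {Γ₀ : Type*} [LinearOrderedCommGroupWithZero Γ₀]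
    {u : Valuation C Γ₀} {K : Type*} [Field K] [Algebra C K] {Γ : Type*}
    [LinearOrderedCommGroupWithZero Γ] {v : Valuation K Γ}
    (h : (v.comap (algebraMap C K)).IsEquiv u) (c : C) :
    algebraMap C K c ∈ v.valuationSubring ↔ u c ≤ 1 :=
  Valuation.isEquiv_iff_val_le_one.1 h

/-- Theorem `thm:En`(1b) of the paper.
With `(C, u)` equicharacteristic `ℤ`-valued with excellent valuation ring and uniformizer `π`,
and `(K, v)`, `(L, w)` henselian extensions with uniformizer `π` and separable residue
extensions: if `(R4_{n+1})` holds and `Th_{∃_n}(Kv, Cu) ⊆ Th_{∃_n}(Lw, Cu)`, then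
`Th_{∃_n}(K, v, C) ⊆ Th_{∃_n}(L, w, C)` as `L_val(C)`-theories. -/
theorem statement1 (n : ℕ)
    (C : Type u) [Field C] (u : Valuation C Zm0) (hZ : Function.Surjective u)
    (hequichar : ringChar C = ringChar (ResF u))
    (π : C) (hπu : IsUniformizer u π)
    (hexc : ExcellentCompletion C u)
    (K : Type u) [Field K] [Algebra C K]
    (ΓK : Type u) [LinearOrderedCommGroupWithZero ΓK] (v : Valuation K ΓK)
    (hKC : (v.comap (algebraMap C K)).IsEquiv u)
    (hKhens : IsHenselian v) (hπv : IsUniformizer v (algebraMap C K π))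
    (L : Type u) [Field L] [Algebra C L]
    (ΓL : Type u) [LinearOrderedCommGroupWithZero ΓL] (w : Valuation L ΓL)
    (hLC : (w.comap (algebraMap C L)).IsEquiv u)
    (hLhens : IsHenselian w) (hπw : IsUniformizer w (algebraMap C L π))
    (gK : ResF u →+* ResF v) (hgK : ResCompat u v gK) (hsepK : IsSepExtHom gK)
    (gL : ResF u →+* ResF w) (hgL : ResCompat u w gL) (hsepL : IsSepExtHom gL)
    -- `(R4_{n+1})`
    (hR4 : R4N.{u} (n + 1))
    -- `Th_{∃_n}(Kv, Cu) ⊆ Th_{∃_n}(Lw, Cu)`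
    (hres : ThRingSub (fun {k} φ => IsExistsN n φ) (ResF v) gK (ResF w) gL) :
    -- `Th_{∃_n}(K, v, C) ⊆ Th_{∃_n}(L, w, C)`
    ThValSub (fun {k} φ => IsExistsN n φ) K (Oset v) (algebraMap C K)
      L (Oset w) (algebraMap C L) := by
  refine thValSub_of_agreement _ _ _ _ fun Z x => ?_
  obtain _ | m := n
  · refine ⟨Fin.elim0, fun p _ => ?_⟩
    rw [MvPolynomial.eq_C_of_isEmpty p, MvPolynomial.eval₂_C, MvPolynomial.eval₂_C, map_eq_zero,
      map_eq_zero]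
    exact ⟨Iff.rfl, (algebraMap_mem_iff hKC _).trans (algebraMap_mem_iff hLC _).symm⟩
  obtain ⟨γ, hγ, hγπ, hexp⟩ := exists_expansions u hequichar π hπu hexc
  have hgKs := SepHom.of_isSepExtHom hsepK
  have hgLs := SepHom.of_isSepExtHom hsepL
  have hπ0 : π ≠ 0 := (Valuation.ne_zero_iff u).1 hπu.1.ne'
  obtain ⟨E, σ, hσ, hEσ⟩ := hexp K (algebraMap C K) v.valuationSubring (algebraMap_mem_iff hKC)
    (ResF v) (resMap v) IsLocalRing.residue_surjective hπv.residue_eq_zero_iff gK hgKs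
    fun c => hgK c _
  have hσ' : E.plus.subtype.comp σ = algebraMap C K := RingHom.ext hσ
  have hπv' := hπv.valuationSubring
  obtain ⟨x₁, hx₁⟩ := exists_laurent_agreement hR4 v.valuationSubring
    (newtonHensel_of_henselianLocalRing _ hKhens) E σ
    (by rw [hEσ]; exact SepHom.comp hγ hgKs.laurentMap) π hπ0 (by rw [hσ]; exact hπv'.2.1)
    (fun y hy => by rw [hσ]; exact hπv'.inv_mul_mem hy)
    (by
      have := RingHom.congr_fun hEσ π
      simp only [RingHom.comp_apply, hγπ, laurentMap_single, map_one] at this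
      exact this) Z x
  have hsolv : ∀ (fs : Finset (MvPolynomial (Fin (m + 1)) (ResF u))) q,
      Solv gK fs q → Solv gL fs q := by
    intro fs q h
    obtain ⟨φ, hφ, hφ'⟩ := exists_sentence_solv fs q
    exact (hφ' _ gL).1 (hres φ (.base hφ) ((hφ' _ gK).2 h))
  obtain ⟨I, U, y, hy⟩ := exists_laurent_agreement_residue γ hgKs hsolv x₁
  have hO₂ : ∀ c, ((germDiag U L).comp (algebraMap C L)) c ∈ germSubring U w.valuationSubring ↔
      u c ≤ 1 := fun c => (germDiag_mem_germSubring _).trans (algebraMap_mem_iff hLC c)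
  have hπ₂ := hπw.valuationSubring.germDiag U
  have hsep₂ : SepHom ((germDiag U (ResF w)).comp gL) := SepHom.comp hgLs sepHom_germDiag
  obtain ⟨E₂, σ₂, hσ₂, hEσ₂⟩ := hexp (Germ (U : Filter I) L)
    ((germDiag U L).comp (algebraMap C L)) (germSubring U w.valuationSubring) hO₂
    (Germ (U : Filter I) (ResF w))
    ((germResidue U w.valuationSubring).comp (IsLocalRing.residue _))
    ((germResidue_surjective w.valuationSubring).comp IsLocalRing.residue_surjective)
    (fun a => by
      rw [RingHom.comp_apply, map_eq_zero]
      exact residue_eq_zero_iff_dvd _ _ ((Valuation.ne_zero_iff _).1 hπ₂.1.ne') hπ₂.2.1 hπ₂.2.2 a)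
    ((germDiag U (ResF w)).comp gL) hsep₂
    (fun c => by
      have hc := (algebraMap_mem_iff hLC c).2 c.2
      rw [RingHom.comp_apply, hgL c hc]
      refine Eq.trans ?_ (germResidue_coe (U := U) w.valuationSubring
        (a := fun _ => algebraMap C L c) ((germDiag_mem_germSubring _).2 hc)).symm
      rw [resFun_of_mem _ hc]
      rfl)
  have hσ₂' : E₂.plus.subtype.comp σ₂ = (germDiag U L).comp (algebraMap C L) := RingHom.ext hσ₂
  have hnewton : NewtonHensel w.valuationSubring := newtonHensel_of_henselianLocalRing _ hLhens
  obtain ⟨z, hz⟩ := LaurentExpansion.exists_agreement hnewton.germ E₂ σ₂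
    (by rw [hEσ₂]; exact SepHom.comp hγ hsep₂.laurentMap) Z y
  obtain ⟨y', hy'⟩ := exists_agreement_of_germ w.valuationSubring (algebraMap C L) Z z
  rw [hσ', hEσ] at hx₁
  rw [hσ₂', hEσ₂] at hz
  refine ⟨y', fun p hp => ⟨?_, ?_⟩⟩
  · exact (((hx₁ p hp).1.trans (hy p).1).trans (hz p hp).1).trans (hy' p hp).1
  · exact (((hx₁ p hp).2.trans (hy p).2).trans (hz p hp).2).trans (hy' p hp).2

end Paper
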